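/- Let N ≥ 4 and let p satisfy 1 < p < (N+1)/(N-3). Then there exists α₀ > 0 such that for every α > α₀, the Hénon problem -Δu = |x|^α u^p in B, u > 0 in B, u = 0 on ∂B, has at least ⌊N/2⌋ - 1 pairwise distinct classical solutions, none of which is radially symmetric: there exist functions u₁, …, u_k with k = ⌊N/2⌋ - 1, each continuous on B̄, twice continuously differentiable on B, positive in B, vanishing on ∂B, satisfying -Δu_i(x) = |x|^α u_i(x)^p in B, with u_i ≠ u_j for i ≠ j, and for each i there exist x, y ∈ B with |x| = |y| and u_i(x) ≠ u_i(y). -/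

import Mathlib

open MeasureTheory Metric Set Filter

noncomputable section

abbrev E (N : ℕ) := EuclideanSpace ℝ (Fin N)

/-- The Laplacian: sum of pure second partial derivatives. -/
def lap {N : ℕ} (u : E N → ℝ) (x : E N) : ℝ :=
  ∑ i, fderiv ℝ (fun y => fderiv ℝ u y (EuclideanSpace.single i 1)) x (EuclideanSpace.single i 1)


open scoped ENNReal NNReal Topology

/-! ## Part 1: the Green kernel of the ball (unnormalised) and its regularisations -/

/-- The exponent `(N-2)/2`. -/
def mm (N : ℕ) : ℝ := ((N : ℝ) - 2) / 2

lemma mm_pos {N : ℕ} (hN : 4 ≤ N) : 1 ≤ mm N := by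
  have : (4 : ℝ) ≤ N := by exact_mod_cast hN
  unfold mm; linarith

/-- The quadratic polynomial of the regular part of the Green function. -/
def QH {N : ℕ} (x y : E N) : ℝ := 1 - 2 * inner ℝ x y + ‖x‖ ^ 2 * ‖y‖ ^ 2

lemma QH_eq {N : ℕ} (x y : E N) :
    QH x y = ‖x - y‖ ^ 2 + (1 - ‖x‖ ^ 2) * (1 - ‖y‖ ^ 2) := by
  rw [QH, norm_sub_sq_real]; ring

lemma QH_ge {N : ℕ} (x y : E N) : (1 - ‖x‖ * ‖y‖) ^ 2 ≤ QH x y := by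
  have := real_inner_le_norm x y
  rw [QH]; nlinarith

lemma QH_nonneg {N : ℕ} (x y : E N) : 0 ≤ QH x y := (sq_nonneg _).trans (QH_ge x y)

lemma QH_symm {N : ℕ} (x y : E N) : QH x y = QH y x := by
  simp only [QH, real_inner_comm]; ring

/-- Regularised Green kernel; `Ge 0` is the Green kernel itself off the diagonal. -/
def Ge {N : ℕ} (ε : ℝ) (x y : E N) : ℝ :=
  (‖x - y‖ ^ 2 + ε) ^ (-mm N) - (QH x y + ε) ^ (-mm N)

lemma Ge_symm {N : ℕ} (ε : ℝ) (x y : E N) : Ge ε x y = Ge ε y x := by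
  rw [Ge, Ge, QH_symm, norm_sub_rev]

lemma Ge_isom {N : ℕ} (ε : ℝ) (g : E N ≃ₗᵢ[ℝ] E N) (x y : E N) :
    Ge ε (g x) (g y) = Ge ε x y := by
  rw [Ge, Ge, QH, QH, ← map_sub, g.norm_map, g.norm_map, g.norm_map, g.inner_map_map]

lemma Ge_continuous {N : ℕ} {ε : ℝ} (hε : 0 < ε) :
    Continuous (fun z : E N × E N => Ge ε z.1 z.2) := by
  have h1 : ∀ z : E N × E N, ‖z.1 - z.2‖ ^ 2 + ε ≠ 0 := fun z => by positivity
  have h2 : ∀ z : E N × E N, QH z.1 z.2 + ε ≠ 0 := fun z => by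
    have := QH_nonneg z.1 z.2; positivity
  unfold Ge
  refine Continuous.sub ?_ ?_
  · exact Continuous.rpow_const (by fun_prop) (fun z => Or.inl (h1 z))
  · refine Continuous.rpow_const ?_ (fun z => Or.inl (h2 z))
    unfold QH; fun_prop

/-- Elementary: `s ↦ s^{-m} - (s+h)^{-m}` is nonincreasing. -/
lemma rpow_diff_anti {m s t h : ℝ} (hm : 0 < m) (hs : 0 < s) (hst : s ≤ t) (hh : 0 ≤ h) :
    t ^ (-m) - (t + h) ^ (-m) ≤ s ^ (-m) - (s + h) ^ (-m) := by
  have ht : 0 < t := hs.trans_le hst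
  have hanti : AntitoneOn (fun s : ℝ => s ^ (-m) - (s + h) ^ (-m)) (Ici s) := by
    refine antitoneOn_of_deriv_nonpos (convex_Ici s) ?_ ?_ ?_
    · intro x hx
      have hx0 : 0 < x := hs.trans_le hx
      refine ContinuousAt.continuousWithinAt ?_
      refine ContinuousAt.sub ?_ ?_
      · exact continuousAt_id.rpow_const (Or.inl hx0.ne')
      · exact (continuousAt_id.add continuousAt_const).rpow_const
          (Or.inl (show x + h ≠ 0 by positivity))
    · intro x hx
      have hx0 : 0 < x := by rw [interior_Ici] at hx; exact hs.trans hx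
      have h1 : HasDerivAt (fun s : ℝ => s ^ (-m) - (s + h) ^ (-m))
          (1 * (-m) * x ^ (-m - 1) - 1 * (-m) * (x + h) ^ (-m - 1)) x :=
        ((hasDerivAt_id x).rpow_const (Or.inl hx0.ne')).sub
          (((hasDerivAt_id x).add_const h).rpow_const (Or.inl (by simp only [id]; positivity)))
      exact h1.differentiableAt.differentiableWithinAt
    · intro x hx
      have hx0 : 0 < x := by rw [interior_Ici] at hx; exact hs.trans hx
      have h1 : HasDerivAt (fun s : ℝ => s ^ (-m) - (s + h) ^ (-m))
          (1 * (-m) * x ^ (-m - 1) - 1 * (-m) * (x + h) ^ (-m - 1)) x :=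
        ((hasDerivAt_id x).rpow_const (Or.inl hx0.ne')).sub
          (((hasDerivAt_id x).add_const h).rpow_const (Or.inl (by simp only [id]; positivity)))
      rw [h1.deriv]
      have h2 : (x + h) ^ (-m - 1) ≤ x ^ (-m - 1) :=
        Real.rpow_le_rpow_of_nonpos hx0 (by linarith) (by linarith)
      nlinarith
  exact hanti (mem_Ici.2 le_rfl) (mem_Ici.2 hst) hst

lemma one_add_mul_le_rpow_of_nonpos {z m : ℝ} (hz : 0 ≤ z) (hm : m ≤ 0) :
    1 + m * z ≤ (1 + z) ^ m := by
  have h := Real.add_one_le_exp (m * Real.log (1 + z))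
  rw [Real.rpow_def_of_pos (by linarith), mul_comm (Real.log _)]
  have h2 : Real.log (1 + z) ≤ z := by
    have := Real.log_le_sub_one_of_pos (show 0 < 1 + z by linarith); linarith
  nlinarith

/-- Elementary: `s^{-m} - (s+h)^{-m} ≤ (max 1 m) h^θ s^{-m-θ}`. -/
lemma rpow_diff_le {m s h θ : ℝ} (hm : 1 ≤ m) (hs : 0 < s) (hh : 0 < h)
    (hθ : 0 < θ) (hθ1 : θ ≤ 1) :
    s ^ (-m) - (s + h) ^ (-m) ≤ m * h ^ θ * s ^ (-m - θ) := by
  have key : s ^ (-m - θ) = s ^ (-m) * s ^ (-θ) := by rw [← Real.rpow_add hs]; ring_nf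
  have hsm : 0 < s ^ (-m) := Real.rpow_pos_of_pos hs _
  have e : m * h ^ θ * s ^ (-m - θ) = s ^ (-m) * (m * (h / s) ^ θ) := by
    have hst : 0 < s ^ θ := Real.rpow_pos_of_pos hs _
    rw [key, Real.div_rpow hh.le hs.le, Real.rpow_neg hs.le θ]; field_simp
  have e2 : s ^ (-m) - (s + h) ^ (-m) = s ^ (-m) * (1 - (1 + h / s) ^ (-m)) := by
    have : s + h = s * (1 + h / s) := by field_simp
    rw [this, Real.mul_rpow hs.le (by positivity)]; ring
  rw [e, e2]
  refine mul_le_mul_of_nonneg_left ?_ hsm.le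
  set z := h / s with hz
  have hz0 : 0 < z := by positivity
  have hpos : 0 < (1 + z) ^ (-m) := by positivity
  by_cases h1 : 1 ≤ z
  · have : 1 ≤ z ^ θ := Real.one_le_rpow h1 hθ.le
    nlinarith
  · push Not at h1
    have h2 : z ≤ z ^ θ := by
      conv_lhs => rw [← Real.rpow_one z]
      exact Real.rpow_le_rpow_of_exponent_ge hz0 h1.le hθ1
    have h3 : 1 + (-m) * z ≤ (1 + z) ^ (-m) :=
      one_add_mul_le_rpow_of_nonpos hz0.le (by linarith)
    nlinarith
section ball
variable {N : ℕ}

lemma prod_nonneg_of_ball {x y : E N} (hx : ‖x‖ ≤ 1) (hy : ‖y‖ ≤ 1) :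
    0 ≤ (1 - ‖x‖ ^ 2) * (1 - ‖y‖ ^ 2) := by
  apply mul_nonneg <;> nlinarith [norm_nonneg x, norm_nonneg y]

lemma Ge_nonneg (hN : 4 ≤ N) {ε : ℝ} {x y : E N} (hx : ‖x‖ ≤ 1) (hy : ‖y‖ ≤ 1)
    (h : 0 < ‖x - y‖ ^ 2 + ε) : 0 ≤ Ge ε x y := by
  rw [Ge, sub_nonneg]
  have := prod_nonneg_of_ball hx hy
  refine Real.rpow_le_rpow_of_nonpos h ?_ (by have := mm_pos hN; linarith)
  rw [QH_eq]; linarith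

lemma Ge_pos (hN : 4 ≤ N) {ε : ℝ} {x y : E N} (hx : ‖x‖ < 1) (hy : ‖y‖ < 1)
    (h : 0 < ‖x - y‖ ^ 2 + ε) : 0 < Ge ε x y := by
  rw [Ge, sub_pos]
  have : 0 < (1 - ‖x‖ ^ 2) * (1 - ‖y‖ ^ 2) := by
    apply mul_pos <;> nlinarith [norm_nonneg x, norm_nonneg y]
  refine Real.rpow_lt_rpow_of_neg h ?_ (by have := mm_pos hN; linarith)
  rw [QH_eq]; linarith

lemma Ge_boundary {ε : ℝ} {x y : E N} (hx : ‖x‖ = 1) : Ge ε x y = 0 := by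
  rw [Ge, QH_eq, hx]; simp

lemma Ge_mono (hN : 4 ≤ N) {ε ε' : ℝ} {x y : E N} (hx : ‖x‖ ≤ 1) (hy : ‖y‖ ≤ 1)
    (h : 0 < ‖x - y‖ ^ 2 + ε) (hε : ε ≤ ε') : Ge ε' x y ≤ Ge ε x y := by
  have hp := prod_nonneg_of_ball hx hy
  have := rpow_diff_anti (m := mm N) (s := ‖x - y‖ ^ 2 + ε) (t := ‖x - y‖ ^ 2 + ε')
    (by have := mm_pos hN; linarith) h (by linarith) hp
  rw [Ge, Ge, QH_eq]
  convert this using 3 <;> ring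

lemma Ge_sub_le (hN : 4 ≤ N) {ε ε' θ : ℝ} {x y : E N} (hx : ‖x‖ ≤ 1) (hy : ‖y‖ ≤ 1)
    (hxy : x ≠ y) (hε : 0 ≤ ε) (hε' : 0 < ε') (hεε' : ε ≤ ε') (hθ : 0 < θ) (hθ1 : θ ≤ 1) :
    Ge ε x y - Ge ε' x y ≤ mm N * ε' ^ θ * ‖x - y‖ ^ (-((N : ℝ) - 2 + 2 * θ)) := by
  have hm := mm_pos hN
  have hd : 0 < ‖x - y‖ := norm_pos_iff.2 (sub_ne_zero.2 hxy)
  have hp := prod_nonneg_of_ball hx hy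
  have hq : 0 < QH x y := by rw [QH_eq]; positivity
  have h1 := rpow_diff_le (m := mm N) (s := ‖x - y‖ ^ 2) (h := ε') hm (by positivity) hε' hθ hθ1
  have h2 : (‖x - y‖ ^ 2) ^ (-mm N - θ) = ‖x - y‖ ^ (-((N : ℝ) - 2 + 2 * θ)) := by
    rw [← Real.rpow_natCast, ← Real.rpow_mul hd.le]; congr 1; unfold mm; push_cast; ring
  have h3 : (QH x y + ε') ^ (-mm N) ≤ (QH x y + ε) ^ (-mm N) :=
    Real.rpow_le_rpow_of_nonpos (by linarith) (by linarith) (by linarith)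
  have h4 : (‖x - y‖ ^ 2 + ε) ^ (-mm N) ≤ (‖x - y‖ ^ 2) ^ (-mm N) :=
    Real.rpow_le_rpow_of_nonpos (by positivity) (by linarith) (by linarith)
  rw [h2] at h1
  rw [Ge, Ge]; linarith

lemma Ge_le_one (hN : 4 ≤ N) (x y : E N) : Ge 1 x y ≤ 1 := by
  have hm := mm_pos hN
  have h1 : (‖x - y‖ ^ 2 + 1) ^ (-mm N) ≤ 1 :=
    Real.rpow_le_one_of_one_le_of_nonpos (by nlinarith [sq_nonneg ‖x - y‖]) (by linarith)
  have h2 : 0 ≤ (QH x y + 1) ^ (-mm N) := by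
    have := QH_nonneg x y; positivity
  rw [Ge]; linarith

/-- Lower bound for the Green kernel at distance comparable to the distance to the boundary. -/
lemma Ge_lower (hN : 4 ≤ N) {ε h : ℝ} {x y : E N} (hh : 0 < h) (hx : ‖x‖ ≤ 1 - h)
    (hy : ‖y‖ ≤ 1 - h) (hxy : ‖x - y‖ ≤ 2 * h) (hε : 0 < ε) (hεh : ε ≤ h ^ 2) :
    ((5 : ℝ) ^ (-mm N) - 6 ^ (-mm N)) * h ^ (-((N : ℝ) - 2)) ≤ Ge ε x y := by
  have hm := mm_pos hN
  have hP : h ^ 2 ≤ (1 - ‖x‖ ^ 2) * (1 - ‖y‖ ^ 2) := by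
    have h1 : h ≤ 1 - ‖x‖ ^ 2 := by nlinarith [norm_nonneg x]
    have h2 : h ≤ 1 - ‖y‖ ^ 2 := by nlinarith [norm_nonneg y]
    nlinarith
  have hd : ‖x - y‖ ^ 2 ≤ 4 * h ^ 2 := by nlinarith [norm_nonneg (x - y)]
  have h1 := rpow_diff_anti (m := mm N) (s := ‖x - y‖ ^ 2 + ε) (t := 5 * h ^ 2)
    (h := h ^ 2) (by linarith) (by positivity) (by linarith) (by positivity)
  have h2 : (QH x y + ε) ^ (-mm N) ≤ (‖x - y‖ ^ 2 + ε + h ^ 2) ^ (-mm N) :=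
    Real.rpow_le_rpow_of_nonpos (by positivity) (by rw [QH_eq]; linarith) (by linarith)
  have h3 : (h ^ 2) ^ (-mm N) = h ^ (-((N : ℝ) - 2)) := by
    rw [← Real.rpow_natCast, ← Real.rpow_mul hh.le]; congr 1; unfold mm; push_cast; ring
  have h4 : (5 * h ^ 2 + h ^ 2) = 6 * h ^ 2 := by ring
  rw [h4, Real.mul_rpow (by norm_num) (by positivity), Real.mul_rpow (by norm_num) (by positivity),
    h3] at h1
  rw [Ge]; linarith

lemma const56_pos (hN : 4 ≤ N) : 0 < (5 : ℝ) ^ (-mm N) - 6 ^ (-mm N) := by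
  have hm := mm_pos hN
  have := Real.rpow_lt_rpow_of_neg (x := 5) (y := 6) (z := -mm N) (by norm_num) (by norm_num)
    (by linarith)
  linarith

/-- The sequence of regularisation parameters. -/
def epsj (j : ℕ) : ℝ := 1 / ((j : ℝ) + 1)

lemma epsj_pos (j : ℕ) : 0 < epsj j := by unfold epsj; positivity

lemma epsj_anti : Antitone epsj := by
  intro i j h
  unfold epsj
  have : (i : ℝ) ≤ j := by exact_mod_cast h
  exact one_div_le_one_div_of_le (by positivity) (by linarith)

lemma epsj_zero : epsj 0 = 1 := by simp [epsj]

lemma epsj_tendsto : Tendsto epsj atTop (𝓝 0) := tendsto_one_div_add_atTop_nhds_zero_nat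

/-- Extended-valued Green kernel. -/
def GE (x y : E N) : ℝ≥0∞ := ⨆ j : ℕ, ENNReal.ofReal (Ge (epsj j) x y)

lemma GE_symm (x y : E N) : GE x y = GE y x := by
  unfold GE; simp_rw [Ge_symm _ x y]

lemma GE_isom (g : E N ≃ₗᵢ[ℝ] E N) (x y : E N) : GE (g x) (g y) = GE x y := by
  unfold GE; simp_rw [Ge_isom]

lemma GEj_measurable (j : ℕ) :
    Measurable (fun z : E N × E N => ENNReal.ofReal (Ge (epsj j) z.1 z.2)) :=
  (Ge_continuous (epsj_pos j)).measurable.ennreal_ofReal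

lemma GE_measurable : Measurable (fun z : E N × E N => GE z.1 z.2) := by
  unfold GE; exact Measurable.iSup fun j => GEj_measurable j

lemma GEj_mono (hN : 4 ≤ N) {x y : E N} (hx : ‖x‖ ≤ 1) (hy : ‖y‖ ≤ 1) :
    Monotone (fun j => ENNReal.ofReal (Ge (epsj j) x y)) := by
  intro i j hij
  apply ENNReal.ofReal_le_ofReal
  exact Ge_mono hN hx hy (by have := epsj_pos j; positivity) (epsj_anti hij)

/-- The Riesz-type kernel. -/
def rk (s : ℝ) (x y : E N) : ℝ≥0∞ := (‖x - y‖ₑ⁻¹) ^ s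

lemma rk_measurable (s : ℝ) : Measurable (fun z : E N × E N => rk s z.1 z.2) := by
  unfold rk; fun_prop

lemma rk_of_ne {s : ℝ} {x y : E N} (hxy : x ≠ y) :
    rk s x y = ENNReal.ofReal (‖x - y‖ ^ (-s)) := by
  have hd : 0 < ‖x - y‖ := norm_pos_iff.2 (sub_ne_zero.2 hxy)
  rw [rk, ← ofReal_norm, ← ENNReal.ofReal_inv_of_pos hd,
    ENNReal.ofReal_rpow_of_pos (by positivity), Real.inv_rpow hd.le, Real.rpow_neg hd.le]

lemma rk_self {s : ℝ} (hs : 0 < s) (x : E N) : rk s x x = ⊤ := by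
  simp [rk, hs]

lemma GE_le_add (hN : 4 ≤ N) {θ : ℝ} {x y : E N} (hx : ‖x‖ ≤ 1) (hy : ‖y‖ ≤ 1)
    (hθ : 0 < θ) (hθ1 : θ ≤ 1) (j : ℕ) :
    GE x y ≤ ENNReal.ofReal (Ge (epsj j) x y)
      + ENNReal.ofReal (mm N * epsj j ^ θ) * rk ((N : ℝ) - 2 + 2 * θ) x y := by
  have hm := mm_pos hN
  have hN' : (4 : ℝ) ≤ N := by exact_mod_cast hN
  have he := epsj_pos j
  by_cases hxy : x = y
  · subst hxy
    rw [rk_self (by linarith), ENNReal.mul_top]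
    · simp
    · simp only [ne_eq, ENNReal.ofReal_eq_zero, not_le]; positivity
  rw [rk_of_ne hxy, ← ENNReal.ofReal_mul (by positivity),
    ← ENNReal.ofReal_add (Ge_nonneg hN hx hy (by positivity)) (by positivity)]
  refine iSup_le fun i => ENNReal.ofReal_le_ofReal ?_
  rcases le_total j i with h | h
  · have := Ge_sub_le hN hx hy hxy (epsj_pos i).le he (epsj_anti h) hθ hθ1
    linarith
  · have h1 := Ge_mono hN hx hy (by positivity : 0 < ‖x - y‖ ^ 2 + epsj j) (epsj_anti h)
    have : 0 ≤ mm N * epsj j ^ θ * ‖x - y‖ ^ (-((N : ℝ) - 2 + 2 * θ)) := by positivity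
    linarith

lemma rk_ge (x y : E N) (hx : ‖x‖ ≤ 1) (hy : ‖y‖ ≤ 1) {s : ℝ} (hs : 0 < s) :
    ENNReal.ofReal (2 ^ (-s)) ≤ rk s x y := by
  by_cases hxy : x = y
  · subst hxy; rw [rk_self hs]; exact le_top
  rw [rk_of_ne hxy]
  have hd : 0 < ‖x - y‖ := norm_pos_iff.2 (sub_ne_zero.2 hxy)
  apply ENNReal.ofReal_le_ofReal
  exact Real.rpow_le_rpow_of_nonpos hd ((norm_sub_le x y).trans (by linarith)) (by linarith)

lemma GE_le_rk (hN : 4 ≤ N) {θ : ℝ} {x y : E N} (hx : ‖x‖ ≤ 1) (hy : ‖y‖ ≤ 1)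
    (hθ : 0 < θ) (hθ1 : θ ≤ 1) :
    GE x y ≤ ENNReal.ofReal (2 ^ ((N : ℝ) - 2 + 2 * θ) + mm N) * rk ((N : ℝ) - 2 + 2 * θ) x y := by
  have hm := mm_pos hN
  have hN' : (4 : ℝ) ≤ N := by exact_mod_cast hN
  refine (GE_le_add hN hx hy hθ hθ1 0).trans ?_
  rw [epsj_zero, Real.one_rpow, mul_one, ENNReal.ofReal_add (by positivity) (by linarith), add_mul]
  gcongr
  refine (ENNReal.ofReal_le_ofReal (Ge_le_one hN x y)).trans ?_
  have h := rk_ge x y hx hy (s := (N : ℝ) - 2 + 2 * θ) (by linarith)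
  calc ENNReal.ofReal 1 = ENNReal.ofReal (2 ^ ((N : ℝ) - 2 + 2 * θ))
        * ENNReal.ofReal (2 ^ (-((N : ℝ) - 2 + 2 * θ))) := by
        rw [← ENNReal.ofReal_mul (by positivity), ← Real.rpow_add (by norm_num)]; simp
    _ ≤ _ := by gcongr

lemma Ge_tendsto {x y : E N} (hx : ‖x‖ ≤ 1) (hy : ‖y‖ ≤ 1) (hxy : x ≠ y) :
    Tendsto (fun j => Ge (epsj j) x y) atTop (𝓝 (Ge 0 x y)) := by
  have hd : 0 < ‖x - y‖ := norm_pos_iff.2 (sub_ne_zero.2 hxy)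
  have hp := prod_nonneg_of_ball hx hy
  have hq : 0 < QH x y := by rw [QH_eq]; positivity
  have : ContinuousAt (fun ε => Ge ε x y) 0 := by
    unfold Ge
    refine ContinuousAt.sub ?_ ?_
    · exact (continuousAt_const.add continuousAt_id).rpow_const (Or.inl (by simp [hd.ne']))
    · exact (continuousAt_const.add continuousAt_id).rpow_const (Or.inl (by simp [hq.ne']))
  exact this.tendsto.comp epsj_tendsto

lemma GE_eq (hN : 4 ≤ N) {x y : E N} (hx : ‖x‖ ≤ 1) (hy : ‖y‖ ≤ 1) (hxy : x ≠ y) :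
    GE x y = ENNReal.ofReal (Ge 0 x y) := by
  refine tendsto_nhds_unique (tendsto_atTop_iSup (GEj_mono hN hx hy)) ?_
  exact (ENNReal.continuous_ofReal.tendsto _).comp (Ge_tendsto hx hy hxy)

end ball

/-! ### Part 2a: integrals of the reduced kernels -/

def ff (b t : ℝ) : ℝ≥0∞ := (‖t‖ₑ⁻¹) ^ b

lemma ff_measurable (b : ℝ) : Measurable (ff b) := by unfold ff; fun_prop

lemma ff_neg (b t : ℝ) : ff b (-t) = ff b t := by simp [ff]

lemma ff_of_ne {b t : ℝ} (ht : t ≠ 0) : ff b t = ENNReal.ofReal (|t| ^ (-b)) := by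
  have hd : 0 < |t| := abs_pos.2 ht
  rw [ff, ← ofReal_norm, Real.norm_eq_abs, ← ENNReal.ofReal_inv_of_pos hd,
    ENNReal.ofReal_rpow_of_pos (by positivity), Real.inv_rpow hd.le, Real.rpow_neg hd.le]

/-- the one dimensional constant -/
def C1 (b : ℝ) : ℝ≥0∞ := ∫⁻ t in Ioo (-2 : ℝ) 2, ff b t

lemma ff_int_pos {b : ℝ} (hb : b < 1) (R : ℝ) : ∫⁻ t in Ioo (0 : ℝ) R, ff b t < ⊤ := by
  rcases le_or_gt R 0 with hR | hR
  · simp [Ioo_eq_empty_of_le hR]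
  have h1 : ∫⁻ t in Ioo (0 : ℝ) R, ff b t = ∫⁻ t in Ioo (0 : ℝ) R, ENNReal.ofReal (t ^ (-b)) := by
    refine setLIntegral_congr_fun measurableSet_Ioo fun t ht => ?_
    rw [ff_of_ne ht.1.ne', abs_of_pos ht.1]
  rw [h1]
  have h2 : IntegrableOn (fun t : ℝ => t ^ (-b)) (Ioo 0 R) :=
    (intervalIntegral.integrableOn_Ioo_rpow_iff hR).2 (by linarith)
  exact h2.lintegral_lt_top

lemma C1_lt_top {b : ℝ} (hb : b < 1) : C1 b < ⊤ := by
  have hsub : Ioo (-2 : ℝ) 2 ⊆ (Ioo (-2) 0 ∪ Ioo 0 2) ∪ {0} := by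
    intro t ht
    rcases lt_trichotomy t 0 with h | h | h
    · left; left; exact ⟨ht.1, h⟩
    · right; exact h
    · left; right; exact ⟨h, ht.2⟩
  have h0 : ∫⁻ t in Ioo (-2 : ℝ) 0, ff b t = ∫⁻ t in Ioo (0 : ℝ) 2, ff b t := by
    have := (Measure.measurePreserving_neg (volume : Measure ℝ)).setLIntegral_comp_preimage
      (measurableSet_Ioo (a := (0 : ℝ)) (b := 2)) (ff_measurable b)
    simpa [ff_neg] using this
  unfold C1
  calc _ ≤ ∫⁻ t in (Ioo (-2) 0 ∪ Ioo 0 2) ∪ {0}, ff b t := lintegral_mono_set hsub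
    _ ≤ (∫⁻ t in Ioo (-2) 0 ∪ Ioo 0 2, ff b t) + ∫⁻ t in {0}, ff b t := lintegral_union_le _ _ _
    _ ≤ ((∫⁻ t in Ioo (-2) 0, ff b t) + ∫⁻ t in Ioo 0 2, ff b t) + ∫⁻ t in {0}, ff b t := by
        gcongr; exact lintegral_union_le _ _ _
    _ < ⊤ := by
        rw [h0]; simp [ff_int_pos hb]

lemma ff_shift_le {b c : ℝ} (hc : |c| ≤ 1) :
    ∫⁻ t in Ioo (-1 : ℝ) 1, ff b (c - t) ≤ C1 b := by
  have h := (Measure.measurePreserving_sub_left (volume : Measure ℝ) c).setLIntegral_comp_preimage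
      (measurableSet_Ioo (a := (-2 : ℝ)) (b := 2)) (ff_measurable b)
  rw [C1, ← h]
  refine lintegral_mono_set fun t ht => ?_
  have := abs_le.1 hc
  simp only [mem_preimage, mem_Ioo] at *
  constructor <;> linarith

section marg
variable {N : ℕ}

lemma lmarg_prod (s : Finset (Fin N)) (h : Fin N → ℝ → ℝ≥0∞) (hm : ∀ k, Measurable (h k))
    (C : ℝ≥0∞) (hC : ∀ k, ∫⁻ t, h k t ≤ C) (g : (Fin N → ℝ) → ℝ≥0∞) (hgm : Measurable g)
    (hg : ∀ y : Fin N → ℝ, ∀ k ∈ s, ∀ t, g (Function.update y k t) = g y) (x : Fin N → ℝ) :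
    (∫⋯∫⁻_s, (fun y => (∏ k ∈ s, h k (y k)) * g y) ∂(fun _ => volume)) x ≤ C ^ s.card * g x := by
  induction s using Finset.induction_on generalizing g with
  | empty => simp
  | insert i s hi ih =>
    rw [lmarginal_insert' _ (by fun_prop) hi]
    have key : (fun y : Fin N → ℝ => ∫⁻ t, (∏ k ∈ insert i s, h k (Function.update y i t k)) *
        g (Function.update y i t)) ≤ fun y => (∏ k ∈ s, h k (y k)) * (C * g y) := by
      intro y
      have : ∀ t, (∏ k ∈ insert i s, h k (Function.update y i t k)) *
          g (Function.update y i t) = h i t * ((∏ k ∈ s, h k (y k)) * g y) := by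
        intro t
        rw [Finset.prod_insert hi, hg y i (Finset.mem_insert_self _ _)]
        have : ∏ k ∈ s, h k (Function.update y i t k) = ∏ k ∈ s, h k (y k) := by
          refine Finset.prod_congr rfl fun k hk => ?_
          rw [Function.update_of_ne]; rintro rfl; exact hi hk
        rw [this]; simp [mul_assoc]
      simp only [this]
      rw [lintegral_mul_const _ (hm i)]
      calc _ ≤ C * ((∏ k ∈ s, h k (y k)) * g y) := by gcongr; exact hC i
        _ = _ := by ring
    refine (lmarginal_mono key x).trans ?_
    refine (ih (fun y => C * g y) (by fun_prop) ?_).trans ?_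
    · intro y k hk t
      rw [hg y k (Finset.mem_insert_of_mem hk)]
    · rw [Finset.card_insert_of_notMem hi, pow_succ]
      simp [mul_assoc]

/-- radial variable in the plane of coordinates `i,j` -/
def rho (i j : Fin N) (x : E N) : ℝ := Real.sqrt (x i ^ 2 + x j ^ 2)

lemma rho_nonneg (i j : Fin N) (x : E N) : 0 ≤ rho i j x := Real.sqrt_nonneg _

lemma planar_le {b c : ℝ} (hc : |c| ≤ 1) :
    ∫⁻ z : ℝ × ℝ, (Ioo (-1 : ℝ) 1).indicator (fun t => ff b (c - t)) (Real.sqrt (z.1 ^ 2 + z.2 ^ 2))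
      ≤ ENNReal.ofReal (2 * Real.pi) * C1 b := by
  rw [← lintegral_comp_polarCoord_symm]
  set h := (Ioo (-1 : ℝ) 1).indicator (fun t => ff b (c - t)) with hh
  have hhm : Measurable h := ((ff_measurable b).comp (by fun_prop)).indicator measurableSet_Ioo
  have h1 : ∀ z ∈ polarCoord.target, ENNReal.ofReal z.1 •
      h (Real.sqrt ((polarCoord.symm z).1 ^ 2 + (polarCoord.symm z).2 ^ 2)) ≤ h z.1 := by
    intro z hz
    have hz1 : 0 < z.1 := hz.1
    have : Real.sqrt ((polarCoord.symm z).1 ^ 2 + (polarCoord.symm z).2 ^ 2) = z.1 := by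
      rw [polarCoord_symm_apply]
      simp only [mul_pow, ← mul_add, Real.cos_sq_add_sin_sq, mul_one]
      exact Real.sqrt_sq hz1.le
    rw [this, smul_eq_mul, hh]
    by_cases hz2 : z.1 ∈ Ioo (-1 : ℝ) 1
    · calc _ ≤ ENNReal.ofReal 1 * (Ioo (-1 : ℝ) 1).indicator (fun t => ff b (c - t)) z.1 := by
            gcongr; exact hz2.2.le
        _ = _ := by simp
    · simp [indicator_of_notMem hz2]
  refine (setLIntegral_mono (hhm.comp measurable_fst) h1).trans ?_
  rw [polarCoord_target, Measure.volume_eq_prod, ← Measure.prod_restrict,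
    lintegral_prod _ (by fun_prop)]
  simp only [Function.comp, lintegral_const, Measure.restrict_apply_univ, Real.volume_Ioo]
  rw [lintegral_mul_const _ hhm, mul_comm]
  gcongr
  · linarith
  · calc _ ≤ ∫⁻ t, h t := setLIntegral_le_lintegral _ _
      _ = ∫⁻ t in Ioo (-1 : ℝ) 1, ff b (c - t) := by rw [hh, lintegral_indicator measurableSet_Ioo]
      _ ≤ _ := ff_shift_le hc

/-- reduced kernel -/
def kij (β : ℝ) (i j : Fin N) (x y : E N) : ℝ≥0∞ :=
  (∏ k ∈ ({i, j} : Finset (Fin N))ᶜ, ff β (x k - y k)) * ff β (rho i j x - rho i j y)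

lemma kij_symm (β : ℝ) (i j : Fin N) (x y : E N) : kij β i j x y = kij β i j y x := by
  unfold kij
  have : ∀ s t, ff β (s - t) = ff β (t - s) := fun s t => by rw [← ff_neg]; simp
  rw [this (rho i j x)]
  simp only [this (x _)]

lemma kij_measurable (β : ℝ) (i j : Fin N) :
    Measurable (fun z : E N × E N => kij β i j z.1 z.2) := by
  unfold kij rho
  have := ff_measurable β
  fun_prop

lemma ff_rpow (β r t : ℝ) : ff β t ^ r = ff (β * r) t := by
  unfold ff; rw [ENNReal.rpow_mul]

lemma coord_le_norm (x : E N) (k : Fin N) : |x k| ≤ ‖x‖ := by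
  simpa using PiLp.norm_apply_le x k

lemma rho_le_norm {i j : Fin N} (hij : i ≠ j) (x : E N) : rho i j x ≤ ‖x‖ := by
  rw [rho, EuclideanSpace.norm_eq]
  apply Real.sqrt_le_sqrt
  have : ∑ k ∈ ({i, j} : Finset (Fin N)), ‖x k‖ ^ 2 ≤ ∑ k, ‖x k‖ ^ 2 :=
    Finset.sum_le_univ_sum_of_nonneg (fun _ => by positivity)
  rw [Finset.sum_pair hij] at this
  simpa using this

lemma kij_int {b β r : ℝ} (hr : 0 < r) (hb : β * r = b) {i j : Fin N} (hij : i ≠ j) {x : E N}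
    (hx : ‖x‖ ≤ 1) :
    ∫⁻ y in ball (0 : E N) 1, kij β i j x y ^ r ≤
      (1 + C1 b) ^ N * (ENNReal.ofReal (2 * Real.pi) * C1 b) := by
  classical
  set s := ({i, j} : Finset (Fin N))ᶜ with hs
  let h : Fin N → ℝ → ℝ≥0∞ := fun k => (Ioo (-1 : ℝ) 1).indicator (fun t => ff b (x k - t))
  let g0 : ℝ → ℝ≥0∞ := (Ioo (-1 : ℝ) 1).indicator (fun t => ff b (rho i j x - t))
  have hg0 : Measurable g0 := ((ff_measurable b).comp (by fun_prop)).indicator measurableSet_Ioo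
  have hhm : ∀ k, Measurable (h k) := fun k =>
    ((ff_measurable b).comp (by fun_prop)).indicator measurableSet_Ioo
  let F : (Fin N → ℝ) → ℝ≥0∞ := fun y => (∏ k ∈ s, h k (y k)) *
    g0 (Real.sqrt (y i ^ 2 + y j ^ 2))
  have hF : Measurable F := by
    have : Measurable fun y : Fin N → ℝ => g0 (Real.sqrt (y i ^ 2 + y j ^ 2)) :=
      hg0.comp (by fun_prop)
    fun_prop
  have h1 : ∫⁻ y in ball (0 : E N) 1, kij β i j x y ^ r ≤ ∫⁻ y : E N, F y.ofLp := by
    refine (setLIntegral_mono' measurableSet_ball ?_).trans (setLIntegral_le_lintegral (ball 0 1) _)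
    intro y hy
    have hy' : ‖y‖ < 1 := by simpa using hy
    have e1 : ∀ k, h k (y k) = ff b (x k - y k) := by
      intro k
      simp only [h]
      rw [indicator_of_mem]
      exact abs_lt.1 ((coord_le_norm y k).trans_lt hy')
    have e2 : g0 (rho i j y) = ff b (rho i j x - rho i j y) := by
      simp only [g0]
      rw [indicator_of_mem]
      refine ⟨by linarith [rho_nonneg i j y], (rho_le_norm hij y).trans_lt hy'⟩
    have e3 : F y.ofLp = (∏ k ∈ s, h k (y k)) * g0 (rho i j y) := rfl
    rw [e3, e2]
    simp only [e1]
    rw [kij, ENNReal.mul_rpow_of_nonneg _ _ hr.le, ff_rpow, hb,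
      ← ENNReal.prod_rpow_of_nonneg hr.le]
    simp only [ff_rpow, hb, hs]
    rfl
  refine h1.trans ?_
  rw [(PiLp.volume_preserving_ofLp (Fin N)).lintegral_comp hF, volume_pi,
    lintegral_eq_lmarginal_univ (fun _ => 0)]
  have hu : (Finset.univ : Finset (Fin N)) = {i, j} ∪ s := by
    rw [hs, Finset.union_compl]
  have hC : ∀ k, ∫⁻ t, h k t ≤ 1 + C1 b := by
    intro k
    simp only [h]
    rw [lintegral_indicator measurableSet_Ioo]
    exact (ff_shift_le ((coord_le_norm x k).trans hx)).trans le_add_self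
  rw [hu, lmarginal_union _ _ hF (by rw [hs]; exact disjoint_compl_right)]
  have h2 : (∫⋯∫⁻_s, F ∂(fun _ => volume)) ≤
      fun y => (1 + C1 b) ^ N * g0 (Real.sqrt (y i ^ 2 + y j ^ 2)) := by
    intro y
    refine (lmarg_prod s h hhm (1 + C1 b) hC (fun y => g0 (Real.sqrt (y i ^ 2 + y j ^ 2)))
      (hg0.comp (by fun_prop)) ?_ y).trans ?_
    · intro y k hk t
      have hk' : k ≠ i ∧ k ≠ j := by simpa [hs] using hk
      simp only [Function.update_of_ne hk'.1.symm, Function.update_of_ne hk'.2.symm]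
    · simp only
      gcongr
      · exact le_self_add
      · simpa using s.card_le_univ
  refine (lmarginal_mono h2 _).trans ?_
  have hm3 : Measurable fun y : Fin N → ℝ => (1 + C1 b) ^ N * g0 (Real.sqrt (y i ^ 2 + y j ^ 2)) :=
    Measurable.const_mul (hg0.comp (by fun_prop)) _
  rw [lmarginal_insert _ hm3 (by simpa using hij), lmarginal_singleton]
  simp only [Function.update_self, Function.update_of_ne hij]
  have hm4 : Measurable fun z : ℝ × ℝ => g0 (Real.sqrt (z.1 ^ 2 + z.2 ^ 2)) :=
    hg0.comp (by fun_prop)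
  have hm5 : Measurable fun z : ℝ × ℝ => (1 + C1 b) ^ N * g0 (Real.sqrt (z.1 ^ 2 + z.2 ^ 2)) :=
    hm4.const_mul _
  have := lintegral_prod (μ := (volume : Measure ℝ)) (ν := (volume : Measure ℝ)) _ hm5.aemeasurable
  rw [← this, ← Measure.volume_eq_prod, lintegral_const_mul _ hm4]
  gcongr
  refine planar_le ?_
  rw [abs_of_nonneg (rho_nonneg i j x)]
  exact (rho_le_norm hij x).trans hx

end marg

/-! ### Part 2b: rotations and averaging -/

section rot
variable {N : ℕ}

def blk (x : E N) : ℝ := ∑ i : Fin N, if i.val < 2 then (x i) ^ 2 else 0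

def IsSym (g : E N ≃ₗᵢ[ℝ] E N) : Prop := ∀ x, blk (g x) = blk x

def SInv {β : Type*} (w : E N → β) : Prop := ∀ g : E N ≃ₗᵢ[ℝ] E N, IsSym g → ∀ x, w (g x) = w x

lemma IsSym.symm {g : E N ≃ₗᵢ[ℝ] E N} (hg : IsSym g) : IsSym g.symm := by
  intro x
  have := hg (g.symm x)
  simpa using this.symm

def rotFun (i j : Fin N) (θ : ℝ) (x : E N) : E N :=
  WithLp.toLp 2 (fun k => if k = i then Real.cos θ * x i - Real.sin θ * x j
    else if k = j then Real.sin θ * x i + Real.cos θ * x j else x k)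

lemma rotFun_apply (i j : Fin N) (θ : ℝ) (x : E N) (k : Fin N) :
    rotFun i j θ x k = if k = i then Real.cos θ * x i - Real.sin θ * x j
    else if k = j then Real.sin θ * x i + Real.cos θ * x j else x k := rfl

lemma rot_sum (i j : Fin N) (hij : i ≠ j) (θ : ℝ) (x : E N) (c : Fin N → ℝ) (hc : c i = c j) :
    ∑ k, c k * (rotFun i j θ x k) ^ 2 = ∑ k, c k * (x k) ^ 2 := by
  rw [← sub_eq_zero, ← Finset.sum_sub_distrib, Fintype.sum_eq_add i j hij]
  · simp only [rotFun_apply, if_true, if_neg hij.symm, hc]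
    have := Real.sin_sq_add_cos_sq θ
    linear_combination (c j * (x i ^2 + x j ^2)) * this
  · rintro k ⟨h1, h2⟩
    simp [rotFun_apply, h1, h2]

def rotLin (i j : Fin N) (θ : ℝ) : E N →ₗ[ℝ] E N where
  toFun := rotFun i j θ
  map_add' x y := by
    ext k
    simp only [rotFun_apply, PiLp.add_apply]
    split_ifs <;> ring
  map_smul' a x := by
    ext k
    simp only [rotFun_apply, PiLp.smul_apply, smul_eq_mul, RingHom.id_apply]
    split_ifs <;> ring

def rot (i j : Fin N) (hij : i ≠ j) (θ : ℝ) : E N ≃ₗᵢ[ℝ] E N :=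
  LinearIsometry.toLinearIsometryEquiv (li :=
    { toLinearMap := rotLin i j θ
      norm_map' := by
        intro x
        have := rot_sum i j hij θ x (fun _ => 1) rfl
        simp only [one_mul] at this
        change ‖rotFun i j θ x‖ = ‖x‖
        rw [EuclideanSpace.norm_eq, EuclideanSpace.norm_eq]
        congr 1
        simpa using this }) rfl

lemma rot_apply (i j : Fin N) (hij : i ≠ j) (θ : ℝ) (x : E N) :
    rot i j hij θ x = rotFun i j θ x := rfl

lemma rot_isSym {i j : Fin N} (hij : i ≠ j) (hb : i.val < 2 ↔ j.val < 2) (θ : ℝ) :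
    IsSym (rot i j hij θ) := by
  intro x
  have := rot_sum i j hij θ x (fun k => if k.val < 2 then 1 else 0) (by simp [hb])
  simpa [blk, rot_apply] using this

def ang (i j : Fin N) (x : E N) : ℝ := Complex.arg ⟨x i, x j⟩

lemma ang_measurable (i j : Fin N) : Measurable (ang i j) := by
  unfold ang
  refine Complex.measurable_arg.comp ?_
  have : (fun x : E N => (⟨x i, x j⟩ : ℂ)) = fun x => (x i : ℂ) + (x j : ℂ) * Complex.I := by
    ext x; apply Complex.ext <;> simp
  rw [this]; fun_prop

lemma rho_eq (i j : Fin N) (x : E N) : rho i j x = ‖(⟨x i, x j⟩ : ℂ)‖ := by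
  rw [rho, Complex.norm_def, Complex.normSq_apply]; congr 1; ring

lemma coord_cos (i j : Fin N) (x : E N) : x i = rho i j x * Real.cos (ang i j x) := by
  rw [rho_eq, ang, Complex.norm_mul_cos_arg]

lemma coord_sin (i j : Fin N) (x : E N) : x j = rho i j x * Real.sin (ang i j x) := by
  rw [rho_eq, ang, Complex.norm_mul_sin_arg]

lemma rot_dist {i j : Fin N} (hij : i ≠ j) (θ : ℝ) (x y : E N) :
    (∀ k, k ≠ i → k ≠ j → |x k - y k| ≤ ‖x - rot i j hij θ y‖) ∧
    |rho i j x - rho i j y| ≤ ‖x - rot i j hij θ y‖ ∧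
    |rho i j x * Real.sin (ang i j x - ang i j y - θ)| ≤ ‖x - rot i j hij θ y‖ := by
  set v := x - rot i j hij θ y with hv
  have hvk : ∀ k, v k = x k - rotFun i j θ y k := fun k => by rw [hv]; rfl
  have h2 : rho i j v ≤ ‖v‖ := rho_le_norm hij v
  set a := ang i j x - ang i j y - θ with ha
  have h3 : v i ^ 2 + v j ^ 2 = rho i j x ^ 2 + rho i j y ^ 2
      - 2 * rho i j x * rho i j y * Real.cos a := by
    rw [hvk, hvk, rotFun_apply, rotFun_apply, if_pos rfl, if_neg hij.symm, if_pos rfl]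
    have e1 := coord_cos i j x
    have e2 := coord_sin i j x
    have e3 := coord_cos i j y
    have e4 := coord_sin i j y
    have e5 : Real.cos a = Real.cos (ang i j x) * Real.cos (ang i j y + θ)
        + Real.sin (ang i j x) * Real.sin (ang i j y + θ) := by
      rw [← Real.cos_sub, ha]; congr 1; ring
    rw [Real.cos_add, Real.sin_add] at e5
    rw [e1, e2, e3, e4, e5]
    have t1 := Real.sin_sq_add_cos_sq (ang i j x)
    have t2 := Real.sin_sq_add_cos_sq (ang i j y)
    have t3 := Real.sin_sq_add_cos_sq θ
    generalize rho i j x = p at *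
    generalize rho i j y = q at *
    linear_combination p ^ 2 * t1 + q^2 * (Real.sin θ ^2 + Real.cos θ ^2) * t2 + q ^ 2 * t3
  have h4 : (rho i j v) ^ 2 = v i ^ 2 + v j ^ 2 := Real.sq_sqrt (by positivity)
  have hn := rho_nonneg i j v
  have hx := rho_nonneg i j x
  have hy := rho_nonneg i j y
  refine ⟨fun k h h' => ?_, ?_, ?_⟩
  · have := coord_le_norm v k
    rwa [hvk, rotFun_apply, if_neg h, if_neg h'] at this
  · refine le_trans (abs_le_of_sq_le_sq ?_ hn) h2 
    rw [h4, h3]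
    nlinarith [Real.cos_le_one a, mul_nonneg hx hy]
  · refine le_trans (abs_le_of_sq_le_sq ?_ hn) h2
    rw [h4, h3]
    have t := Real.sin_sq_add_cos_sq a
    nlinarith [sq_nonneg (rho i j y - rho i j x * Real.cos a)]

lemma rk_rot_le {i j : Fin N} (hij : i ≠ j) (θ : ℝ) (x y : E N) {β b : ℝ} (hβ : 0 ≤ β)
    (hb : 0 ≤ b) : rk (((N : ℝ) - 1) * β + b) x (rot i j hij θ y) ≤
      kij β i j x y * (ff b (rho i j x) * ff b (Real.sin (ang i j x - ang i j y - θ))) := by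
  obtain ⟨h1, h2, h3⟩ := rot_dist hij θ x y
  set v := x - rot i j hij θ y with hv
  have hN : (({i, j} : Finset (Fin N))ᶜ.card : ℝ) = (N : ℝ) - 2 := by
    have h := Finset.card_add_card_compl ({i, j} : Finset (Fin N))
    rw [Finset.card_pair hij, Fintype.card_fin] at h
    have : ((2 + ({i, j} : Finset (Fin N))ᶜ.card : ℕ) : ℝ) = N := by rw [h]
    push_cast at this; linarith
  have hN2 : (0 : ℝ) ≤ (N : ℝ) - 2 := by rw [← hN]; positivity
  have hff : ∀ (c : ℝ), 0 ≤ c → ∀ t : ℝ, |t| ≤ ‖v‖ → (‖v‖ₑ⁻¹) ^ c ≤ ff c t := by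
    intro c hc t ht
    unfold ff
    gcongr
    rw [← ofReal_norm, ← ofReal_norm]
    exact ENNReal.ofReal_le_ofReal ht
  have e1 : rk (((N : ℝ) - 1) * β + b) x (rot i j hij θ y) =
      ((∏ k ∈ ({i, j} : Finset (Fin N))ᶜ, (‖v‖ₑ⁻¹) ^ β) * (‖v‖ₑ⁻¹) ^ β) * (‖v‖ₑ⁻¹) ^ b := by
    rw [Finset.prod_const, ← ENNReal.rpow_natCast, ← ENNReal.rpow_mul, hN,
      ← ENNReal.rpow_add_of_nonneg _ _ (by positivity) hβ,
      ← ENNReal.rpow_add_of_nonneg _ _ (by positivity) hb, rk]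
    congr 1; ring
  have e2 : ff b (rho i j x) * ff b (Real.sin (ang i j x - ang i j y - θ)) =
      ff b (rho i j x * Real.sin (ang i j x - ang i j y - θ)) ∨ 
      ff b (rho i j x) * ff b (Real.sin (ang i j x - ang i j y - θ)) = ⊤ ∨ b = 0 := by
    rcases hb.eq_or_lt with hb0 | hb0
    · right; right; exact hb0.symm
    have hpos : ∀ t, ff b t ≠ 0 := fun t => by
      unfold ff
      simp [hb0.le, hb0]
    by_cases hr : rho i j x = 0
    · right; left
      rw [hr, show ff b 0 = ⊤ by simp [ff, hb0]]
      exact ENNReal.top_mul (hpos _)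
    by_cases hs : Real.sin (ang i j x - ang i j y - θ) = 0
    · right; left
      rw [hs, show ff b 0 = ⊤ by simp [ff, hb0]]
      exact ENNReal.mul_top (hpos _)
    left
    rw [ff_of_ne hr, ff_of_ne hs, ff_of_ne (mul_ne_zero hr hs), abs_mul,
      Real.mul_rpow (abs_nonneg _) (abs_nonneg _), ENNReal.ofReal_mul (by positivity)]
  rw [e1]
  unfold kij
  gcongr with k hk
  · have : k ≠ i ∧ k ≠ j := by simpa using hk
    exact hff β hβ _ (h1 k this.1 this.2)
  · exact hff β hβ _ h2
  · rcases e2 with e | e | e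
    · rw [e]; exact hff b hb _ h3
    · rw [e]; exact le_top
    · subst e; simp [ff]

/-- angular constant -/
def CS (b : ℝ) : ℝ≥0∞ := ∫⁻ t in Ioc (0 : ℝ) Real.pi, ff b (Real.sin t)

lemma CS_shift (b ψ : ℝ) : ∫⁻ t in Ioc (0 : ℝ) Real.pi, ff b (Real.sin (ψ - t)) = CS b := by
  have hf : Measurable fun t => ff b (Real.sin t) :=
    (ff_measurable b).comp Real.measurable_sin
  have h := (Measure.measurePreserving_sub_left (volume : Measure ℝ) ψ).setLIntegral_comp_preimage
      (measurableSet_Ico (a := ψ - Real.pi) (b := ψ)) hf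
  have e : (fun x => ψ - x) ⁻¹' Ico (ψ - Real.pi) ψ = Ioc 0 Real.pi := by
    ext t; simp only [mem_preimage, mem_Ico, mem_Ioc]
    constructor <;> rintro ⟨h1, h2⟩ <;> constructor <;> linarith
  rw [e] at h
  rw [h, CS, setLIntegral_congr Ico_ae_eq_Ioc]
  have d1 := isAddFundamentalDomain_Ioc Real.pi_pos (ψ - Real.pi)
  have d2 := isAddFundamentalDomain_Ioc Real.pi_pos 0
  have := d1.setLIntegral_eq d2 (fun t => ff b (Real.sin t)) ?_
  · simpa using this
  · rintro ⟨g, hg⟩ t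
    obtain ⟨n, rfl⟩ := AddSubgroup.mem_zmultiples_iff.1 hg
    change ff b (Real.sin (n • Real.pi + t)) = _
    rw [add_comm, zsmul_eq_mul, Real.sin_add_int_mul_pi]
    unfold ff
    congr 2
    rw [enorm_mul, ]
    rcases Int.even_or_odd n with h | h
    · simp [h.neg_one_zpow]
    · simp [h.neg_one_zpow]

lemma CS_lt_top {b : ℝ} (hb0 : 0 ≤ b) (hb : b < 1) : CS b < ⊤ := by
  have hpi := Real.pi_pos
  have hpi4 := Real.pi_lt_four
  have h1 : ∀ t ∈ Ioc (0 : ℝ) (Real.pi), ff b (Real.sin (Real.pi / 2 - t)) ≤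
    ((ENNReal.ofReal (2 / Real.pi))⁻¹ ^ b) * ff b (Real.pi / 2 - t) := by
    intro t ht
    have h := Real.mul_abs_le_abs_sin (x := Real.pi / 2 - t)
      (abs_le.2 ⟨by linarith [ht.2], by linarith [ht.1]⟩)
    have h' : ENNReal.ofReal (2 / Real.pi) * ‖Real.pi / 2 - t‖ₑ ≤ ‖Real.sin (Real.pi / 2 - t)‖ₑ := by
      rw [← ofReal_norm, ← ofReal_norm, ← ENNReal.ofReal_mul (by positivity)]
      exact ENNReal.ofReal_le_ofReal h
    unfold ff
    rw [← ENNReal.mul_rpow_of_nonneg _ _ hb0, ← ENNReal.mul_inv (by simp) (by simp)]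
    gcongr
  rw [← CS_shift b (Real.pi / 2)]
  have hm : Measurable fun t => ff b (Real.pi / 2 - t) := (ff_measurable b).comp (by fun_prop)
  refine (setLIntegral_mono (hm.const_mul _) h1).trans_lt ?_
  rw [lintegral_const_mul _ hm]
  refine ENNReal.mul_lt_top (ENNReal.rpow_lt_top_of_nonneg hb0 (by simp [hpi])) ?_
  have h := (Measure.measurePreserving_sub_left (volume : Measure ℝ)
    (Real.pi / 2)).setLIntegral_comp_preimage
      (measurableSet_Ioo (a := (-2 : ℝ)) (b := 2)) (ff_measurable b)
  refine lt_of_le_of_lt ?_ (C1_lt_top hb)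
  rw [C1, ← h]
  refine lintegral_mono_set fun t ht => ?_
  simp only [mem_preimage, mem_Ioo, mem_Ioc] at *
  constructor <;> linarith

lemma isom_setLIntegral_ball (g : E N ≃ₗᵢ[ℝ] E N) (f : E N → ℝ≥0∞) :
    ∫⁻ y in ball (0 : E N) 1, f (g y) = ∫⁻ y in ball (0 : E N) 1, f y := by
  have h := g.measurePreserving.setLIntegral_comp_preimage_emb
    g.toHomeomorph.measurableEmbedding f (ball (0 : E N) 1)
  have e : g ⁻¹' (ball (0 : E N) 1) = ball 0 1 := by
    ext y; simp
  rw [e] at h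
  exact h

lemma avg_aux (b : ℝ) (μ : Measure (E N)) [SFinite μ] (K : E N → ℝ≥0∞) (hK : Measurable K)
    (ψ : E N → ℝ) (hψ : Measurable ψ) (I : ℝ≥0∞)
    (h : ∀ θ : ℝ, I ≤ ∫⁻ y, K y * ff b (Real.sin (ψ y - θ)) ∂μ) :
    ENNReal.ofReal Real.pi * I ≤ CS b * ∫⁻ y, K y ∂μ := by
  calc _ = ∫⁻ _ in Ioc (0 : ℝ) Real.pi, I := by
        rw [lintegral_const, Measure.restrict_apply_univ, Real.volume_Ioc, sub_zero, mul_comm]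
    _ ≤ ∫⁻ θ in Ioc (0 : ℝ) Real.pi, ∫⁻ y, K y * ff b (Real.sin (ψ y - θ)) ∂μ :=
        lintegral_mono fun θ => h θ
    _ = ∫⁻ y, (∫⁻ θ in Ioc (0 : ℝ) Real.pi, K y * ff b (Real.sin (ψ y - θ))) ∂μ := by
        refine lintegral_lintegral_swap ?_
        have h2 : Measurable fun z : ℝ × E N => ff b (Real.sin (ψ z.2 - z.1)) :=
          (ff_measurable b).comp (Real.measurable_sin.comp (by fun_prop))
        have h3 : Measurable fun z : ℝ × E N => K z.2 := hK.comp measurable_snd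
        exact (h3.mul h2).aemeasurable
    _ = ∫⁻ y, CS b * K y ∂μ := by
        refine lintegral_congr fun y => ?_
        have h2 : Measurable fun θ : ℝ => ff b (Real.sin (ψ y - θ)) :=
          (ff_measurable b).comp (Real.measurable_sin.comp (by fun_prop))
        rw [lintegral_const_mul _ h2, CS_shift]
        ring
    _ = _ := by rw [lintegral_const_mul _ hK]

lemma kij_measurable_left (β : ℝ) (i j : Fin N) (x : E N) : Measurable fun y => kij β i j x y := by
  unfold kij rho
  have := ff_measurable β
  fun_prop

lemma avg {i j : Fin N} (hij : i ≠ j) (hbl : i.val < 2 ↔ j.val < 2) {β b : ℝ} (hβ : 0 ≤ β)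
    (hb : 0 ≤ b) {w : E N → ℝ≥0∞} (hw : Measurable w) (hi : SInv w) (x : E N) :
    ENNReal.ofReal Real.pi * ∫⁻ y in ball (0 : E N) 1, rk (((N : ℝ) - 1) * β + b) x y * w y ≤
      CS b * (ff b (rho i j x) * ∫⁻ y in ball (0 : E N) 1, kij β i j x y * w y) := by
  have hk : Measurable fun y => kij β i j x y := kij_measurable_left β i j x
  have hψ : Measurable fun y => ang i j x - ang i j y := (ang_measurable i j).const_sub _
  have hkw : Measurable fun y => kij β i j x y * w y := hk.mul hw
  have hkw2 : Measurable fun y => ff b (rho i j x) * (kij β i j x y * w y) := hkw.const_mul _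
  rw [← lintegral_const_mul _ hkw]
  refine avg_aux b _ _ hkw2 _ hψ _ ?_
  intro θ
  rw [← isom_setLIntegral_ball (rot i j hij θ)]
  refine lintegral_mono fun y => ?_
  simp only
  rw [hi _ (rot_isSym hij hbl θ) y]
  calc _ ≤ (kij β i j x y * (ff b (rho i j x) * ff b (Real.sin (ang i j x - ang i j y - θ))))
        * w y := by gcongr; exact rk_rot_le hij θ x y hβ hb
    _ = _ := by ring


def pr (hN : 4 ≤ N) (i : Fin N) : Fin N :=
  if i.val = 0 then ⟨1, by omega⟩ else if i.val = 1 then ⟨0, by omega⟩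
  else if i.val = 2 then ⟨3, by omega⟩ else ⟨2, by omega⟩

lemma pr_ne (hN : 4 ≤ N) (i : Fin N) : i ≠ pr hN i := by
  intro h
  have h' := congrArg Fin.val h
  unfold pr at h'
  split_ifs at h' <;> simp at h' <;> omega

lemma pr_blk (hN : 4 ≤ N) (i : Fin N) : i.val < 2 ↔ (pr hN i).val < 2 := by
  unfold pr
  split_ifs <;> simp <;> omega

def kk (hN : 4 ≤ N) (β : ℝ) (x y : E N) : ℝ≥0∞ := ∑ i, kij β i (pr hN i) x y

lemma kk_symm (hN : 4 ≤ N) (β : ℝ) (x y : E N) : kk hN β x y = kk hN β y x := by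
  unfold kk; simp only [kij_symm β _ _ x]

lemma kk_measurable (hN : 4 ≤ N) (β : ℝ) : Measurable (fun z : E N × E N => kk hN β z.1 z.2) := by
  unfold kk
  exact Finset.measurable_fun_sum _ fun i _ => kij_measurable β i _

lemma kk_measurable_left (hN : 4 ≤ N) (β : ℝ) (x : E N) : Measurable (fun y => kk hN β x y) := by
  unfold kk
  exact Finset.measurable_fun_sum _ fun i _ => kij_measurable_left β i _ x

lemma kk_int (hN : 4 ≤ N) {β r b : ℝ} (hr : 1 < r) (hb : β * r = b) (hb1 : b < 1) :
    ∃ A : ℝ≥0∞, A < ⊤ ∧ ∀ x : E N, ‖x‖ ≤ 1 → ∫⁻ y in ball (0 : E N) 1, kk hN β x y ^ r ≤ A := by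
  set A0 := (1 + C1 b) ^ N * (ENNReal.ofReal (2 * Real.pi) * C1 b)
  have hA0 : A0 < ⊤ := by
    have := C1_lt_top hb1
    refine ENNReal.mul_lt_top (ENNReal.pow_lt_top (by simp [this]))
      (ENNReal.mul_lt_top ENNReal.ofReal_lt_top this)
  refine ⟨(N : ℝ≥0∞) ^ (r - 1) * (N * A0), ?_, fun x hx => ?_⟩
  · refine ENNReal.mul_lt_top (ENNReal.rpow_lt_top_of_nonneg (by linarith) (by simp))
      (ENNReal.mul_lt_top (by simp) hA0)
  · have h1 : ∀ y, kk hN β x y ^ r ≤ (N : ℝ≥0∞) ^ (r - 1) * ∑ i, kij β i (pr hN i) x y ^ r := by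
      intro y
      have := ENNReal.rpow_sum_le_const_mul_sum_rpow (Finset.univ : Finset (Fin N))
        (fun i => kij β i (pr hN i) x y) hr.le
      simpa [kk] using this
    have hm : ∀ i, Measurable fun y => kij β i (pr hN i) x y ^ r := fun i =>
      (kij_measurable_left β i _ x).pow_const r
    calc _ ≤ ∫⁻ y in ball (0 : E N) 1, (N : ℝ≥0∞) ^ (r - 1) * ∑ i, kij β i (pr hN i) x y ^ r :=
          lintegral_mono h1
      _ = (N : ℝ≥0∞) ^ (r - 1) * ∑ i, ∫⁻ y in ball (0 : E N) 1, kij β i (pr hN i) x y ^ r := by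
          rw [lintegral_const_mul _ (Finset.measurable_fun_sum _ fun i _ => hm i),
            lintegral_finsetSum _ fun i _ => hm i]
      _ ≤ (N : ℝ≥0∞) ^ (r - 1) * ∑ i : Fin N, A0 := by
          gcongr with i
          exact kij_int (by linarith) hb (pr_ne hN i) hx
      _ = _ := by simp

/-- the weight -/
def aw (α p : ℝ) (x : E N) : ℝ≥0∞ := ENNReal.ofReal (‖x‖ ^ (α / (p + 1)))

lemma aw_measurable (α p : ℝ) : Measurable (aw α p : E N → ℝ≥0∞) := by
  unfold aw; fun_prop

lemma aw_le_one {α p : ℝ} (hp : 1 < p) (hα : p + 1 ≤ α) {x : E N} (hx : ‖x‖ ≤ 1) :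
    aw α p x ≤ 1 := by
  unfold aw
  rw [ENNReal.ofReal_le_one]
  exact Real.rpow_le_one (norm_nonneg _) hx (div_nonneg (by linarith) (by linarith))

lemma exists_coord (hN : 4 ≤ N) (x : E N) : ∃ i : Fin N, ‖x‖ ^ 2 ≤ N * (x i) ^ 2 := by
  by_contra! h
  have h2 : ∑ i : Fin N, (N : ℝ) * (x i) ^ 2 < ∑ _i : Fin N, ‖x‖ ^ 2 :=
    Finset.sum_lt_sum_of_nonempty ⟨⟨0, by omega⟩, Finset.mem_univ _⟩ fun i _ => h i
  rw [← Finset.mul_sum] at h2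
  have h3 : ‖x‖ ^ 2 = ∑ i, (x i) ^ 2 := by
    rw [EuclideanSpace.norm_sq_eq]; simp
  rw [← h3] at h2
  simp at h2

lemma lemmaA (hN : 4 ≤ N) {β b α p : ℝ} (hβ : 0 ≤ β) (hb : 0 < b) (hb1 : b < 1) (hp : 1 < p)
    (hα : p + 1 ≤ α) {w : E N → ℝ≥0∞} (hw : Measurable w) (hi : SInv w) {x : E N} (hx : ‖x‖ ≤ 1) :
    aw α p x * ∫⁻ y in ball (0 : E N) 1, rk (((N : ℝ) - 1) * β + b) x y * w y ≤
      (CS b * ENNReal.ofReal N) * ∫⁻ y in ball (0 : E N) 1, kk hN β x y * w y := by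
  have hN' : (4 : ℝ) ≤ N := by exact_mod_cast hN
  by_cases hx0 : x = 0
  · subst hx0
    have : aw α p (0 : E N) = 0 := by
      unfold aw
      rw [norm_zero, Real.zero_rpow (by
        have : 0 < α / (p + 1) := div_pos (by linarith) (by linarith)
        exact this.ne')]
      simp
    rw [this]; simp
  have hxp : 0 < ‖x‖ := norm_pos_iff.2 hx0
  obtain ⟨i, hi'⟩ := exists_coord hN x
  have hrho : ‖x‖ ^ 2 ≤ N * rho i (pr hN i) x ^ 2 := by
    rw [rho, Real.sq_sqrt (by positivity)]
    nlinarith [sq_nonneg (x (pr hN i))]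
  have hr0 := rho_nonneg i (pr hN i) x
  have hrp : 0 < rho i (pr hN i) x := by
    rcases hr0.eq_or_lt with h | h
    · rw [← h] at hrho; nlinarith
    · exact h
  have hrle : ‖x‖ ≤ N * rho i (pr hN i) x := by
    refine abs_le_of_sq_le_sq' (?_) (by positivity) |>.2
    nlinarith [sq_nonneg (rho i (pr hN i) x)]
  have h1 : aw α p x * ff b (rho i (pr hN i) x) ≤ ENNReal.ofReal N := by
    rw [ff_of_ne hrp.ne', abs_of_pos hrp, aw, ← ENNReal.ofReal_mul (by positivity)]
    apply ENNReal.ofReal_le_ofReal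
    have e1 : ‖x‖ ^ (α / (p + 1)) ≤ ‖x‖ ^ b :=
      Real.rpow_le_rpow_of_exponent_ge hxp hx (by rw [le_div_iff₀ (by linarith)]; nlinarith)
    have e2 : ‖x‖ ^ b ≤ (N * rho i (pr hN i) x) ^ b := Real.rpow_le_rpow hxp.le hrle hb.le
    rw [Real.mul_rpow (by positivity) hr0] at e2
    have e3 : (N : ℝ) ^ b ≤ N ^ (1 : ℝ) := Real.rpow_le_rpow_of_exponent_le (by linarith) hb1.le
    rw [Real.rpow_one] at e3
    have e4 : rho i (pr hN i) x ^ b * rho i (pr hN i) x ^ (-b) = 1 := by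
      rw [← Real.rpow_add hrp]; simp
    calc _ ≤ (N : ℝ) ^ b * rho i (pr hN i) x ^ b * rho i (pr hN i) x ^ (-b) := by
          gcongr; exact e1.trans e2
      _ = (N : ℝ) ^ b := by rw [mul_assoc, e4, mul_one]
      _ ≤ _ := e3
  have h2 := avg (pr_ne hN i) (pr_blk hN i) hβ hb.le hw hi x
  have hpi : (1 : ℝ≥0∞) ≤ ENNReal.ofReal Real.pi := by
    rw [ENNReal.one_le_ofReal]; linarith [Real.pi_gt_three]
  set I := ∫⁻ y in ball (0 : E N) 1, rk (((N : ℝ) - 1) * β + b) x y * w y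
  calc aw α p x * I ≤ aw α p x * (ENNReal.ofReal Real.pi * I) := by
        gcongr; calc I = 1 * I := (one_mul _).symm
          _ ≤ _ := by gcongr
    _ ≤ aw α p x * (CS b * (ff b (rho i (pr hN i) x) *
        ∫⁻ y in ball (0 : E N) 1, kij β i (pr hN i) x y * w y)) := by gcongr
    _ = CS b * (aw α p x * ff b (rho i (pr hN i) x)) *
        ∫⁻ y in ball (0 : E N) 1, kij β i (pr hN i) x y * w y := by ring
    _ ≤ CS b * ENNReal.ofReal N * ∫⁻ y in ball (0 : E N) 1, kk hN β x y * w y := by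
        gcongr with y
        unfold kk
        exact Finset.single_le_sum (f := fun i => kij β i (pr hN i) x y)
          (fun _ _ => zero_le) (Finset.mem_univ i)

/-- Packaged output of the symmetrization step. -/
lemma kernel_package (hN : 4 ≤ N) {p : ℝ} (hp : 1 < p)
    (hsup : p < ((N : ℝ) + 1) / ((N : ℝ) - 3)) :
    ∃ (θ : ℝ) (k : E N → E N → ℝ≥0∞) (A : ℝ≥0∞), 0 < θ ∧ θ < 1 ∧
      Measurable (fun z : E N × E N => k z.1 z.2) ∧ (∀ x y, k x y = k y x) ∧ A < ⊤ ∧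
      (∀ x : E N, ‖x‖ ≤ 1 → ∫⁻ y in ball (0 : E N) 1, k x y ^ ((p + 1) / 2) ≤ A) ∧
      ∀ α, p + 1 ≤ α → ∀ w : E N → ℝ≥0∞, Measurable w → SInv w → ∀ x : E N, ‖x‖ ≤ 1 →
        aw α p x * ∫⁻ y in ball (0 : E N) 1, rk ((N : ℝ) - 2 + 2 * θ) x y * w y ≤
        ∫⁻ y in ball (0 : E N) 1, k x y * w y := by
  have hN' : (4 : ℝ) ≤ N := by exact_mod_cast hN
  set S : ℝ := 2 * ((N : ℝ) - 1) / (p + 1) + 1 with hS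
  have hS1 : (N : ℝ) - 2 < S := by
    rw [lt_div_iff₀ (by linarith)] at hsup
    have : (N : ℝ) - 3 < 2 * ((N : ℝ) - 1) / (p + 1) := by
      rw [lt_div_iff₀ (by linarith)]; nlinarith
    linarith
  have hS2 : S < N := by
    have : 2 * ((N : ℝ) - 1) / (p + 1) < N - 1 := by
      rw [div_lt_iff₀ (by linarith)]; nlinarith
    linarith
  have hS0 : 0 < S := by linarith
  set b : ℝ := ((N : ℝ) - 2 + S) / 2 / S with hb
  have hb0 : 0 < b := by rw [hb]; apply div_pos _ hS0; linarith
  have hb1 : b < 1 := by rw [hb, div_lt_one hS0]; linarith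
  have hbS : b * S = ((N : ℝ) - 2 + S) / 2 := by rw [hb]; field_simp
  set β : ℝ := b / ((p + 1) / 2) with hβ
  have hβ0 : 0 < β := by rw [hβ]; apply div_pos hb0; linarith
  have hβr : β * ((p + 1) / 2) = b := by rw [hβ]; field_simp
  obtain ⟨A, hA, hA'⟩ := kk_int (N := N) hN (r := (p + 1) / 2) (by linarith) hβr hb1
  set c : ℝ≥0∞ := CS b * ENNReal.ofReal N with hc
  have hc' : c < ⊤ := ENNReal.mul_lt_top (CS_lt_top hb0.le hb1) (by simp)
  have hr0 : 0 ≤ (p + 1) / 2 := by linarith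
  refine ⟨(S - (N - 2)) / 4, fun x y => c * kk hN β x y, c ^ ((p + 1) / 2) * A, by linarith,
    by linarith, (kk_measurable hN β).const_mul _, fun x y => congrArg (c * ·) (kk_symm hN β x y),
    ENNReal.mul_lt_top (ENNReal.rpow_lt_top_of_nonneg hr0 hc'.ne) hA, ?_, ?_⟩
  · intro x hx
    have hm : Measurable fun y => kk hN β x y ^ ((p + 1) / 2) :=
      (kk_measurable_left hN β x).pow_const _
    simp only [ENNReal.mul_rpow_of_nonneg _ _ hr0]
    rw [lintegral_const_mul _ hm]
    gcongr
    exact hA' x hx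
  · intro α hα w hw hi x hx
    have h := lemmaA hN hβ0.le hb0 hb1 hp hα hw hi hx
    have e : ((N : ℝ) - 1) * β + b = (N : ℝ) - 2 + 2 * ((S - (N - 2)) / 4) := by
      have e1 : ((N : ℝ) - 1) * β + b = b * S := by
        rw [hβ, hS]; field_simp
      rw [e1, hbS]; ring
    rw [e] at h
    refine h.trans ?_
    simp only [mul_assoc]
    have hm : Measurable fun y => kk hN β x y * w y := (kk_measurable_left hN β x).mul hw
    rw [lintegral_const_mul _ hm, hc, mul_assoc]

end rot

/-! ### Part 3a: the dual functional -/

/-- Data produced by `kernel_package`. -/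
structure Pkg (N : ℕ) (p α : ℝ) where
  hN : 4 ≤ N
  hp : 1 < p
  hα : p + 1 ≤ α
  θ : ℝ
  k : E N → E N → ℝ≥0∞
  A : ℝ≥0∞
  hθ : 0 < θ
  hθ1 : θ < 1
  hk : Measurable (fun z : E N × E N => k z.1 z.2)
  hks : ∀ x y, k x y = k y x
  hA : A < ⊤
  hkA : ∀ x : E N, ‖x‖ ≤ 1 → ∫⁻ y in ball (0 : E N) 1, k x y ^ ((p + 1) / 2) ≤ A
  hkw : ∀ w : E N → ℝ≥0∞, Measurable w → SInv w → ∀ x : E N, ‖x‖ ≤ 1 →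
        aw α p x * ∫⁻ y in ball (0 : E N) 1, rk ((N : ℝ) - 2 + 2 * θ) x y * w y ≤
        ∫⁻ y in ball (0 : E N) 1, k x y * w y

section dual
variable {N : ℕ} {p α : ℝ}

/-- Lebesgue measure on the ball -/
def μB (N : ℕ) : Measure (E N) := volume.restrict (ball 0 1)

instance : IsFiniteMeasure (μB N) := by
  unfold μB; exact ⟨by simp [measure_ball_lt_top]⟩

lemma ae_ball : ∀ᵐ x ∂(μB N), ‖x‖ < 1 := by
  unfold μB
  filter_upwards [ae_restrict_mem measurableSet_ball] with x hx
  simpa using hx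

def KE (p α : ℝ) (x y : E N) : ℝ≥0∞ := aw α p x * aw α p y * GE x y
def KJ (p α : ℝ) (j : ℕ) (x y : E N) : ℝ≥0∞ :=
  aw α p x * aw α p y * ENNReal.ofReal (Ge (epsj j) x y)

def TE (p α : ℝ) (w : E N → ℝ≥0∞) (x : E N) : ℝ≥0∞ := ∫⁻ y, KE p α x y * w y ∂(μB N)
def TJ (p α : ℝ) (j : ℕ) (w : E N → ℝ≥0∞) (x : E N) : ℝ≥0∞ := ∫⁻ y, KJ p α j x y * w y ∂(μB N)

lemma KE_measurable : Measurable (fun z : E N × E N => KE p α z.1 z.2) := by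
  unfold KE
  exact (((aw_measurable α p).comp measurable_fst).mul
    ((aw_measurable α p).comp measurable_snd)).mul GE_measurable

lemma KJ_measurable (j : ℕ) : Measurable (fun z : E N × E N => KJ p α j z.1 z.2) := by
  unfold KJ
  exact (((aw_measurable α p).comp measurable_fst).mul
    ((aw_measurable α p).comp measurable_snd)).mul (GEj_measurable j)

lemma KE_symm (x y : E N) : KE p α x y = KE p α y x := by
  unfold KE; rw [GE_symm, mul_comm (aw α p x)]

lemma aw_isom (g : E N ≃ₗᵢ[ℝ] E N) (x : E N) : aw α p (g x) = aw α p x := by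
  unfold aw; simp

lemma meas_mul_snd {K : E N → E N → ℝ≥0∞} (hK : Measurable (fun z : E N × E N => K z.1 z.2))
    {w : E N → ℝ≥0∞} (hw : Measurable w) :
    Measurable (fun z : E N × E N => K z.1 z.2 * w z.2) :=
  hK.mul (hw.comp measurable_snd)

lemma meas_left {K : E N → E N → ℝ≥0∞} (hK : Measurable (fun z : E N × E N => K z.1 z.2))
    (x : E N) : Measurable (fun y => K x y) :=
  hK.comp (measurable_const.prodMk measurable_id)

lemma TE_measurable {w : E N → ℝ≥0∞} (hw : Measurable w) : Measurable (TE p α w) := by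
  unfold TE
  exact (meas_mul_snd (K := KE p α) KE_measurable hw).lintegral_prod_right'

lemma TJ_measurable (j : ℕ) {w : E N → ℝ≥0∞} (hw : Measurable w) : Measurable (TJ p α j w) := by
  unfold TJ
  exact (meas_mul_snd (K := KJ p α j) (KJ_measurable j) hw).lintegral_prod_right'

lemma isom_μB (g : E N ≃ₗᵢ[ℝ] E N) (f : E N → ℝ≥0∞) :
    ∫⁻ y, f (g y) ∂(μB N) = ∫⁻ y, f y ∂(μB N) := isom_setLIntegral_ball g f

lemma TE_inv {w : E N → ℝ≥0∞} (hi : SInv w) : SInv (TE p α w) := by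
  intro g hg x
  unfold TE
  rw [← isom_μB g]
  refine lintegral_congr fun y => ?_
  simp only [KE, aw_isom, GE_isom, hi g hg]

lemma TJ_inv (j : ℕ) {w : E N → ℝ≥0∞} (hi : SInv w) : SInv (TJ p α j w) := by
  intro g hg x
  unfold TJ
  rw [← isom_μB g]
  refine lintegral_congr fun y => ?_
  simp only [KJ, aw_isom, Ge_isom, hi g hg]

lemma TE_symm {w w' : E N → ℝ≥0∞} (hw : Measurable w) (hw' : Measurable w') :
    ∫⁻ x, w x * TE p α w' x ∂(μB N) = ∫⁻ x, w' x * TE p α w x ∂(μB N) := by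
  have h1 : ∀ (f g : E N → ℝ≥0∞), Measurable f → Measurable g →
      ∫⁻ x, f x * TE p α g x ∂(μB N) = ∫⁻ x, ∫⁻ y, f x * (KE p α x y * g y) ∂(μB N) ∂(μB N) := by
    intro f g hf hg
    refine lintegral_congr fun x => ?_
    unfold TE
    have : Measurable fun y => KE p α x y * g y :=
      (meas_left (K := KE p α) KE_measurable x).mul hg
    rw [lintegral_const_mul _ this]
  rw [h1 w w' hw hw', h1 w' w hw' hw, lintegral_lintegral_swap]
  · refine lintegral_congr fun y => lintegral_congr fun x => ?_
    rw [KE_symm]; ring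
  · have := (hw.comp measurable_fst).mul (meas_mul_snd (K := KE p α) KE_measurable hw')
    exact this.aemeasurable

lemma TJ_le_TE (j : ℕ) (w : E N → ℝ≥0∞) (x : E N) : TJ p α j w x ≤ TE p α w x := by
  unfold TJ TE KJ KE
  refine lintegral_mono fun y => ?_
  simp only
  gcongr
  exact le_iSup (fun j => ENNReal.ofReal (Ge (epsj j) x y)) j

lemma TJ_mono (hN : 4 ≤ N) (w : E N → ℝ≥0∞) {x : E N} (hx : ‖x‖ ≤ 1) :
    Monotone fun j => TJ p α j w x := by
  intro i j hij
  unfold TJ KJ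
  refine lintegral_mono_ae ?_
  filter_upwards [ae_ball] with y hy
  have := GEj_mono hN hx hy.le hij
  simp only at this
  gcongr ?_ * _
  exact mul_le_mul_right this _

end dual

namespace Pkg
variable {N : ℕ} {p α : ℝ} (P : Pkg N p α)

lemma TE_le {w : E N → ℝ≥0∞} (hw : Measurable w) (hi : SInv w) {x : E N} (hx : ‖x‖ ≤ 1) (j : ℕ) :
    TE p α w x ≤ TJ p α j w x + ENNReal.ofReal (mm N * epsj j ^ P.θ) *
      ∫⁻ y, P.k x y * w y ∂(μB N) := by
  set c := ENNReal.ofReal (mm N * epsj j ^ P.θ)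
  have hm2 : Measurable fun y => rk ((N : ℝ) - 2 + 2 * P.θ) x y * w y :=
    (meas_left (K := rk ((N : ℝ) - 2 + 2 * P.θ)) (rk_measurable _) x).mul hw
  have hm1 : Measurable fun y => KJ p α j x y * w y :=
    (meas_left (K := KJ p α j) (KJ_measurable j) x).mul hw
  calc TE p α w x ≤ ∫⁻ y, (KJ p α j x y * w y +
        c * aw α p x * (rk ((N : ℝ) - 2 + 2 * P.θ) x y * w y)) ∂(μB N) := by
        unfold TE KE KJ
        refine lintegral_mono_ae ?_
        filter_upwards [ae_ball] with y hy
        have h1 := GE_le_add P.hN hx hy.le P.hθ P.hθ1.le j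
        have h2 : aw α p y ≤ 1 := aw_le_one P.hp P.hα hy.le
        calc _ ≤ aw α p x * aw α p y * (ENNReal.ofReal (Ge (epsj j) x y) +
              c * rk ((N : ℝ) - 2 + 2 * P.θ) x y) * w y := by gcongr
          _ = aw α p x * aw α p y * ENNReal.ofReal (Ge (epsj j) x y) * w y +
              c * aw α p x * aw α p y * (rk ((N : ℝ) - 2 + 2 * P.θ) x y * w y) := by ring
          _ ≤ aw α p x * aw α p y * ENNReal.ofReal (Ge (epsj j) x y) * w y +
              c * aw α p x * 1 * (rk ((N : ℝ) - 2 + 2 * P.θ) x y * w y) := by gcongr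
          _ = _ := by ring
    _ = TJ p α j w x + c * (aw α p x * ∫⁻ y, (rk ((N : ℝ) - 2 + 2 * P.θ) x y * w y) ∂(μB N)) := by
        rw [lintegral_add_left hm1, lintegral_const_mul _ hm2, TJ, mul_assoc]
    _ ≤ _ := by gcongr; exact P.hkw w hw hi x hx

/-- Constant in front of the reduced kernel. -/
def c0 : ℝ≥0∞ :=
  ENNReal.ofReal (2 ^ ((N : ℝ) - 2 + 2 * P.θ) + mm N)

lemma TE_le' {w : E N → ℝ≥0∞} (hw : Measurable w) (hi : SInv w) {x : E N} (hx : ‖x‖ ≤ 1) :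
    TE p α w x ≤ P.c0 * ∫⁻ y, P.k x y * w y ∂(μB N) := by
  have hm2 : Measurable fun y => rk ((N : ℝ) - 2 + 2 * P.θ) x y * w y :=
    (meas_left (K := rk ((N : ℝ) - 2 + 2 * P.θ)) (rk_measurable _) x).mul hw
  calc TE p α w x ≤ ∫⁻ y, (P.c0 * aw α p x * (rk ((N : ℝ) - 2 + 2 * P.θ) x y * w y)) ∂(μB N) := by
        unfold TE KE
        refine lintegral_mono_ae ?_
        filter_upwards [ae_ball] with y hy
        have h1 := GE_le_rk P.hN hx hy.le P.hθ P.hθ1.le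
        have h2 : aw α p y ≤ 1 := aw_le_one P.hp P.hα hy.le
        calc _ ≤ aw α p x * 1 * (P.c0 * rk ((N : ℝ) - 2 + 2 * P.θ) x y) * w y := by
                gcongr; exact h1
          _ = _ := by ring
    _ = P.c0 * (aw α p x * ∫⁻ y, (rk ((N : ℝ) - 2 + 2 * P.θ) x y * w y) ∂(μB N)) := by
        rw [lintegral_const_mul _ hm2, mul_assoc]
    _ ≤ _ := by gcongr; exact P.hkw w hw hi x hx

end Pkg

/-! ### Part 3b: Hoelder type facts -/

lemma ennreal_young {s t : ℝ} (hs : 0 < s) (ht : 0 < t) (hst : s + t = 1) (x y : ℝ≥0∞) :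
    x ^ s * y ^ t ≤ ENNReal.ofReal s * x + ENNReal.ofReal t * y := by
  rcases eq_or_ne x ⊤ with rfl | hx
  · rw [ENNReal.mul_top (by simpa using hs)]; simp
  rcases eq_or_ne y ⊤ with rfl | hy
  · rw [ENNReal.mul_top (by simpa using ht)]; simp
  lift x to ℝ≥0 using hx
  lift y to ℝ≥0 using hy
  rw [← ENNReal.coe_rpow_of_nonneg _ hs.le, ← ENNReal.coe_rpow_of_nonneg _ ht.le]
  have := NNReal.geom_mean_le_arith_mean2_weighted s.toNNReal t.toNNReal x y
    (by rw [← Real.toNNReal_add hs.le ht.le, hst]; simp)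
  rw [Real.coe_toNNReal _ hs.le, Real.coe_toNNReal _ ht.le] at this
  unfold ENNReal.ofReal
  exact_mod_cast this

lemma ennreal_young_eq {s t : ℝ} (hs : 0 < s) (ht : 0 < t) (hst : s + t = 1) {x y : ℝ≥0∞}
    (hx : x ≠ ⊤) (hy : y ≠ ⊤)
    (h : x ^ s * y ^ t = ENNReal.ofReal s * x + ENNReal.ofReal t * y) : x = y := by
  have h1 : x.toReal ^ s * y.toReal ^ t = s * x.toReal + t * y.toReal := by
    have := congrArg ENNReal.toReal h
    rw [ENNReal.toReal_mul, ENNReal.toReal_add (ENNReal.mul_ne_top (by simp) hx)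
      (ENNReal.mul_ne_top (by simp) hy), ENNReal.toReal_mul, ENNReal.toReal_mul,
      ENNReal.toReal_ofReal hs.le, ENNReal.toReal_ofReal ht.le, ← ENNReal.toReal_rpow,
      ← ENNReal.toReal_rpow] at this
    exact this
  have h2 := (Real.geom_mean_eq_arith_mean_weighted_iff_of_pos' (Finset.univ : Finset (Fin 2))
    ![s, t] ![x.toReal, y.toReal] (by intro i; fin_cases i <;> simp [hs, ht])
    (by simp [hst]) (by intro i; fin_cases i <;> simp)).1 (by simpa using h1)
  have h3 := h2 0 (Finset.mem_univ _)
  have h4 := h2 1 (Finset.mem_univ _)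
  rw [← h4] at h3
  simp only [Matrix.cons_val_zero, Matrix.cons_val_one] at h3
  exact (ENNReal.toReal_eq_toReal_iff' hx hy).1 h3

lemma holder_eq {X : Type*} [MeasurableSpace X] {μ : Measure X} {F H : X → ℝ≥0∞}
    (hF : Measurable F) (hH : Measurable H) {s t : ℝ} (hs : 0 < s) (ht : 0 < t) (hst : s + t = 1)
    (hF1 : ∫⁻ x, F x ∂μ ≤ 1) (hH1 : ∫⁻ x, H x ∂μ ≤ 1) (h : 1 ≤ ∫⁻ x, F x ^ s * H x ^ t ∂μ) :
    F =ᵐ[μ] H := by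
  have hub : ∫⁻ x, (ENNReal.ofReal s * F x + ENNReal.ofReal t * H x) ∂μ ≤ 1 := by
    rw [lintegral_add_left (hF.const_mul _), lintegral_const_mul _ hF, lintegral_const_mul _ hH]
    calc _ ≤ ENNReal.ofReal s * 1 + ENNReal.ofReal t * 1 := by gcongr
      _ = 1 := by rw [mul_one, mul_one, ← ENNReal.ofReal_add hs.le ht.le, hst]; simp
  have hle : ∀ x, F x ^ s * H x ^ t ≤ ENNReal.ofReal s * F x + ENNReal.ofReal t * H x :=
    fun x => ennreal_young hs ht hst _ _
  have hae := ae_eq_of_ae_le_of_lintegral_le (μ := μ) (Eventually.of_forall hle)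
    (ne_of_lt (((lintegral_mono hle).trans hub).trans_lt ENNReal.one_lt_top))
    ((hF.const_mul _).add (hH.const_mul _)).aemeasurable (hub.trans h)
  filter_upwards [hae, ae_lt_top hF (ne_of_lt (hF1.trans_lt ENNReal.one_lt_top)),
    ae_lt_top hH (ne_of_lt (hH1.trans_lt ENNReal.one_lt_top))] with x h1 h2 h3
  exact ennreal_young_eq hs ht hst h2.ne h3.ne h1

section W
variable {N : ℕ} {p α : ℝ}

structure InW (p : ℝ) (w : E N → ℝ≥0∞) : Prop where
  meas : Measurable w
  inv : SInv w
  int : ∫⁻ x, w x ^ ((p + 1) / p) ∂(μB N) ≤ 1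

lemma qconj (hp : 1 < p) : ((p + 1) / p).HolderConjugate (p + 1) := by
  rw [Real.holderConjugate_iff]
  constructor
  · rw [lt_div_iff₀ (by linarith)]; linarith
  · have : p + 1 ≠ 0 := by linarith
    field_simp
    

lemma InW.holder (hp : 1 < p) {w v : E N → ℝ≥0∞} (hw : InW p w) (hv : Measurable v) :
    ∫⁻ x, w x * v x ∂(μB N) ≤ (∫⁻ x, v x ^ (p + 1) ∂(μB N)) ^ (1 / (p + 1)) := by
  have h := ENNReal.lintegral_mul_le_Lp_mul_Lq (μB N) (qconj hp) hw.meas.aemeasurable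
    hv.aemeasurable
  refine h.trans ?_
  calc _ ≤ (1 : ℝ≥0∞) ^ (1 / ((p + 1) / p)) * (∫⁻ x, v x ^ (p + 1) ∂(μB N)) ^ (1 / (p + 1)) := by
        gcongr
        exact hw.int
    _ = _ := by simp

/-- volume-type constant bounding `∫ w` -/
def CW (N : ℕ) : ℝ≥0∞ := μB N univ + 1

lemma CW_lt_top : CW N < ⊤ := by unfold CW; simp [measure_lt_top]

lemma InW.int_le (hp : 1 < p) {w : E N → ℝ≥0∞} (hw : InW p w) :
    ∫⁻ x, w x ∂(μB N) ≤ CW N := by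
  have h : ∀ x, w x ≤ 1 + w x ^ ((p + 1) / p) := by
    intro x
    rcases le_total (w x) 1 with h | h
    · exact h.trans le_self_add
    · refine le_trans ?_ le_add_self
      calc w x = w x ^ (1 : ℝ) := by simp
        _ ≤ _ := ENNReal.rpow_le_rpow_of_exponent_le h (by
            rw [le_div_iff₀ (by linarith)]; linarith)
  refine (lintegral_mono h).trans ?_
  rw [lintegral_add_left measurable_const]
  unfold CW
  gcongr
  · simp
  · exact hw.int

lemma pexp {q : ℝ} (hp : 1 < p) (hq : q = (p + 1) / p) (x : ℝ≥0∞) : (x ^ p) ^ q = x ^ (p + 1) := by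
  rw [← ENNReal.rpow_mul, hq]; congr 1; field_simp

/-- Dual characterization of the `L^{p+1}` norm among invariant functions. -/
lemma dual_norm (hp : 1 < p) {v : E N → ℝ≥0∞} (hv : Measurable v) (hi : SInv v) {c : ℝ≥0∞}
    (h : ∀ w, InW p w → ∫⁻ x, w x * v x ∂(μB N) ≤ c) :
    ∫⁻ x, v x ^ (p + 1) ∂(μB N) ≤ c ^ (p + 1) := by
  have hp0 : (0 : ℝ) < p + 1 := by linarith
  -- truncations
  have key : ∀ n : ℕ, ∫⁻ x, (min (v x) n) ^ (p + 1) ∂(μB N) ≤ c ^ (p + 1) := by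
    intro n
    set vn : E N → ℝ≥0∞ := fun x => min (v x) n with hvn
    have hvm : Measurable vn := hv.min measurable_const
    set I := ∫⁻ x, vn x ^ (p + 1) ∂(μB N) with hI
    have hIt : I ≠ ⊤ := by
      refine ne_of_lt (lt_of_le_of_lt (lintegral_mono (g := fun _ => (n : ℝ≥0∞) ^ (p + 1)) ?_) ?_)
      · intro x; simp only; gcongr; exact min_le_right _ _
      · rw [lintegral_const]
        exact ENNReal.mul_lt_top (ENNReal.rpow_lt_top_of_nonneg hp0.le (by simp)) (measure_lt_top _ _)
    by_cases hI0 : I = 0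
    · rw [hI0]; exact zero_le
    set q := (p + 1) / p with hq
    have hq0 : 0 < q := by rw [hq]; apply div_pos <;> linarith
    set w : E N → ℝ≥0∞ := fun x => (I⁻¹) ^ (1 / q) * vn x ^ p with hw
    have hwW : InW p w := by
      refine ⟨(hvm.pow_const _).const_mul _, ?_, ?_⟩
      · intro g hg x; simp only [hw, hvn, hi g hg]
      · have : ∀ x, w x ^ q = I⁻¹ * vn x ^ (p + 1) := by
          intro x
          rw [hw]
          simp only
          rw [ENNReal.mul_rpow_of_nonneg _ _ hq0.le, pexp hp hq, ← ENNReal.rpow_mul]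
          congr 1
          rw [one_div, inv_mul_cancel₀ hq0.ne', ENNReal.rpow_one]
        rw [← hq]
        simp only [this]
        rw [lintegral_const_mul _ (hvm.pow_const _), ← hI, ENNReal.inv_mul_cancel hI0 hIt]
    have h1 := h w hwW
    have h2 : (I⁻¹) ^ (1 / q) * I ≤ c := by
      refine le_trans ?_ h1
      rw [hI, ← lintegral_const_mul _ (hvm.pow_const _)]
      refine lintegral_mono fun x => ?_
      simp only [hw]
      rw [mul_assoc]
      gcongr
      calc vn x ^ (p + 1) = vn x ^ p * vn x := by
            rw [ENNReal.rpow_add_of_nonneg _ _ (by linarith) zero_le_one, ENNReal.rpow_one]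
        _ ≤ _ := by gcongr; exact min_le_left _ _
    have h3 : (I⁻¹) ^ (1 / q) * I = I ^ (1 / (p + 1)) := by
      rw [ENNReal.inv_rpow, ← ENNReal.rpow_neg]
      nth_rw 2 [← ENNReal.rpow_one I]
      rw [← ENNReal.rpow_add _ _ hI0 hIt]
      congr 1
      rw [hq]; field_simp; ring
    rw [h3] at h2
    calc I = (I ^ (1 / (p + 1))) ^ (p + 1) := by
          rw [← ENNReal.rpow_mul, one_div, inv_mul_cancel₀ hp0.ne', ENNReal.rpow_one]
      _ ≤ _ := by gcongr
  have hsup : ∀ x, v x ^ (p + 1) = ⨆ n : ℕ, (min (v x) n) ^ (p + 1) := by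
    intro x
    have hmono : Monotone fun n : ℕ => min (v x) (n : ℝ≥0∞) := fun a b hab =>
      min_le_min le_rfl (by exact_mod_cast hab)
    have ht : Tendsto (fun n : ℕ => min (v x) (n : ℝ≥0∞)) atTop (𝓝 (v x)) := by
      have := (tendsto_const_nhds (x := v x)).min ENNReal.tendsto_nat_nhds_top
      simpa using this
    have ht2 : Tendsto (fun n : ℕ => min (v x) (n : ℝ≥0∞) ^ (p + 1)) atTop (𝓝 (v x ^ (p + 1))) :=
      (ENNReal.continuous_rpow_const.tendsto _).comp ht
    refine tendsto_nhds_unique ht2 (tendsto_atTop_iSup fun a b hab => ?_)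
    exact ENNReal.rpow_le_rpow (hmono hab) hp0.le
  simp only [hsup]
  rw [lintegral_iSup (fun n => (hv.min measurable_const).pow_const _)]
  · exact iSup_le key
  · intro a b hab x
    exact ENNReal.rpow_le_rpow (min_le_min le_rfl (by exact_mod_cast hab)) hp0.le

/-- The supremum of the dual functional. -/
def MM (N : ℕ) (p α : ℝ) : ℝ≥0∞ :=
  sSup {m | ∃ w w' : E N → ℝ≥0∞, InW p w ∧ InW p w' ∧ m = ∫⁻ x, w x * TE p α w' x ∂(μB N)}

lemma le_MM {w w' : E N → ℝ≥0∞} (hw : InW p w) (hw' : InW p w') :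
    ∫⁻ x, w x * TE p α w' x ∂(μB N) ≤ MM N p α := le_sSup ⟨w, w', hw, hw', rfl⟩

end W

namespace Pkg
variable {N : ℕ} {p α : ℝ} (P : Pkg N p α)

def D : ℝ≥0∞ := P.A ^ (1 / (p + 1)) * P.A ^ (1 / (p + 1))

lemma D_lt_top : P.D < ⊤ := by
  have := P.hp
  have h : P.A ^ (1 / (p + 1)) < ⊤ := ENNReal.rpow_lt_top_of_nonneg
    (by apply one_div_nonneg.2; linarith) P.hA.ne
  exact ENNReal.mul_lt_top h h

lemma kint_left {w : E N → ℝ≥0∞} (hw : Measurable w) :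
    Measurable fun x => ∫⁻ y, P.k x y * w y ∂(μB N) :=
  (meas_mul_snd P.hk hw).lintegral_prod_right'

lemma young {w w' : E N → ℝ≥0∞} (hw : InW p w) (hw' : InW p w') :
    ∫⁻ x, w x * (∫⁻ y, P.k x y * w' y ∂(μB N)) ∂(μB N) ≤ P.D := by
  have hp := P.hp
  set q := (p + 1) / p with hq
  set r := (p + 1) / 2 with hr
  have hq0 : 0 < q := by rw [hq]; apply div_pos <;> linarith
  have hr0 : 0 < r := by rw [hr]; linarith
  set a := (p - 1) / (p + 1) with ha
  set b := 1 / (p + 1) with hb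
  have hpp : p + 1 ≠ 0 := by linarith
  have ha0 : 0 ≤ a := by rw [ha]; apply div_nonneg <;> linarith
  have hb0 : 0 ≤ b := by rw [hb]; apply one_div_nonneg.2; linarith
  have hqab : q * a + q * b = 1 := by rw [hq, ha, hb]; field_simp; ring
  have hrb : r * b + r * b = 1 := by rw [hr, hb]; field_simp; ring
  let f : Fin 3 → E N × E N → ℝ≥0∞ := ![fun z => w z.1 ^ q * w' z.2 ^ q,
    fun z => w z.1 ^ q * P.k z.1 z.2 ^ r, fun z => P.k z.1 z.2 ^ r * w' z.2 ^ q]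
  let e : Fin 3 → ℝ := ![a, b, b]
  have m1 : Measurable fun z : E N × E N => w z.1 ^ q := (hw.meas.comp measurable_fst).pow_const _
  have m2 : Measurable fun z : E N × E N => w' z.2 ^ q := (hw'.meas.comp measurable_snd).pow_const _
  have m3 : Measurable fun z : E N × E N => P.k z.1 z.2 ^ r := P.hk.pow_const _
  have h := ENNReal.lintegral_prod_norm_pow_le (μ := (μB N).prod (μB N)) Finset.univ (f := f)
    (p := e) (by
      intro i _
      fin_cases i
      · exact (m1.mul m2).aemeasurable
      · exact (m1.mul m3).aemeasurable
      · exact (m3.mul m2).aemeasurable) (by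
      simp [e, Fin.sum_univ_three]; rw [ha, hb]; field_simp; ring) (by
      intro i _; fin_cases i <;> simp [e, ha0, hb0])
  simp only [Fin.prod_univ_three] at h
  replace h : ∫⁻ z : E N × E N, (w z.1 ^ q * w' z.2 ^ q) ^ a * (w z.1 ^ q * P.k z.1 z.2 ^ r) ^ b *
      (P.k z.1 z.2 ^ r * w' z.2 ^ q) ^ b ∂((μB N).prod (μB N)) ≤
      (∫⁻ z : E N × E N, w z.1 ^ q * w' z.2 ^ q ∂((μB N).prod (μB N))) ^ a *
      (∫⁻ z : E N × E N, w z.1 ^ q * P.k z.1 z.2 ^ r ∂((μB N).prod (μB N))) ^ b *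
      (∫⁻ z : E N × E N, P.k z.1 z.2 ^ r * w' z.2 ^ q ∂((μB N).prod (μB N))) ^ b := h
  have hpt : ∀ x y : ℝ≥0∞, ∀ κ : ℝ≥0∞, (x ^ q * y ^ q) ^ a * (x ^ q * κ ^ r) ^ b *
      (κ ^ r * y ^ q) ^ b = x * (κ * y) := by
    intro x y κ
    simp only [ENNReal.mul_rpow_of_nonneg _ _ ha0, ENNReal.mul_rpow_of_nonneg _ _ hb0,
      ← ENNReal.rpow_mul]
    have ex : ∀ x : ℝ≥0∞, x ^ (q * a) * x ^ (q * b) = x := fun x => by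
      rw [← ENNReal.rpow_add_of_nonneg _ _ (by positivity) (by positivity), hqab, ENNReal.rpow_one]
    have ek : κ ^ (r * b) * κ ^ (r * b) = κ := by
      rw [← ENNReal.rpow_add_of_nonneg _ _ (by positivity) (by positivity), hrb, ENNReal.rpow_one]
    calc _ = (x ^ (q * a) * x ^ (q * b)) * ((κ ^ (r * b) * κ ^ (r * b)) *
          (y ^ (q * a) * y ^ (q * b))) := by ring
      _ = _ := by rw [ex, ex, ek]
  simp only [hpt] at h
  have hm4 : Measurable fun z : E N × E N => w z.1 * (P.k z.1 z.2 * w' z.2) :=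
    (hw.meas.comp measurable_fst).mul (meas_mul_snd P.hk hw'.meas)
  rw [lintegral_prod _ hm4.aemeasurable] at h
  have e0 : ∀ x, ∫⁻ y, w x * (P.k x y * w' y) ∂(μB N) = w x * ∫⁻ y, P.k x y * w' y ∂(μB N) :=
    fun x => lintegral_const_mul _ ((meas_left P.hk x).mul hw'.meas)
  simp only [e0] at h
  refine h.trans ?_
  have i1 : ∫⁻ z : E N × E N, w z.1 ^ q * w' z.2 ^ q ∂((μB N).prod (μB N)) ≤ 1 := by
    rw [lintegral_prod_mul (hw.meas.pow_const _).aemeasurable (hw'.meas.pow_const _).aemeasurable]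
    exact mul_le_one' hw.int hw'.int
  have i2 : ∫⁻ z : E N × E N, w z.1 ^ q * P.k z.1 z.2 ^ r ∂((μB N).prod (μB N)) ≤ P.A := by
    have m13 : Measurable fun z : E N × E N => w z.1 ^ q * P.k z.1 z.2 ^ r := m1.mul m3
    rw [lintegral_prod _ m13.aemeasurable]
    calc _ ≤ ∫⁻ x, w x ^ q * P.A ∂(μB N) := by
          refine lintegral_mono_ae ?_
          filter_upwards [ae_ball] with x hx
          rw [lintegral_const_mul _ ((meas_left P.hk x).pow_const _)]
          gcongr
          exact P.hkA x hx.le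
      _ = (∫⁻ x, w x ^ q ∂(μB N)) * P.A := lintegral_mul_const _ (hw.meas.pow_const _)
      _ ≤ 1 * P.A := by gcongr; exact hw.int
      _ = _ := one_mul _
  have i3 : ∫⁻ z : E N × E N, P.k z.1 z.2 ^ r * w' z.2 ^ q ∂((μB N).prod (μB N)) ≤ P.A := by
    have m32 : Measurable fun z : E N × E N => P.k z.1 z.2 ^ r * w' z.2 ^ q := m3.mul m2
    rw [lintegral_prod_symm _ m32.aemeasurable]
    calc _ ≤ ∫⁻ x, P.A * w' x ^ q ∂(μB N) := by
          refine lintegral_mono_ae ?_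
          filter_upwards [ae_ball] with x hx
          simp only [P.hks _ x]
          rw [lintegral_mul_const _ ((meas_left P.hk x).pow_const _)]
          gcongr
          exact P.hkA x hx.le
      _ = P.A * (∫⁻ x, w' x ^ q ∂(μB N)) := lintegral_const_mul _ (hw'.meas.pow_const _)
      _ ≤ P.A * 1 := by gcongr; exact hw'.int
      _ = _ := mul_one _
  calc _ ≤ (1 : ℝ≥0∞) ^ a * P.A ^ b * P.A ^ b := by gcongr
    _ = P.D := by rw [ENNReal.one_rpow, one_mul, D]

lemma MM_lt_top (P : Pkg N p α) : MM N p α < ⊤ := by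
  have : MM N p α ≤ P.c0 * P.D := by
    refine sSup_le ?_
    rintro m ⟨w, w', hw, hw', rfl⟩
    have hm2 : Measurable fun x => w x * ∫⁻ y, P.k x y * w' y ∂(μB N) :=
      hw.meas.mul (P.kint_left hw'.meas)
    calc _ ≤ ∫⁻ x, P.c0 * (w x * ∫⁻ y, P.k x y * w' y ∂(μB N)) ∂(μB N) := by
          refine lintegral_mono_ae ?_
          filter_upwards [ae_ball] with x hx
          calc _ ≤ w x * (P.c0 * ∫⁻ y, P.k x y * w' y ∂(μB N)) := by
                gcongr; exact P.TE_le' hw'.meas hw'.inv hx.le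
            _ = _ := by ring
      _ = P.c0 * ∫⁻ x, w x * (∫⁻ y, P.k x y * w' y ∂(μB N)) ∂(μB N) :=
          lintegral_const_mul _ hm2
      _ ≤ _ := by gcongr; exact P.young hw hw'
  refine this.trans_lt (ENNReal.mul_lt_top ?_ P.D_lt_top)
  unfold c0; exact ENNReal.ofReal_lt_top

/-- uniform approximation of the bilinear form -/
lemma bil_le {w w' : E N → ℝ≥0∞} (hw : InW p w) (hw' : InW p w') (j : ℕ) :
    ∫⁻ x, w x * TE p α w' x ∂(μB N) ≤ ∫⁻ x, w x * TJ p α j w' x ∂(μB N) +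
      ENNReal.ofReal (mm N * epsj j ^ P.θ) * P.D := by
  set c := ENNReal.ofReal (mm N * epsj j ^ P.θ)
  have hm2 : Measurable fun x => w x * ∫⁻ y, P.k x y * w' y ∂(μB N) :=
    hw.meas.mul (P.kint_left hw'.meas)
  have hm1 : Measurable fun x => w x * TJ p α j w' x := hw.meas.mul (TJ_measurable j hw'.meas)
  calc _ ≤ ∫⁻ x, (w x * TJ p α j w' x + c * (w x * ∫⁻ y, P.k x y * w' y ∂(μB N))) ∂(μB N) := by
        refine lintegral_mono_ae ?_
        filter_upwards [ae_ball] with x hx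
        calc _ ≤ w x * (TJ p α j w' x + c * ∫⁻ y, P.k x y * w' y ∂(μB N)) := by
              gcongr; exact P.TE_le hw'.meas hw'.inv hx.le j
          _ = _ := by ring
    _ = ∫⁻ x, w x * TJ p α j w' x ∂(μB N) +
        c * ∫⁻ x, w x * ∫⁻ y, P.k x y * w' y ∂(μB N) ∂(μB N) := by
        rw [lintegral_add_left hm1, lintegral_const_mul _ hm2]
    _ ≤ _ := by gcongr; exact P.young hw hw'

end Pkg

/-! ### Part 3c: existence of a maximizer -/

lemma ascoli_seq {X : Type*} [MetricSpace X] [CompactSpace X] (f : ℕ → ℕ → X → ℝ)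
    (hb : ∀ j, ∃ C : ℝ, ∀ n x, f j n x ∈ Icc 0 C)
    (he : ∀ j, ∀ δ > 0, ∃ η > 0, ∀ n x x', dist x x' < η → dist (f j n x) (f j n x') < δ) :
    ∃ φ : ℕ → ℕ, StrictMono φ ∧ ∀ j, ∃ g : X → ℝ,
      TendstoUniformly (fun n => f j (φ n)) g atTop := by
  have hc : ∀ j n, Continuous (f j n) := by
    intro j n
    refine Metric.continuous_iff.2 fun x δ hδ => ?_
    obtain ⟨η, hη, h⟩ := he j δ hδ
    exact ⟨η, hη, fun y hy => h n y x hy⟩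
  let F : ℕ → ℕ → BoundedContinuousFunction X ℝ := fun j n =>
    BoundedContinuousFunction.mkOfCompact ⟨f j n, hc j n⟩
  have hcomp : ∀ j, IsCompact (closure (range (F j))) := by
    intro j
    obtain ⟨C, hC⟩ := hb j
    refine BoundedContinuousFunction.arzela_ascoli (Icc 0 C) isCompact_Icc (range (F j)) ?_ ?_
    · rintro _ x ⟨n, rfl⟩
      exact hC n x
    · intro x
      refine Metric.equicontinuousAt_iff.2 ?_
      intro δ hδ
      obtain ⟨η, hη, h⟩ := he j δ hδ
      refine ⟨η, hη, fun y hy => ?_⟩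
      rintro ⟨_, n, rfl⟩
      exact h n x y (by rw [dist_comm]; exact hy)
  have hK := isCompact_univ_pi hcomp
  obtain ⟨G, -, φ, hφ, hG⟩ := hK.tendsto_subseq (x := fun n j => F j n)
    (fun n j _ => subset_closure ⟨n, rfl⟩)
  refine ⟨φ, hφ, fun j => ⟨G j, ?_⟩⟩
  have := (tendsto_pi_nhds.1 hG) j
  exact BoundedContinuousFunction.tendsto_iff_tendstoUniformly.1 this

section max
variable {N : ℕ} {p α : ℝ}

def kr (p α : ℝ) (j : ℕ) (z : E N × E N) : ℝ :=
  ‖z.1‖ ^ (α / (p + 1)) * ‖z.2‖ ^ (α / (p + 1)) * Ge (epsj j) z.1 z.2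

lemma kr_continuous (hp : 1 < p) (hα : p + 1 ≤ α) (j : ℕ) :
    Continuous (kr (N := N) p α j) := by
  unfold kr
  have h0 : 0 ≤ α / (p + 1) := by apply div_nonneg <;> linarith
  exact ((continuous_fst.norm.rpow_const fun _ => Or.inr h0).mul
    (continuous_snd.norm.rpow_const fun _ => Or.inr h0)).mul (Ge_continuous (epsj_pos j))

lemma KJ_eq (j : ℕ) (x y : E N) : KJ p α j x y = ENNReal.ofReal (kr p α j (x, y)) := by
  unfold KJ kr aw
  rw [ENNReal.ofReal_mul (by positivity), ENNReal.ofReal_mul (by positivity)]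

lemma TJ_bound (hp : 1 < p) (hα : p + 1 ≤ α) (j : ℕ) : ∃ C : ℝ≥0, ∀ w : E N → ℝ≥0∞, InW p w →
    ∀ x, ‖x‖ ≤ 1 → TJ p α j w x ≤ C := by
  have hK : IsCompact (closedBall (0 : E N) 1 ×ˢ closedBall (0 : E N) 1) :=
    (isCompact_closedBall _ _).prod (isCompact_closedBall _ _)
  obtain ⟨C, hC⟩ := hK.exists_bound_of_continuousOn (kr_continuous hp hα j).continuousOn
  have hfin : ENNReal.ofReal C * CW N ≠ ⊤ := ENNReal.mul_ne_top (by simp) CW_lt_top.ne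
  refine ⟨(ENNReal.ofReal C * CW N).toNNReal, fun w hw x hx => ?_⟩
  rw [ENNReal.coe_toNNReal hfin]
  calc TJ p α j w x ≤ ∫⁻ y, ENNReal.ofReal C * w y ∂(μB N) := by
        unfold TJ
        refine lintegral_mono_ae ?_
        filter_upwards [ae_ball] with y hy
        rw [KJ_eq]
        gcongr
        exact (le_abs_self _).trans (hC (x, y) ⟨by simpa using hx, by simpa using hy.le⟩)
    _ = ENNReal.ofReal C * ∫⁻ y, w y ∂(μB N) := lintegral_const_mul _ hw.meas
    _ ≤ _ := by gcongr; exact hw.int_le hp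

lemma TJ_equi (hp : 1 < p) (hα : p + 1 ≤ α) (j : ℕ) {δ : ℝ} (hδ : 0 < δ) :
    ∃ η > 0, ∀ w : E N → ℝ≥0∞, InW p w →
    ∀ x x', ‖x‖ ≤ 1 → ‖x'‖ ≤ 1 → dist x x' < η → TJ p α j w x ≤ TJ p α j w x' + ENNReal.ofReal δ := by
  have hK : IsCompact (closedBall (0 : E N) 1 ×ˢ closedBall (0 : E N) 1) :=
    (isCompact_closedBall _ _).prod (isCompact_closedBall _ _)
  have hu := hK.uniformContinuousOn_of_continuous (kr_continuous hp hα j).continuousOn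
  rw [Metric.uniformContinuousOn_iff] at hu
  have hCpos : 0 < (CW N).toReal := by
    refine ENNReal.toReal_pos ?_ CW_lt_top.ne
    unfold CW; simp
  obtain ⟨η, hη, h⟩ := hu (δ / (CW N).toReal) (by positivity)
  refine ⟨η, hη, fun w hw x x' hx hx' hd => ?_⟩
  have hm : Measurable fun y => KJ p α j x' y * w y :=
    (meas_left (K := KJ p α j) (KJ_measurable j) x').mul hw.meas
  calc TJ p α j w x ≤ ∫⁻ y, (KJ p α j x' y * w y + ENNReal.ofReal (δ / (CW N).toReal) * w y)
          ∂(μB N) := by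
        unfold TJ
        refine lintegral_mono_ae ?_
        filter_upwards [ae_ball] with y hy
        rw [← add_mul]
        gcongr
        rw [KJ_eq, KJ_eq]
        refine le_trans (ENNReal.ofReal_le_ofReal ?_) ENNReal.ofReal_add_le
        have := h (x, y) ⟨by simpa using hx, by simpa using hy.le⟩ (x', y)
          ⟨by simpa using hx', by simpa using hy.le⟩ (by simpa [Prod.dist_eq] using hd)
        rw [Real.dist_eq] at this
        linarith [(abs_lt.1 this).2]
    _ = TJ p α j w x' + ENNReal.ofReal (δ / (CW N).toReal) * ∫⁻ y, w y ∂(μB N) := by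
        rw [lintegral_add_left hm, lintegral_const_mul _ hw.meas]; rfl
    _ ≤ TJ p α j w x' + ENNReal.ofReal (δ / (CW N).toReal) * CW N := by
        gcongr; exact hw.int_le hp
    _ = _ := by
        congr 1
        have h1 : CW N = ENNReal.ofReal (CW N).toReal :=
          (ENNReal.ofReal_toReal (CW_lt_top (N := N)).ne).symm
        calc _ = ENNReal.ofReal (δ / (CW N).toReal) * ENNReal.ofReal (CW N).toReal := by rw [← h1]
          _ = _ := by
            rw [← ENNReal.ofReal_mul (by positivity)]
            congr 1
            field_simp

/-- Uniform convergence of a subsequence of the regularized potentials. -/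
lemma TJ_subseq (hp : 1 < p) (hα : p + 1 ≤ α) (w : ℕ → E N → ℝ≥0∞) (hw : ∀ n, InW p (w n)) :
    ∃ φ : ℕ → ℕ, StrictMono φ ∧ ∀ j, ∀ δ : ℝ, 0 < δ → ∀ᶠ n in atTop, ∀ x : E N, ‖x‖ ≤ 1 →
      TJ p α j (w (φ n)) x ≤ limsup (fun n => TJ p α j (w (φ n)) x) atTop + ENNReal.ofReal δ ∧
      limsup (fun n => TJ p α j (w (φ n)) x) atTop ≤ TJ p α j (w (φ n)) x + ENNReal.ofReal δ := by
  have : CompactSpace (closedBall (0 : E N) 1) :=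
    isCompact_iff_compactSpace.1 (isCompact_closedBall _ _)
  have hb := fun j => TJ_bound (N := N) hp hα j
  have hfin : ∀ j n (x : closedBall (0 : E N) 1), TJ p α j (w n) x ≠ ⊤ := by
    intro j n x
    obtain ⟨C, hC⟩ := hb j
    exact ((hC _ (hw n) x (mem_closedBall_zero_iff.1 x.2)).trans_lt ENNReal.coe_lt_top).ne
  obtain ⟨φ, hφ, h⟩ := ascoli_seq (X := closedBall (0 : E N) 1)
    (fun j n x => (TJ p α j (w n) x).toReal) (by
      intro j
      obtain ⟨C, hC⟩ := hb j
      refine ⟨C, fun n x => ⟨ENNReal.toReal_nonneg, ?_⟩⟩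
      have := ENNReal.toReal_mono ENNReal.coe_ne_top (hC _ (hw n) x (mem_closedBall_zero_iff.1 x.2))
      simpa using this) (by
      intro j δ hδ
      obtain ⟨η, hη, h⟩ := TJ_equi (N := N) hp hα j (half_pos hδ)
      refine ⟨η, hη, fun n x x' hd => ?_⟩
      have hx : ‖(x : E N)‖ ≤ 1 := mem_closedBall_zero_iff.1 x.2
      have hx' : ‖(x' : E N)‖ ≤ 1 := mem_closedBall_zero_iff.1 x'.2
      have key : ∀ y y' : closedBall (0 : E N) 1, dist y y' < η →
          (TJ p α j (w n) y).toReal ≤ (TJ p α j (w n) y').toReal + δ / 2 := by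
        intro y y' hd
        have h1 := h _ (hw n) y y' (mem_closedBall_zero_iff.1 y.2) (mem_closedBall_zero_iff.1 y'.2) hd
        have := ENNReal.toReal_mono (ENNReal.add_ne_top.2 ⟨hfin j n y', by simp⟩) h1
        rwa [ENNReal.toReal_add (hfin j n y') (by simp), ENNReal.toReal_ofReal (by linarith)] at this
      rw [Real.dist_eq, abs_lt]
      have h1 := key x x' hd
      have h2 := key x' x (by rw [dist_comm]; exact hd)
      constructor <;> linarith)
  refine ⟨φ, hφ, fun j δ hδ => ?_⟩
  obtain ⟨g, hg⟩ := h j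
  have hlim : ∀ x : closedBall (0 : E N) 1,
      limsup (fun n => TJ p α j (w (φ n)) x) atTop = ENNReal.ofReal (g x) := by
    intro x
    have h1 := ENNReal.tendsto_ofReal (hg.tendsto_at x)
    simp only [ENNReal.ofReal_toReal (hfin _ _ _)] at h1
    exact h1.limsup_eq
  rw [Metric.tendstoUniformly_iff] at hg
  filter_upwards [hg δ hδ] with n hn x hx
  have h1 := hn ⟨x, by simpa using hx⟩
  have h2 := hlim ⟨x, by simpa using hx⟩
  have h3 := hfin j (φ n) ⟨x, by simpa using hx⟩
  simp only at h1 h2 h3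
  rw [h2]
  rw [Real.dist_eq, abs_lt] at h1
  rw [← ENNReal.ofReal_toReal h3]
  constructor
  · exact le_trans (ENNReal.ofReal_le_ofReal (by linarith)) ENNReal.ofReal_add_le
  · exact le_trans (ENNReal.ofReal_le_ofReal (by linarith)) ENNReal.ofReal_add_le

end max

/-! ### Part 3d: the Euler-Lagrange system -/

section EL
variable {N : ℕ} {p α : ℝ}

lemma norm_lem (hp : 1 < p) {M : ℝ≥0∞} (hM0 : M ≠ 0) (hMt : M ≠ ⊤) {v : E N → ℝ≥0∞}
    (hv : Measurable v) (hi : SInv v) (h : ∫⁻ x, v x ^ (p + 1) ∂(μB N) = M ^ (p + 1)) :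
    InW p (fun x => (M⁻¹ * v x) ^ p) ∧
    ∫⁻ x, ((M⁻¹ * v x) ^ p) ^ ((p + 1) / p) ∂(μB N) = 1 ∧
    ∫⁻ x, (M⁻¹ * v x) ^ p * v x ∂(μB N) = M := by
  have hp0 : (0 : ℝ) < p + 1 := by linarith
  have e1 : ∫⁻ x, ((M⁻¹ * v x) ^ p) ^ ((p + 1) / p) ∂(μB N) = 1 := by
    simp only [pexp hp rfl, ENNReal.mul_rpow_of_nonneg _ _ hp0.le]
    rw [lintegral_const_mul _ (hv.pow_const _), h, ENNReal.inv_rpow, ENNReal.inv_mul_cancel]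
    · simp [ENNReal.rpow_eq_zero_iff, hM0, hMt]
    · simp [ENNReal.rpow_eq_top_iff, hM0, hMt]
  refine ⟨⟨(hv.const_mul _).pow_const _, ?_, e1.le⟩, e1, ?_⟩
  · intro g hg x; simp only [hi g hg]
  · have hpt : ∀ x, (M⁻¹ * v x) ^ p * v x = (M⁻¹) ^ p * v x ^ (p + 1) := by
      intro x
      rw [ENNReal.mul_rpow_of_nonneg _ _ (by linarith : (0:ℝ) ≤ p),
        ENNReal.rpow_add_of_nonneg _ _ (by linarith) zero_le_one, ENNReal.rpow_one, mul_assoc]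
    simp only [hpt]
    rw [lintegral_const_mul _ (hv.pow_const _), h, ENNReal.inv_rpow, ← ENNReal.rpow_neg,
      ← ENNReal.rpow_add _ _ hM0 hMt]
    rw [show -p + (p + 1) = 1 by ring, ENNReal.rpow_one]

lemma rpow_root {x c : ℝ≥0∞} (hp : 1 < p) (h : c ≤ x ^ (1 / (p + 1))) : c ^ (p + 1) ≤ x := by
  have hp0 : (0 : ℝ) < p + 1 := by linarith
  calc c ^ (p + 1) ≤ (x ^ (1 / (p + 1))) ^ (p + 1) := by gcongr
    _ = x := by rw [← ENNReal.rpow_mul, one_div, inv_mul_cancel₀ hp0.ne', ENNReal.rpow_one]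

lemma le_of_add_ofReal {a b c : ℝ≥0∞} (hc : c ≠ ⊤)
    (h : ∀ δ : ℝ, 0 < δ → a ≤ b + ENNReal.ofReal δ * c) : a ≤ b := by
  have ht : Tendsto (fun n : ℕ => b + ENNReal.ofReal (epsj n) * c) atTop (𝓝 (b + 0 * c)) := by
    refine tendsto_const_nhds.add (ENNReal.Tendsto.mul_const ?_ (Or.inr hc))
    have := ENNReal.tendsto_ofReal epsj_tendsto
    simpa using this
  have := ge_of_tendsto' ht (fun n => h (epsj n) (epsj_pos n))
  simpa using this

theorem exists_EL (P : Pkg N p α) (hM : MM N p α ≠ 0) :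
    ∃ w w' : E N → ℝ≥0∞, InW p w ∧ InW p w' ∧
      ∫⁻ x, w x ^ ((p + 1) / p) ∂(μB N) = 1 ∧ ∫⁻ x, w' x ^ ((p + 1) / p) ∂(μB N) = 1 ∧
      (∀ x, w x = ((MM N p α)⁻¹ * TE p α w' x) ^ p) ∧
      (∀ x, w' x = ((MM N p α)⁻¹ * TE p α w x) ^ p) := by
  have hp := P.hp
  have hα := P.hα
  have hN := P.hN
  have hp0 : (0 : ℝ) < p + 1 := by linarith
  set M := MM N p α with hMdef
  have hMt : M ≠ ⊤ := P.MM_lt_top.ne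
  -- maximizing sequence
  have hne : {m | ∃ w w' : E N → ℝ≥0∞, InW p w ∧ InW p w' ∧
      m = ∫⁻ x, w x * TE p α w' x ∂(μB N)}.Nonempty := by
    have h0 : InW p (fun _ : E N => (0 : ℝ≥0∞)) := by
      refine ⟨measurable_const, fun _ _ _ => rfl, ?_⟩
      rw [ENNReal.zero_rpow_of_pos (by apply div_pos <;> linarith)]; simp
    exact ⟨_, _, _, h0, h0, rfl⟩
  obtain ⟨m, -, hmlim, hmem⟩ := exists_seq_tendsto_sSup hne (OrderTop.bddAbove _)
  choose f0 g0 hf0 hg0 hfg0 using hmem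
  obtain ⟨φ, hφ, hunif0⟩ := TJ_subseq hp hα g0 hg0
  obtain ⟨f, hfdef⟩ : ∃ f, f = fun n => f0 (φ n) := ⟨_, rfl⟩
  obtain ⟨g, hgdef⟩ : ∃ g, g = fun n => g0 (φ n) := ⟨_, rfl⟩
  have hf : ∀ n, InW p (f n) := fun n => by rw [hfdef]; exact hf0 _
  have hg : ∀ n, InW p (g n) := fun n => by rw [hgdef]; exact hg0 _
  have hlim : Tendsto (fun n => ∫⁻ x, f n x * TE p α (g n) x ∂(μB N)) atTop (𝓝 M) := by
    have := hmlim.comp hφ.tendsto_atTop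
    refine this.congr fun n => ?_
    simp only [Function.comp, hfg0, hfdef, hgdef]
  obtain ⟨vj, hvj⟩ : ∃ vj : ℕ → E N → ℝ≥0∞,
    vj = fun j x => limsup (fun n => TJ p α j (g n) x) atTop := ⟨_, rfl⟩
  have hunif : ∀ j, ∀ δ : ℝ, 0 < δ → ∀ᶠ n in atTop, ∀ x : E N, ‖x‖ ≤ 1 →
      TJ p α j (g n) x ≤ vj j x + ENNReal.ofReal δ ∧
      vj j x ≤ TJ p α j (g n) x + ENNReal.ofReal δ := by
    rw [hvj, hgdef]; exact hunif0
  have hvjm : ∀ j, Measurable (vj j) := by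
    intro j; rw [hvj]
    exact Measurable.limsup fun n => TJ_measurable j (hg n).meas
  have hvji : ∀ j, SInv (vj j) := by
    intro j S hS x; rw [hvj]
    simp only [TJ_inv j (hg _).inv S hS x]
  have hvjmono : ∀ x : E N, ‖x‖ ≤ 1 → Monotone fun j => vj j x := by
    intro x hx i j hij
    simp only [hvj]
    exact limsup_le_limsup (Eventually.of_forall fun n => TJ_mono hN (g n) hx hij)
  clear_value M
  obtain ⟨v, hv⟩ : ∃ v : E N → ℝ≥0∞, v = fun x => ⨆ j, vj j x := ⟨_, rfl⟩
  have hvm : Measurable v := by rw [hv]; exact Measurable.iSup hvjm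
  have hvi : SInv v := by
    intro S hS x; rw [hv]; simp only [hvji _ S hS x]
  have hvsup : ∀ h : E N → ℝ≥0∞, InW p h → ∀ c, (∀ j, ∫⁻ x, h x * vj j x ∂(μB N) ≤ c) →
      ∫⁻ x, h x * v x ∂(μB N) ≤ c := by
    intro h hh c hc
    have : ∀ x, h x * v x = ⨆ j, h x * vj j x := fun x => by rw [hv]; exact ENNReal.mul_iSup _ _
    simp only [this]
    rw [lintegral_iSup']
    · exact iSup_le hc
    · intro j; exact (hh.meas.mul (hvjm j)).aemeasurable
    · filter_upwards [ae_ball] with x hx i j hij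
      exact mul_le_mul_right (hvjmono x hx.le hij) _
  -- splitting integrals against constants
  have hsplit : ∀ h : E N → ℝ≥0∞, InW p h → ∀ F : E N → ℝ≥0∞, Measurable F → ∀ δ : ℝ,
      ∫⁻ x, h x * (F x + ENNReal.ofReal δ) ∂(μB N) ≤
      ∫⁻ x, h x * F x ∂(μB N) + ENNReal.ofReal δ * CW N := by
    intro h hh F hF δ
    have hm : Measurable fun x => h x * F x := hh.meas.mul hF
    simp only [mul_add]
    rw [lintegral_add_left hm, lintegral_mul_const _ hh.meas, mul_comm (ENNReal.ofReal δ)]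
    gcongr
    exact hh.int_le hp
  -- (C1)
  have C1 : ∀ h : E N → ℝ≥0∞, InW p h → ∫⁻ x, h x * v x ∂(μB N) ≤ M := by
    intro h hh
    refine hvsup h hh M fun j => le_of_add_ofReal (c := CW N) CW_lt_top.ne fun δ hδ => ?_
    obtain ⟨n, hn⟩ := (hunif j δ hδ).exists
    calc _ ≤ ∫⁻ x, h x * (TE p α (g n) x + ENNReal.ofReal δ) ∂(μB N) := by
          refine lintegral_mono_ae ?_
          filter_upwards [ae_ball] with x hx
          gcongr
          exact (hn x hx.le).2.trans (by gcongr; exact TJ_le_TE _ _ _)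
      _ ≤ _ := hsplit h hh _ (TE_measurable (hg n).meas) δ
      _ ≤ _ := by gcongr; rw [hMdef]; exact le_MM hh (hg n)
  -- (C2)
  have C2 : M ≤ (∫⁻ x, v x ^ (p + 1) ∂(μB N)) ^ (1 / (p + 1)) := by
    have key : ∀ j, M ≤ (∫⁻ x, v x ^ (p + 1) ∂(μB N)) ^ (1 / (p + 1)) +
        ENNReal.ofReal (mm N * epsj j ^ P.θ) * P.D := by
      intro j
      refine le_of_add_ofReal (c := CW N) CW_lt_top.ne fun δ hδ => ?_
      refine le_of_tendsto hlim ?_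
      filter_upwards [hunif j δ hδ] with n hn
      calc _ ≤ ∫⁻ x, f n x * TJ p α j (g n) x ∂(μB N) +
            ENNReal.ofReal (mm N * epsj j ^ P.θ) * P.D := P.bil_le (hf n) (hg n) j
        _ ≤ ∫⁻ x, f n x * (v x + ENNReal.ofReal δ) ∂(μB N) +
            ENNReal.ofReal (mm N * epsj j ^ P.θ) * P.D := by
          gcongr ?_ + _
          refine lintegral_mono_ae ?_
          filter_upwards [ae_ball] with x hx
          gcongr
          refine (hn x hx.le).1.trans ?_
          gcongr
          rw [hv]; exact le_iSup (fun j => vj j x) j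
        _ ≤ ((∫⁻ x, v x ^ (p + 1) ∂(μB N)) ^ (1 / (p + 1)) + ENNReal.ofReal δ * CW N) +
            ENNReal.ofReal (mm N * epsj j ^ P.θ) * P.D := by
          gcongr ?_ + _
          refine (hsplit _ (hf n) _ hvm δ).trans ?_
          gcongr
          exact (hf n).holder hp hvm
        _ = _ := by ring
    have ht : Tendsto (fun j => (∫⁻ x, v x ^ (p + 1) ∂(μB N)) ^ (1 / (p + 1)) +
        ENNReal.ofReal (mm N * epsj j ^ P.θ) * P.D) atTop
        (𝓝 ((∫⁻ x, v x ^ (p + 1) ∂(μB N)) ^ (1 / (p + 1)) + 0 * P.D)) := by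
      refine tendsto_const_nhds.add (ENNReal.Tendsto.mul_const ?_ (Or.inr P.D_lt_top.ne))
      have h1 : Tendsto (fun j => mm N * epsj j ^ P.θ) atTop (𝓝 (mm N * 0 ^ P.θ)) :=
        (epsj_tendsto.rpow_const (Or.inr P.hθ.le)).const_mul _
      rw [Real.zero_rpow P.hθ.ne', mul_zero] at h1
      simpa using ENNReal.tendsto_ofReal h1
    have := ge_of_tendsto' ht key
    simpa using this
  have C3 : ∫⁻ x, v x ^ (p + 1) ∂(μB N) = M ^ (p + 1) :=
    le_antisymm (dual_norm hp hvm hvi C1) (rpow_root hp C2)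
  obtain ⟨hw, hw1, hwv⟩ := norm_lem hp hM hMt hvm hvi C3
  set w : E N → ℝ≥0∞ := fun x => (M⁻¹ * v x) ^ p with hwdef
  have C4 : M ≤ (∫⁻ x, TE p α w x ^ (p + 1) ∂(μB N)) ^ (1 / (p + 1)) := by
    rw [← hwv]
    refine hvsup w hw _ fun j => le_of_add_ofReal (c := CW N) CW_lt_top.ne fun δ hδ => ?_
    obtain ⟨n, hn⟩ := (hunif j δ hδ).exists
    calc _ ≤ ∫⁻ x, w x * (TE p α (g n) x + ENNReal.ofReal δ) ∂(μB N) := by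
          refine lintegral_mono_ae ?_
          filter_upwards [ae_ball] with x hx
          refine mul_le_mul_right ?_ _
          exact (hn x hx.le).2.trans (by gcongr; exact TJ_le_TE _ _ _)
      _ ≤ _ := hsplit w hw _ (TE_measurable (hg n).meas) δ
      _ ≤ _ := by
        gcongr
        rw [TE_symm hw.meas (hg n).meas]
        exact (hg n).holder hp (TE_measurable hw.meas)
  have hTw : ∫⁻ x, TE p α w x ^ (p + 1) ∂(μB N) = M ^ (p + 1) := by
    refine le_antisymm (dual_norm hp (TE_measurable hw.meas) (TE_inv hw.inv) ?_) (rpow_root hp C4)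
    intro h hh
    rw [hMdef]; exact le_MM hh hw
  obtain ⟨hw', hw1', hwv'⟩ := norm_lem hp hM hMt (TE_measurable hw.meas) (TE_inv hw.inv) hTw
  set w' : E N → ℝ≥0∞ := fun x => (M⁻¹ * TE p α w x) ^ p with hwdef'
  -- (C5)
  have hTw' : ∫⁻ x, TE p α w' x ^ (p + 1) ∂(μB N) ≤ M ^ (p + 1) := by
    refine dual_norm hp (TE_measurable hw'.meas) (TE_inv hw'.inv) ?_
    intro h hh
    rw [hMdef]; exact le_MM hh hw'
  have hq0 : 0 < (p + 1) / p := by apply div_pos <;> linarith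
  have hae := holder_eq (μ := μB N) (F := fun x => w x ^ ((p + 1) / p))
    (H := fun x => (M⁻¹ * TE p α w' x) ^ (p + 1)) (s := 1 / ((p + 1) / p)) (t := 1 / (p + 1))
    (hw.meas.pow_const _) (((TE_measurable hw'.meas).const_mul _).pow_const _)
    (by positivity) (by positivity) (by field_simp) hw.int (by
      simp only [ENNReal.mul_rpow_of_nonneg _ _ hp0.le]
      rw [lintegral_const_mul _ ((TE_measurable hw'.meas).pow_const _)]
      calc _ ≤ M⁻¹ ^ (p + 1) * M ^ (p + 1) := by gcongr
        _ = 1 := by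
          rw [ENNReal.inv_rpow, ENNReal.inv_mul_cancel]
          · simp [ENNReal.rpow_eq_zero_iff, hM, hMt]
          · simp [ENNReal.rpow_eq_top_iff, hM, hMt]) (by
      have hpt : ∀ a b : ℝ≥0∞, (a ^ ((p + 1) / p)) ^ (1 / ((p + 1) / p)) *
          ((M⁻¹ * b) ^ (p + 1)) ^ (1 / (p + 1)) = M⁻¹ * (a * b) := by
        intro a b
        rw [← ENNReal.rpow_mul, ← ENNReal.rpow_mul, mul_one_div_cancel hq0.ne',
          mul_one_div_cancel hp0.ne', ENNReal.rpow_one, ENNReal.rpow_one]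
        ring
      have hm : Measurable fun x => w x * TE p α w' x := hw.meas.mul (TE_measurable hw'.meas)
      simp only [hpt]
      rw [lintegral_const_mul _ hm, TE_symm hw.meas hw'.meas, hwv', ENNReal.inv_mul_cancel hM hMt])
  have hae2 : w =ᵐ[μB N] fun x => (M⁻¹ * TE p α w' x) ^ p := by
    filter_upwards [hae] with x hx
    have := congrArg (fun y => y ^ (p / (p + 1))) hx
    simp only [← ENNReal.rpow_mul] at this
    rw [show (p + 1) / p * (p / (p + 1)) = 1 by field_simp,
      show (p + 1) * (p / (p + 1)) = p by field_simp, ENNReal.rpow_one] at this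
    exact this
  set w2 : E N → ℝ≥0∞ := fun x => (M⁻¹ * TE p α w' x) ^ p with hw2
  have hT : TE p α w2 = TE p α w := by
    funext x
    unfold TE
    refine lintegral_congr_ae ?_
    filter_upwards [hae2] with y hy
    rw [hy]
  have hint2 : ∫⁻ x, w2 x ^ ((p + 1) / p) ∂(μB N) = 1 := by
    rw [← hw1]
    refine lintegral_congr_ae ?_
    filter_upwards [hae2] with y hy
    rw [← hy]
  refine ⟨w2, w', ⟨((TE_measurable hw'.meas).const_mul _).pow_const _, ?_, hint2.le⟩, hw', hint2,
    hw1', fun x => rfl, fun x => ?_⟩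
  · intro S hS x
    simp only [hw2, TE_inv hw'.inv S hS x]
  · rw [hT]

end EL

/-! ### Part 4: boundedness -/

section bdd
variable {N : ℕ} {p α : ℝ}

lemma Pkg.kint_le (P : Pkg N p α) {x : E N} (hx : ‖x‖ ≤ 1) :
    ∫⁻ y, P.k x y ∂(μB N) ≤ μB N univ + P.A := by
  have hp := P.hp
  have h : ∀ y, P.k x y ≤ 1 + P.k x y ^ ((p + 1) / 2) := by
    intro y
    rcases le_total (P.k x y) 1 with h | h
    · exact h.trans le_self_add
    · refine le_trans ?_ le_add_self
      calc P.k x y = P.k x y ^ (1 : ℝ) := by simp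
        _ ≤ _ := ENNReal.rpow_le_rpow_of_exponent_le h (by linarith)
  refine (lintegral_mono h).trans ?_
  rw [lintegral_add_left measurable_const]
  gcongr
  · simp
  · exact P.hkA x hx

lemma Pkg.bdd (P : Pkg N p α) {V : E N → ℝ≥0∞} (hV : Measurable V)
    (hintg : ∫⁻ x, V x ^ (p + 1) ∂(μB N) ≠ ⊤) {C : ℝ≥0∞} (hC : C ≠ ⊤)
    (h : ∀ x, ‖x‖ ≤ 1 → V x ≤ C * ∫⁻ y, P.k x y * V y ^ p ∂(μB N)) :
    ∃ b : ℝ≥0∞, b ≠ ⊤ ∧ ∀ x, ‖x‖ ≤ 1 → V x ≤ b := by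
  have hp := P.hp
  have hp0 : (0 : ℝ) < p + 1 := by linarith
  set r := (p + 1) / 2 with hr
  set r' := (p + 1) / (p - 1) with hr'
  have hpm : 0 < p - 1 := by linarith
  have hr'0 : 0 < r' := by rw [hr']; positivity
  have hconj : r.HolderConjugate r' := by
    rw [Real.holderConjugate_iff]
    constructor
    · rw [hr]; linarith
    · rw [hr, hr']; field_simp; ring
  -- tail of V
  have htail : Tendsto (fun n : ℕ => ∫⁻ x in {x | (n : ℝ≥0∞) < V x}, V x ^ (p + 1) ∂(μB N)) atTop
      (𝓝 0) := by
    refine tendsto_setLIntegral_zero hintg ?_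
    have hanti : Antitone fun n : ℕ => {x : E N | (n : ℝ≥0∞) < V x} := by
      intro a b hab x hx
      exact lt_of_le_of_lt (b := (b : ℝ≥0∞)) (by exact_mod_cast hab) hx
    have hms : ∀ n : ℕ, MeasurableSet {x : E N | (n : ℝ≥0∞) < V x} := fun n =>
      measurableSet_lt measurable_const hV
    have := tendsto_measure_iInter_atTop (μ := μB N) (fun n => (hms n).nullMeasurableSet) hanti
      ⟨0, (measure_lt_top _ _).ne⟩
    have h0 : μB N (⋂ n : ℕ, {x : E N | (n : ℝ≥0∞) < V x}) = 0 := by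
      have hfin := ae_lt_top (hV.pow_const (p + 1)) hintg
      refine measure_mono_null ?_ hfin
      intro x hx
      simp only [mem_iInter, mem_ofPred_eq] at hx
      have : V x = ⊤ := by
        by_contra hne
        obtain ⟨n, hn⟩ := ENNReal.exists_nat_gt hne
        exact lt_asymm hn (hx n)
      simp [this, ENNReal.top_rpow_of_pos hp0]
    rw [h0] at this
    exact this
  have hA' : P.A ^ (1 / r) ≠ ⊤ := (ENNReal.rpow_lt_top_of_nonneg
    (one_div_nonneg.2 hconj.nonneg) P.hA.ne).ne
  have hL : ∃ n : ℕ, C * (P.A ^ (1 / r) *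
      (∫⁻ x in {x | (n : ℝ≥0∞) < V x}, V x ^ (p + 1) ∂(μB N)) ^ (1 / r')) ≤ 1 / 2 := by
    have h1 : Tendsto (fun n : ℕ => C * (P.A ^ (1 / r) *
      (∫⁻ x in {x | (n : ℝ≥0∞) < V x}, V x ^ (p + 1) ∂(μB N)) ^ (1 / r'))) atTop
      (𝓝 (C * (P.A ^ (1 / r) * 0 ^ (1 / r')))) := by
      refine ENNReal.Tendsto.const_mul (ENNReal.Tendsto.const_mul ?_ (Or.inr hA')) (Or.inr hC)
      exact (ENNReal.continuous_rpow_const.tendsto _).comp htail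
    rw [ENNReal.zero_rpow_of_pos (by positivity), mul_zero, mul_zero] at h1
    exact ((h1.eventually_lt_const (by simp : (0 : ℝ≥0∞) < 1 / 2)).mono fun n hn => hn.le).exists
  obtain ⟨L, hL⟩ := hL
  set S : Set (E N) := {x | (L : ℝ≥0∞) < V x} with hS
  have hSm : MeasurableSet S := measurableSet_lt measurable_const hV
  set PL : E N → ℝ≥0∞ := S.indicator (fun x => V x ^ (p - 1)) with hPL
  have hPLm : Measurable PL := (hV.pow_const _).indicator hSm
  have hS1 : ∀ x, ‖x‖ ≤ 1 → C * ∫⁻ y, P.k x y * PL y ∂(μB N) ≤ 1 / 2 := by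
    intro x hx
    refine le_trans ?_ hL
    gcongr
    have h1 := ENNReal.lintegral_mul_le_Lp_mul_Lq (μB N) hconj (meas_left P.hk x).aemeasurable
      hPLm.aemeasurable
    refine h1.trans ?_
    have h2 : ∀ y, PL y ^ r' = S.indicator (fun x => V x ^ (p + 1)) y := by
      intro y
      by_cases hy : y ∈ S
      · simp only [hPL, indicator_of_mem hy]
        rw [← ENNReal.rpow_mul, hr']; congr 1; field_simp
      · simp only [hPL, indicator_of_notMem hy]
        exact ENNReal.zero_rpow_of_pos hr'0
    simp only [h2]
    rw [lintegral_indicator hSm]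
    have h3 := P.hkA x hx
    have hr1 : 0 ≤ 1 / r := one_div_nonneg.2 hconj.nonneg
    gcongr
    exact h3
  set κ := μB N univ + P.A with hκ
  have hκt : κ ≠ ⊤ := ENNReal.add_ne_top.2 ⟨(measure_lt_top _ _).ne, P.hA.ne⟩
  set b := C * ((L : ℝ≥0∞) ^ p * κ) with hb
  have hbt : b ≠ ⊤ := ENNReal.mul_ne_top hC (ENNReal.mul_ne_top
    (ENNReal.rpow_lt_top_of_nonneg (by linarith) (by simp)).ne hκt)
  have hVp : ∀ y, V y ^ p ≤ PL y * V y + (L : ℝ≥0∞) ^ p := by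
    intro y
    by_cases hy : y ∈ S
    · refine le_trans ?_ le_self_add
      simp only [hPL, indicator_of_mem hy]
      rw [show p = (p - 1) + 1 by ring, ENNReal.rpow_add_of_nonneg _ _ hpm.le zero_le_one,
        ENNReal.rpow_one]
      simp
    · refine le_trans ?_ le_add_self
      have : V y ≤ L := not_lt.1 hy
      gcongr
  set g : E N → ℝ≥0∞ := fun x => V x - 2 * b with hg
  have hgm : Measurable g := hV.sub measurable_const
  have hm1 : ∀ x, Measurable fun y => P.k x y * (PL y * g y) := fun x =>
    (meas_left P.hk x).mul (hPLm.mul hgm)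
  have hm2 : ∀ x, Measurable fun y => P.k x y * PL y := fun x => (meas_left P.hk x).mul hPLm
  have hgS : ∀ x, ‖x‖ ≤ 1 → g x ≤ C * ∫⁻ y, P.k x y * (PL y * g y) ∂(μB N) := by
    intro x hx
    simp only [hg]
    rw [tsub_le_iff_right]
    have hm3 : Measurable fun y => (2 * b) * (P.k x y * PL y) := (hm2 x).const_mul _
    have hm4 : Measurable fun y => (L : ℝ≥0∞) ^ p * P.k x y := (meas_left P.hk x).const_mul _
    calc V x ≤ C * ∫⁻ y, P.k x y * V y ^ p ∂(μB N) := h x hx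
      _ ≤ C * ∫⁻ y, (P.k x y * (PL y * g y) + ((2 * b) * (P.k x y * PL y) +
          (L : ℝ≥0∞) ^ p * P.k x y)) ∂(μB N) := by
          gcongr with y
          calc P.k x y * V y ^ p ≤ P.k x y * (PL y * (g y + 2 * b) + (L : ℝ≥0∞) ^ p) := by
                gcongr
                refine (hVp y).trans ?_
                gcongr
                exact le_tsub_add
            _ = _ := by ring
      _ = C * ∫⁻ y, P.k x y * (PL y * g y) ∂(μB N) + ((2 * b) * (C * ∫⁻ y, P.k x y * PL y ∂(μB N))
          + C * ((L : ℝ≥0∞) ^ p * ∫⁻ y, P.k x y ∂(μB N))) := by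
          rw [lintegral_add_left (hm1 x), lintegral_add_left hm3, lintegral_const_mul _ (hm2 x),
            lintegral_const_mul _ (meas_left P.hk x)]
          ring
      _ ≤ C * ∫⁻ y, P.k x y * (PL y * g y) ∂(μB N) + ((2 * b) * (1 / 2) + b) := by
          have h1 := hS1 x hx
          have h2 := P.kint_le hx
          gcongr
          rw [hb]
          gcongr
      _ = _ := by
          congr 1
          rw [mul_comm 2 b, mul_assoc, one_div, ENNReal.mul_inv_cancel (by simp) (by simp), mul_one,
            mul_two]
  set I := ∫⁻ x, PL x * g x ∂(μB N) with hI
  have hIt : I ≠ ⊤ := by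
    refine ne_of_lt (lt_of_le_of_lt (lintegral_mono (g := fun x => 1 + V x ^ (p + 1)) ?_) ?_)
    · intro x
      simp only
      have h1 : PL x * g x ≤ V x ^ p := by
        have hp1 : V x ^ p = V x ^ (p - 1) * V x := by
          conv_lhs => rw [show p = (p - 1) + 1 by ring]
          rw [ENNReal.rpow_add_of_nonneg _ _ hpm.le zero_le_one, ENNReal.rpow_one]
        rw [hp1]
        gcongr
        · exact indicator_le_self _ _ x
        · exact tsub_le_self
      refine h1.trans ?_
      rcases le_total (V x) 1 with h | h
      · refine le_trans ?_ le_self_add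
        exact ENNReal.rpow_le_one h (by linarith)
      · refine le_trans ?_ le_add_self
        exact ENNReal.rpow_le_rpow_of_exponent_le h (by linarith)
    · rw [lintegral_add_left measurable_const]
      refine ENNReal.add_lt_top.2 ⟨?_, hintg.lt_top⟩
      simp [measure_lt_top]
  have hI2 : I ≤ (1 / 2) * I := by
    have hmm : Measurable fun z : E N × E N => PL z.1 * (P.k z.1 z.2 * (PL z.2 * g z.2)) :=
      (hPLm.comp measurable_fst).mul (meas_mul_snd P.hk (hPLm.mul hgm))
    calc I ≤ ∫⁻ x, PL x * (C * ∫⁻ y, P.k x y * (PL y * g y) ∂(μB N)) ∂(μB N) := by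
          refine lintegral_mono_ae ?_
          filter_upwards [ae_ball] with x hx
          gcongr
          exact hgS x hx.le
      _ = C * ∫⁻ x, ∫⁻ y, PL x * (P.k x y * (PL y * g y)) ∂(μB N) ∂(μB N) := by
          rw [← lintegral_const_mul _ hmm.lintegral_prod_right']
          refine lintegral_congr fun x => ?_
          have : ∫⁻ y, PL x * (P.k x y * (PL y * g y)) ∂(μB N) =
            PL x * ∫⁻ y, P.k x y * (PL y * g y) ∂(μB N) := lintegral_const_mul _ (hm1 x)
          simp only [this]
          ring
      _ = C * ∫⁻ y, ∫⁻ x, PL x * (P.k x y * (PL y * g y)) ∂(μB N) ∂(μB N) := by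
          rw [lintegral_lintegral_swap hmm.aemeasurable]
      _ = ∫⁻ y, (PL y * g y) * (C * ∫⁻ x, P.k y x * PL x ∂(μB N)) ∂(μB N) := by
          rw [← lintegral_const_mul _ hmm.lintegral_prod_left']
          refine lintegral_congr fun y => ?_
          have : ∀ x, PL x * (P.k x y * (PL y * g y)) = (PL y * g y) * (P.k y x * PL x) := by
            intro x; rw [P.hks x y]; ring
          simp only [this]
          rw [lintegral_const_mul _ (hm2 y)]
          ring
      _ ≤ ∫⁻ y, (PL y * g y) * (1 / 2) ∂(μB N) := by
          refine lintegral_mono_ae ?_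
          filter_upwards [ae_ball] with x hx
          gcongr
          exact hS1 x hx.le
      _ = _ := by
          have hm5 : Measurable fun y => PL y * g y := hPLm.mul hgm
          rw [lintegral_mul_const _ hm5, mul_comm]
  have hI0 : I = 0 := by
    by_contra hne
    have h1 : I < I := by
      calc I ≤ (1 / 2) * I := hI2
        _ = I / 2 := by rw [one_div, mul_comm, ENNReal.div_eq_inv_mul, mul_comm]
        _ < I := ENNReal.half_lt_self hne hIt
    exact lt_irrefl _ h1
  have hae : ∀ᵐ y ∂(μB N), PL y * g y = 0 := by
    have hm5 : Measurable fun y => PL y * g y := hPLm.mul hgm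
    exact (lintegral_eq_zero_iff hm5).1 hI0
  refine ⟨2 * b, ENNReal.mul_ne_top (by simp) hbt, fun x hx => ?_⟩
  have h1 := hgS x hx
  have h2 : ∫⁻ y, P.k x y * (PL y * g y) ∂(μB N) = 0 := by
    rw [lintegral_eq_zero_iff (hm1 x)]
    filter_upwards [hae] with y hy
    simp only [hy, mul_zero]; rfl
  rw [h2, mul_zero] at h1
  exact tsub_eq_zero_iff_le.1 (le_antisymm h1 zero_le)

/-- The solutions of the Euler-Lagrange system are bounded. -/
lemma EL_bdd (P : Pkg N p α) (hM : MM N p α ≠ 0) {w w' : E N → ℝ≥0∞} (hw : InW p w) (hw' : InW p w')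
    (h1 : ∀ x, w x = ((MM N p α)⁻¹ * TE p α w' x) ^ p)
    (h2 : ∀ x, w' x = ((MM N p α)⁻¹ * TE p α w x) ^ p) :
    ∃ b : ℝ≥0∞, b ≠ ⊤ ∧ ∀ x, ‖x‖ ≤ 1 → w x ≤ b ∧ w' x ≤ b := by
  have hp := P.hp
  have hp0 : (0 : ℝ) < p + 1 := by linarith
  set M := MM N p α
  have hMi : M⁻¹ ≠ ⊤ := by simpa using hM
  set a1 : E N → ℝ≥0∞ := fun x => M⁻¹ * TE p α w' x with ha1
  set a2 : E N → ℝ≥0∞ := fun x => M⁻¹ * TE p α w x with ha2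
  have ha1m : Measurable a1 := (TE_measurable hw'.meas).const_mul _
  have ha2m : Measurable a2 := (TE_measurable hw.meas).const_mul _
  set V : E N → ℝ≥0∞ := fun x => a1 x + a2 x with hV
  have hVm : Measurable V := ha1m.add ha2m
  have hintg : ∫⁻ x, V x ^ (p + 1) ∂(μB N) ≠ ⊤ := by
    have hle : ∀ x, V x ^ (p + 1) ≤ 2 ^ (p + 1 - 1) * (w x ^ ((p + 1) / p) + w' x ^ ((p + 1) / p)) := by
      intro x
      have := ENNReal.rpow_add_le_mul_rpow_add_rpow (a1 x) (a2 x) (by linarith : 1 ≤ p + 1)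
      rw [h1, h2, pexp hp rfl, pexp hp rfl]
      exact this
    refine ne_of_lt (lt_of_le_of_lt (lintegral_mono hle) ?_)
    have hm6 : Measurable fun x => w x ^ ((p + 1) / p) + w' x ^ ((p + 1) / p) :=
      (hw.meas.pow_const _).add (hw'.meas.pow_const _)
    rw [lintegral_const_mul _ hm6,
      lintegral_add_left (hw.meas.pow_const _)]
    refine ENNReal.mul_lt_top (ENNReal.rpow_lt_top_of_nonneg (by linarith) (by simp)) ?_
    exact ENNReal.add_lt_top.2 ⟨hw.int.trans_lt ENNReal.one_lt_top, hw'.int.trans_lt ENNReal.one_lt_top⟩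
  have hc0 : P.c0 ≠ ⊤ := by unfold Pkg.c0; simp
  obtain ⟨b, hb, hVb⟩ := P.bdd hVm hintg (C := M⁻¹ * P.c0 * 2)
    (ENNReal.mul_ne_top (ENNReal.mul_ne_top hMi hc0) (by simp)) (by
    intro x hx
    have e1 := P.TE_le' hw'.meas hw'.inv hx
    have e2 := P.TE_le' hw.meas hw.inv hx
    have hm : Measurable fun y => P.k x y * w' y := (meas_left P.hk x).mul hw'.meas
    have hm2 : Measurable fun y => P.k x y * V y ^ p := (meas_left P.hk x).mul (hVm.pow_const _)
    calc V x ≤ M⁻¹ * (P.c0 * ∫⁻ y, P.k x y * w' y ∂(μB N)) +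
          M⁻¹ * (P.c0 * ∫⁻ y, P.k x y * w y ∂(μB N)) := by
          simp only [hV, ha1, ha2]; gcongr
      _ = M⁻¹ * P.c0 * ∫⁻ y, (P.k x y * w' y + P.k x y * w y) ∂(μB N) := by
          rw [lintegral_add_left hm]; ring
      _ ≤ M⁻¹ * P.c0 * ∫⁻ y, 2 * (P.k x y * V y ^ p) ∂(μB N) := by
          gcongr with y
          have hp0' : 0 ≤ p := by linarith
          have g1 : w' y ≤ V y ^ p := by
            rw [h2]; exact ENNReal.rpow_le_rpow le_add_self hp0'
          have g2 : w y ≤ V y ^ p := by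
            rw [h1]; exact ENNReal.rpow_le_rpow le_self_add hp0'
          rw [two_mul]
          gcongr
      _ = _ := by rw [lintegral_const_mul _ hm2]; ring)
  have hp0' : 0 ≤ p := by linarith
  refine ⟨b ^ p, (ENNReal.rpow_lt_top_of_nonneg hp0' hb).ne, fun x hx => ⟨?_, ?_⟩⟩
  · rw [h1]; exact ENNReal.rpow_le_rpow (le_self_add.trans (hVb x hx)) hp0'
  · rw [h2]; exact ENNReal.rpow_le_rpow (le_add_self.trans (hVb x hx)) hp0'

end bdd

/-! ### Part 5a: calculus with partial derivatives -/

section calc1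
variable {N : ℕ}

/-- the `i`-th coordinate as a continuous linear form -/
def pj (i : Fin N) : E N →L[ℝ] ℝ := EuclideanSpace.proj i

@[simp] lemma pj_apply (i : Fin N) (x : E N) : pj i x = x i := rfl

/-- `F` has partial derivatives `G i` on `U` in the Frechet sense. -/
def D1 (U : Set (E N)) (F : E N → ℝ) (G : Fin N → E N → ℝ) : Prop :=
  ∀ x ∈ U, HasFDerivAt F (∑ i, G i x • pj i) x

variable {U V : Set (E N)} {F F' : E N → ℝ} {G G' : Fin N → E N → ℝ}

lemma D1.mono (h : D1 U F G) (hV : V ⊆ U) : D1 V F G := fun x hx => h x (hV hx)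

lemma D1.add (h : D1 U F G) (h' : D1 U F' G') :
    D1 U (fun x => F x + F' x) (fun i x => G i x + G' i x) := by
  intro x hx
  have := (h x hx).add (h' x hx)
  rw [← Finset.sum_add_distrib] at this
  simp only [← add_smul] at this
  exact this

lemma D1.sub (h : D1 U F G) (h' : D1 U F' G') :
    D1 U (fun x => F x - F' x) (fun i x => G i x - G' i x) := by
  intro x hx
  have := (h x hx).sub (h' x hx)
  rw [← Finset.sum_sub_distrib] at this
  simp only [← sub_smul] at this
  exact this

lemma D1.const_mul (h : D1 U F G) (c : ℝ) :
    D1 U (fun x => c * F x) (fun i x => c * G i x) := by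
  intro x hx
  have := (h x hx).const_mul c
  rw [Finset.smul_sum] at this
  simp only [smul_smul] at this
  exact this

lemma D1.congr (h : D1 U F G) (hU : IsOpen U) (hF : ∀ x ∈ U, F' x = F x)
    (hG : ∀ i, ∀ x ∈ U, G' i x = G i x) : D1 U F' G' := by
  intro x hx
  have h1 : (∑ i, G' i x • pj i : E N →L[ℝ] ℝ) = ∑ i, G i x • pj i :=
    Finset.sum_congr rfl fun i _ => by rw [hG i x hx]
  rw [h1]
  exact (h x hx).congr_of_eventuallyEq (eventuallyEq_of_mem (hU.mem_nhds hx) hF)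

lemma D1.continuousOn (h : D1 U F G) : ContinuousOn F U := fun x hx =>
  (h x hx).continuousAt.continuousWithinAt

lemma D1.fderiv_eq (h : D1 U F G) {x : E N} (hx : x ∈ U) : fderiv ℝ F x = ∑ i, G i x • pj i :=
  (h x hx).fderiv

lemma sum_pj_single (c : Fin N → ℝ) (i : Fin N) :
    (∑ j, c j • pj j : E N →L[ℝ] ℝ) (EuclideanSpace.single i 1) = c i := by
  simp

lemma D1.fderiv_single (h : D1 U F G) {x : E N} (hx : x ∈ U) (i : Fin N) :
    fderiv ℝ F x (EuclideanSpace.single i 1) = G i x := by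
  rw [h.fderiv_eq hx, sum_pj_single]

lemma clm_eq_sum (L : E N →L[ℝ] ℝ) : L = ∑ i, L (EuclideanSpace.single i 1) • pj i := by
  ext x
  have hx : x = ∑ i, x i • EuclideanSpace.single i (1 : ℝ) := by
    ext j; simp [Finset.sum_apply, Pi.single_apply]
  conv_lhs => rw [hx, map_sum]
  simp [mul_comm]

lemma D1_of_differentiable (h : ∀ x ∈ U, DifferentiableAt ℝ F x) :
    D1 U F (fun i x => fderiv ℝ F x (EuclideanSpace.single i 1)) := by
  intro x hx
  rw [← clm_eq_sum]
  exact (h x hx).hasFDerivAt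

lemma D1.contDiffOn_one (h : D1 U F G) (hU : IsOpen U) (hG : ∀ i, ContinuousOn (G i) U) :
    ContDiffOn ℝ 1 F U := by
  rw [show (1 : WithTop ℕ∞) = 0 + 1 by rfl, contDiffOn_succ_iff_fderiv_of_isOpen hU]
  refine ⟨fun x hx => (h x hx).differentiableAt.differentiableWithinAt, by simp, ?_⟩
  rw [contDiffOn_zero]
  have : ContinuousOn (fun x => (∑ i, G i x • pj i : E N →L[ℝ] ℝ)) U :=
    continuousOn_finsetSum _ fun i _ => (hG i).smul continuousOn_const
  exact this.congr fun x hx => h.fderiv_eq hx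

lemma D1.contDiffOn_two (h : D1 U F G) (hU : IsOpen U) {H : Fin N → Fin N → E N → ℝ}
    (hG : ∀ i, D1 U (G i) (H i)) (hH : ∀ i j, ContinuousOn (H i j) U) :
    ContDiffOn ℝ 2 F U := by
  rw [show (2 : WithTop ℕ∞) = 1 + 1 by norm_num, contDiffOn_succ_iff_fderiv_of_isOpen hU]
  refine ⟨fun x hx => (h x hx).differentiableAt.differentiableWithinAt, by simp, ?_⟩
  have : ContDiffOn ℝ 1 (fun x => (∑ i, G i x • pj i : E N →L[ℝ] ℝ)) U :=
    ContDiffOn.sum fun i _ => ((hG i).contDiffOn_one hU (hH i)).smul contDiffOn_const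
  exact this.congr fun x hx => h.fderiv_eq hx

lemma D1.lap_eq (h : D1 U F G) (hU : IsOpen U) {H : Fin N → Fin N → E N → ℝ}
    (hG : ∀ i, D1 U (G i) (H i)) {x : E N} (hx : x ∈ U) : lap F x = ∑ i, H i i x := by
  unfold lap
  refine Finset.sum_congr rfl fun i _ => ?_
  rw [Filter.EventuallyEq.fderiv_eq (f := G i)
    (eventuallyEq_of_mem (hU.mem_nhds hx) fun y hy => h.fderiv_single hy i)]
  exact (hG i).fderiv_single hx i

/-- passage to the limit -/
lemma D1.of_limit (hU : IsOpen U) {Fn : ℕ → E N → ℝ} {Gn : ℕ → Fin N → E N → ℝ}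
    (h : ∀ n, D1 U (Fn n) (Gn n)) (hF : ∀ x ∈ U, Tendsto (fun n => Fn n x) atTop (𝓝 (F x)))
    (hG : ∀ i, TendstoUniformlyOn (fun n => Gn n i) (G i) atTop U) : D1 U F G := by
  intro x hx
  refine hasFDerivAt_of_tendstoUniformlyOn (f := Fn) (f' := fun n x => ∑ i, Gn n i x • pj i)
    (g' := fun x => ∑ i, G i x • pj i) hU ?_ h hF hx
  rw [Metric.tendstoUniformlyOn_iff]
  intro δ hδ
  have hC : 0 < ∑ i : Fin N, ‖(pj i : E N →L[ℝ] ℝ)‖ + 1 := by positivity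
  have h1 : ∀ i, ∀ᶠ n in atTop, ∀ x ∈ U,
      dist (G i x) (Gn n i x) < δ / (∑ i : Fin N, ‖(pj i : E N →L[ℝ] ℝ)‖ + 1) := fun i =>
    Metric.tendstoUniformlyOn_iff.1 (hG i) _ (by positivity)
  filter_upwards [eventually_all.2 h1] with n hn x hx
  rw [dist_eq_norm, ← Finset.sum_sub_distrib]
  simp only [← sub_smul]
  calc _ ≤ ∑ i, ‖(G i x - Gn n i x) • (pj i : E N →L[ℝ] ℝ)‖ := norm_sum_le _ _
    _ ≤ ∑ i, δ / (∑ i : Fin N, ‖(pj i : E N →L[ℝ] ℝ)‖ + 1) * ‖(pj i : E N →L[ℝ] ℝ)‖ := by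
        refine Finset.sum_le_sum fun i _ => ?_
        rw [norm_smul]
        gcongr
        have := hn i x hx
        rw [Real.dist_eq] at this
        exact this.le
    _ = δ * ((∑ i : Fin N, ‖(pj i : E N →L[ℝ] ℝ)‖) /
        (∑ i : Fin N, ‖(pj i : E N →L[ℝ] ℝ)‖ + 1)) := by rw [← Finset.mul_sum]; ring
    _ < δ := by
        refine mul_lt_of_lt_one_right hδ ?_
        rw [div_lt_one hC]; linarith

/-- differentiation under the integral sign -/
lemma D1.integral {Y : Type*} [MeasurableSpace Y] {μ : Measure Y} [IsFiniteMeasure μ]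
    (hU : IsOpen U) {k : Y → E N → ℝ} {g : Y → Fin N → E N → ℝ} {B : ℝ}
    (hk : ∀ x ∈ U, AEStronglyMeasurable (fun y => k y x) μ)
    (hg : ∀ x ∈ U, ∀ i, AEStronglyMeasurable (fun y => g y i x) μ)
    (hkB : ∀ᵐ y ∂μ, ∀ x ∈ U, |k y x| ≤ B) (hgB : ∀ᵐ y ∂μ, ∀ x ∈ U, ∀ i, |g y i x| ≤ B)
    (hd : ∀ᵐ y ∂μ, D1 U (k y) (g y)) :
    D1 U (fun x => ∫ y, k y x ∂μ) (fun i x => ∫ y, g y i x ∂μ) := by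
  intro x hx
  have hintg : ∀ i, Integrable (fun y => g y i x) μ := fun i =>
    Integrable.of_bound (hg x hx i) B (hgB.mono fun y hy => hy x hx i)
  have := hasFDerivAt_integral_of_dominated_of_fderiv_le (𝕜 := ℝ) (μ := μ)
    (F := fun x y => k y x) (F' := fun x y => (∑ i, g y i x • pj i : E N →L[ℝ] ℝ))
    (s := U) (x₀ := x) (bound := fun _ => ∑ i, B * ‖(pj i : E N →L[ℝ] ℝ)‖) (hU.mem_nhds hx)
    (eventually_of_mem (hU.mem_nhds hx) hk)
    (Integrable.of_bound (hk x hx) B (hkB.mono fun y hy => hy x hx))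
    (by
      refine Finset.aestronglyMeasurable_fun_sum _ fun i _ => ?_
      exact (hg x hx i).smul_const _)
    (by
      filter_upwards [hgB] with y hy x hx
      refine (norm_sum_le _ _).trans (Finset.sum_le_sum fun i _ => ?_)
      rw [norm_smul]
      gcongr
      exact hy x hx i)
    (integrable_const _) hd
  rw [integral_finsetSum _ fun i _ => (hintg i).smul_const _] at this
  simp only [integral_smul_const] at this
  exact this

end calc1

/-! ### Part 5b: potentials of powers of quadratics -/

section quad
variable {N : ℕ}

/-- quadratic polynomial in `x` with parameter `y` -/
def qd (A C : E N → ℝ) (y x : E N) : ℝ := A y * ‖x‖ ^ 2 - 2 * inner ℝ x y + C y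

/-- its partial derivatives -/
def qe (A : E N → ℝ) (y : E N) (i : Fin N) (x : E N) : ℝ := 2 * (A y * x i - y i)

variable {A C h : E N → ℝ} {U : Set (E N)} {c R : ℝ} {μ : Measure (E N)}

lemma D1.mul {F F' : E N → ℝ} {G G' : Fin N → E N → ℝ} (h : D1 U F G) (h' : D1 U F' G') :
    D1 U (fun x => F x * F' x) (fun i x => F x * G' i x + F' x * G i x) := by
  intro x hx
  have := (h x hx).mul (h' x hx)
  refine this.congr_fderiv ?_
  rw [Finset.smul_sum, Finset.smul_sum, ← Finset.sum_add_distrib]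
  refine Finset.sum_congr rfl fun i _ => ?_
  rw [add_smul, smul_smul, smul_smul]

lemma D1.mul_const {F : E N → ℝ} {G : Fin N → E N → ℝ} (h : D1 U F G) (c : ℝ) :
    D1 U (fun x => F x * c) (fun i x => G i x * c) := by
  have := h.const_mul c
  simpa only [mul_comm c] using this

lemma D1.rpow {F : E N → ℝ} {G : Fin N → E N → ℝ} (h : D1 U F G) (s : ℝ)
    (hF : ∀ x ∈ U, 0 < F x) :
    D1 U (fun x => F x ^ s) (fun i x => s * F x ^ (s - 1) * G i x) := by
  intro x hx
  have := (h x hx).rpow_const (p := s) (Or.inl (hF x hx).ne')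
  refine this.congr_fderiv ?_
  rw [Finset.smul_sum]
  refine Finset.sum_congr rfl fun i _ => ?_
  rw [smul_smul]

lemma inner_eq_sum (x y : E N) : inner ℝ x y = ∑ i, x i * y i := by
  simp [PiLp.inner_apply, mul_comm]

lemma normsq_eq_sum (x : E N) : ‖x‖ ^ 2 = ∑ i, x i ^ 2 := by
  rw [EuclideanSpace.norm_sq_eq]; simp

lemma D1_qd (A C : E N → ℝ) (y : E N) : D1 U (qd A C y) (qe A y) := by
  intro x _
  have h1 : ∀ i, HasFDerivAt (fun x : E N => x i) (pj i) x := fun i => (pj i).hasFDerivAt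
  have h2 : HasFDerivAt (fun x : E N => ∑ i, (A y * (x i * x i) - 2 * (x i * y i)))
      (∑ i, (A y • (x i • pj i + x i • pj i) - (2 : ℝ) • (y i • pj i)) : E N →L[ℝ] ℝ) x :=
    HasFDerivAt.fun_sum fun i _ => (((h1 i).mul (h1 i)).const_mul (A y)).sub
      (((h1 i).mul_const (y i)).const_mul 2)
  have h3 := h2.add_const (C y)
  have he : qd A C y = fun x => ∑ i, (A y * (x i * x i) - 2 * (x i * y i)) + C y := by
    ext z
    simp only [qd, inner_eq_sum, normsq_eq_sum, Finset.sum_sub_distrib, Finset.mul_sum]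
    simp only [sq]
  rw [he]
  refine h3.congr_fderiv ?_
  refine Finset.sum_congr rfl fun i _ => ?_
  ext z
  simp [qe]
  ring

lemma D1_qe (A : E N → ℝ) (y : E N) (i : Fin N) :
    D1 U (qe A y i) (fun j _ => 2 * A y * (if i = j then 1 else 0)) := by
  intro x _
  have h1 : HasFDerivAt (fun x : E N => x i) (pj i) x := (pj i).hasFDerivAt
  have h2 := ((h1.const_mul (A y)).sub_const (y i)).const_mul 2
  refine h2.congr_fderiv ?_
  ext z
  simp [qe]
  ring

/-- kernel, first and second derivatives -/
def k0 (A C h : E N → ℝ) (s : ℝ) (y x : E N) : ℝ := qd A C y x ^ (-s) * h y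
def k1 (A C h : E N → ℝ) (s : ℝ) (y : E N) (i : Fin N) (x : E N) : ℝ :=
  -s * qd A C y x ^ (-s - 1) * qe A y i x * h y
def k2 (A C h : E N → ℝ) (s : ℝ) (y : E N) (i j : Fin N) (x : E N) : ℝ :=
  (s * (s + 1) * qd A C y x ^ (-s - 2) * qe A y i x * qe A y j x -
    s * qd A C y x ^ (-s - 1) * (2 * A y * (if i = j then 1 else 0))) * h y

lemma D1_k0 (s : ℝ) (y : E N) (hq : ∀ x ∈ U, 0 < qd A C y x) :
    D1 U (k0 A C h s y) (k1 A C h s y) :=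
  ((D1_qd A C y).rpow (-s) hq).mul_const (h y)

lemma D1_k1 (hU : IsOpen U) (s : ℝ) (y : E N) (i : Fin N) (hq : ∀ x ∈ U, 0 < qd A C y x) :
    D1 U (k1 A C h s y i) (k2 A C h s y i) := by
  have := ((((D1_qd A C y).rpow (-s - 1) hq).const_mul (-s)).mul (D1_qe A y i)).mul_const (h y)
  refine this.congr hU (fun x _ => rfl) fun j x _ => ?_
  simp only [k2]
  rw [show -s - 1 - 1 = -s - 2 by ring]
  ring

lemma k2_trace (hN : 4 ≤ N) (y x : E N) (hq : 0 < qd A C y x) :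
    ∑ i, k2 A C h (mm N) y i i x =
      -((N : ℝ) * (N - 2)) * (A y * C y - ‖y‖ ^ 2) * qd A C y x ^ (-mm N - 2) * h y := by
  have h1 : ∑ i, qe A y i x * qe A y i x = 4 * (A y * qd A C y x - (A y * C y - ‖y‖ ^ 2)) := by
    have : ∀ i, qe A y i x * qe A y i x =
        4 * (A y * (A y * x i ^ 2)) - 4 * (A y * (2 * (x i * y i))) + 4 * y i ^ 2 := by
      intro i; unfold qe; ring
    simp only [this, Finset.sum_add_distrib, Finset.sum_sub_distrib, ← Finset.mul_sum]
    rw [← normsq_eq_sum, ← normsq_eq_sum, ← inner_eq_sum]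
    unfold qd
    ring
  have h2 : qd A C y x ^ (-mm N - 1) = qd A C y x ^ (-mm N - 2) * qd A C y x := by
    rw [show -mm N - 1 = (-mm N - 2) + 1 by ring, Real.rpow_add_one hq.ne']
  have h3 : ∑ i : Fin N, k2 A C h (mm N) y i i x =
      (mm N * (mm N + 1) * qd A C y x ^ (-mm N - 2) * ∑ i, qe A y i x * qe A y i x -
       N * (mm N * qd A C y x ^ (-mm N - 1) * (2 * A y))) * h y := by
    simp only [k2, if_true, ← Finset.sum_mul, Finset.sum_sub_distrib, Finset.mul_sum,
      Finset.sum_const, Finset.card_univ, Fintype.card_fin, nsmul_eq_mul, mul_one, mul_assoc]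
  rw [h3, h1, h2]
  unfold mm
  ring

/-- hypotheses for the potential -/
structure QHyp (A C h : E N → ℝ) (μ : Measure (E N)) (U : Set (E N)) (c R : ℝ) : Prop where
  mA : Measurable A
  mC : Measurable C
  mh : Measurable h
  hU : IsOpen U
  hUb : ∀ x ∈ U, ‖x‖ ≤ 1
  hc : 0 < c
  bA : ∀ᵐ y ∂μ, |A y| ≤ 1
  by1 : ∀ᵐ y ∂μ, ‖y‖ ≤ 1
  bh : ∀ y, |h y| ≤ R
  hq : ∀ᵐ y ∂μ, ∀ x ∈ U, c ≤ qd A C y x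

lemma qd_meas (mA : Measurable A) (mC : Measurable C) (x : E N) :
    Measurable fun y => qd A C y x := by
  unfold qd; fun_prop

lemma qe_meas (mA : Measurable A) (i : Fin N) (x : E N) :
    Measurable fun y => qe A y i x := by
  unfold qe; fun_prop

lemma k0_meas (H : QHyp A C h μ U c R) (s : ℝ) (x : E N) :
    Measurable fun y => k0 A C h s y x :=
  ((qd_meas H.mA H.mC x).pow_const _).mul H.mh

lemma k1_meas (H : QHyp A C h μ U c R) (s : ℝ) (i : Fin N) (x : E N) :
    Measurable fun y => k1 A C h s y i x :=
  ((((qd_meas H.mA H.mC x).pow_const _).const_mul _).mul (qe_meas H.mA i x)).mul H.mh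

lemma k2_meas (H : QHyp A C h μ U c R) (s : ℝ) (i j : Fin N) (x : E N) :
    Measurable fun y => k2 A C h s y i j x :=
  ((((((qd_meas H.mA H.mC x).pow_const _).const_mul _).mul (qe_meas H.mA i x)).mul
    (qe_meas H.mA j x)).sub ((((qd_meas H.mA H.mC x).pow_const _).const_mul _).mul
    ((H.mA.const_mul 2).mul_const _))).mul H.mh

lemma qe_le {y x : E N} (hA : |A y| ≤ 1) (hy : ‖y‖ ≤ 1) (hx : ‖x‖ ≤ 1) (i : Fin N) :
    |qe A y i x| ≤ 4 := by
  have h1 : |x i| ≤ 1 := (coord_le_norm x i).trans hx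
  have h2 : |y i| ≤ 1 := (coord_le_norm y i).trans hy
  have h3 : |A y * x i| ≤ 1 := by
    rw [abs_mul]; exact mul_le_one₀ hA (abs_nonneg _) h1
  unfold qe
  rw [abs_mul, abs_two]
  have := abs_sub (A y * x i) (y i)
  linarith

lemma rpow_neg_le_bound {c q s : ℝ} (hc : 0 < c) (hq : c ≤ q) (hs : 0 ≤ s) :
    |q ^ (-s)| ≤ c ^ (-s) := by
  rw [abs_of_nonneg (Real.rpow_nonneg (hc.le.trans hq) _)]
  exact Real.rpow_le_rpow_of_nonpos hc hq (by linarith)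

/-- common bound -/
def kB (c R s : ℝ) : ℝ :=
  c ^ (-s) * R + s * c ^ (-s - 1) * 4 * R +
    (s * (s + 1) * c ^ (-s - 2) * 4 * 4 + s * c ^ (-s - 1) * 2) * R

lemma k_bounds {s : ℝ} (hs : 0 ≤ s) {y x : E N} (hc : 0 < c) (hA : |A y| ≤ 1) (hy : ‖y‖ ≤ 1)
    (hx : ‖x‖ ≤ 1) (hq : c ≤ qd A C y x) (hh : |h y| ≤ R) :
    |k0 A C h s y x| ≤ kB c R s ∧ (∀ i, |k1 A C h s y i x| ≤ kB c R s) ∧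
      ∀ i j, |k2 A C h s y i j x| ≤ kB c R s := by
  have hR : 0 ≤ R := (abs_nonneg _).trans hh
  have b0 := rpow_neg_le_bound hc hq hs
  have b1 : |qd A C y x ^ (-s - 1)| ≤ c ^ (-s - 1) := by
    have := rpow_neg_le_bound (s := s + 1) hc hq (by linarith)
    rwa [show -(s + 1) = -s - 1 by ring] at this
  have b2 : |qd A C y x ^ (-s - 2)| ≤ c ^ (-s - 2) := by
    have := rpow_neg_le_bound (s := s + 2) hc hq (by linarith)
    rwa [show -(s + 2) = -s - 2 by ring] at this
  have p0 : 0 ≤ c ^ (-s) * R := by positivity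
  have p1 : 0 ≤ s * c ^ (-s - 1) * 4 * R := by positivity
  have p2 : 0 ≤ (s * (s + 1) * c ^ (-s - 2) * 4 * 4 + s * c ^ (-s - 1) * 2) * R := by positivity
  refine ⟨?_, fun i => ?_, fun i j => ?_⟩
  · have : |k0 A C h s y x| ≤ c ^ (-s) * R := by
      unfold k0; rw [abs_mul]; gcongr
    unfold kB; linarith
  · have : |k1 A C h s y i x| ≤ s * c ^ (-s - 1) * 4 * R := by
      unfold k1; rw [abs_mul, abs_mul, abs_mul, abs_neg, abs_of_nonneg hs]
      gcongr
      exact qe_le hA hy hx i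
    unfold kB; linarith
  · have : |k2 A C h s y i j x| ≤
        (s * (s + 1) * c ^ (-s - 2) * 4 * 4 + s * c ^ (-s - 1) * 2) * R := by
      unfold k2; rw [abs_mul]
      gcongr
      refine (abs_sub _ _).trans ?_
      rw [abs_mul, abs_mul, abs_mul, abs_of_nonneg (by positivity : 0 ≤ s * (s + 1)), abs_mul,
        abs_mul, abs_of_nonneg hs]
      gcongr
      · exact qe_le hA hy hx i
      · exact qe_le hA hy hx j
      · rw [abs_mul, abs_mul, abs_two]
        have : |(if i = j then (1 : ℝ) else 0)| ≤ 1 := by split_ifs <;> simp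
        calc 2 * |A y| * |(if i = j then (1 : ℝ) else 0)| ≤ 2 * 1 * 1 := by gcongr
          _ = 2 := by norm_num
    unfold kB; linarith

lemma QHyp.bounds (H : QHyp A C h μ U c R) {s : ℝ} (hs : 0 ≤ s) :
    ∀ᵐ y ∂μ, ∀ x ∈ U, |k0 A C h s y x| ≤ kB c R s ∧ (∀ i, |k1 A C h s y i x| ≤ kB c R s) ∧
      ∀ i j, |k2 A C h s y i j x| ≤ kB c R s := by
  filter_upwards [H.bA, H.by1, H.hq] with y h1 h2 h3 x hx
  exact k_bounds hs H.hc h1 h2 (H.hUb x hx) (h3 x hx) (H.bh y)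

variable [IsFiniteMeasure μ]

lemma QHyp.d1 (H : QHyp A C h μ U c R) {s : ℝ} (hs : 0 ≤ s) :
    D1 U (fun x => ∫ y, k0 A C h s y x ∂μ) (fun i x => ∫ y, k1 A C h s y i x ∂μ) := by
  refine D1.integral (B := kB c R s) H.hU (fun x _ => (k0_meas H s x).aestronglyMeasurable)
    (fun x _ i => (k1_meas H s i x).aestronglyMeasurable)
    ((H.bounds hs).mono fun y hy x hx => (hy x hx).1)
    ((H.bounds hs).mono fun y hy x hx => (hy x hx).2.1) ?_
  filter_upwards [H.hq] with y hy
  exact D1_k0 s y fun x hx => H.hc.trans_le (hy x hx)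

lemma QHyp.d2 (H : QHyp A C h μ U c R) {s : ℝ} (hs : 0 ≤ s) (i : Fin N) :
    D1 U (fun x => ∫ y, k1 A C h s y i x ∂μ) (fun j x => ∫ y, k2 A C h s y i j x ∂μ) := by
  refine D1.integral (B := kB c R s) H.hU (fun x _ => (k1_meas H s i x).aestronglyMeasurable)
    (fun x _ j => (k2_meas H s i j x).aestronglyMeasurable)
    ((H.bounds hs).mono fun y hy x hx => (hy x hx).2.1 i)
    ((H.bounds hs).mono fun y hy x hx => (hy x hx).2.2 i) ?_
  filter_upwards [H.hq] with y hy
  exact D1_k1 H.hU s y i fun x hx => H.hc.trans_le (hy x hx)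

lemma QHyp.cont (H : QHyp A C h μ U c R) {s : ℝ} (hs : 0 ≤ s) (i j : Fin N) :
    ContinuousOn (fun x => ∫ y, k2 A C h s y i j x ∂μ) U := by
  refine continuousOn_of_dominated (bound := fun _ => kB c R s)
    (fun x _ => (k2_meas H s i j x).aestronglyMeasurable) ?_ (integrable_const _) ?_
  · intro x hx
    exact (H.bounds hs).mono fun y hy => (hy x hx).2.2 i j
  · filter_upwards [H.hq] with y hy
    have hp : ∀ x ∈ U, qd A C y x ≠ 0 := fun x hx => (H.hc.trans_le (hy x hx)).ne'
    have c1 : ContinuousOn (qd A C y) U := (D1_qd A C y).continuousOn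
    have c2 : ∀ i, ContinuousOn (qe A y i) U := fun i => (D1_qe A y i).continuousOn
    unfold k2
    exact ((((continuousOn_const.mul (c1.rpow_const fun x hx => Or.inl (hp x hx))).mul
      (c2 i)).mul (c2 j)).sub ((continuousOn_const.mul
      (c1.rpow_const fun x hx => Or.inl (hp x hx))).mul continuousOn_const)).mul continuousOn_const

lemma QHyp.trace (hN : 4 ≤ N) (H : QHyp A C h μ U c R) {x : E N} (hx : x ∈ U) :
    ∑ i, ∫ y, k2 A C h (mm N) y i i x ∂μ =
      ∫ y, -((N : ℝ) * (N - 2)) * (A y * C y - ‖y‖ ^ 2) * qd A C y x ^ (-mm N - 2) * h y ∂μ := by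
  have hm := mm_pos hN
  rw [← integral_finsetSum]
  · refine integral_congr_ae ?_
    filter_upwards [H.hq] with y hy
    exact k2_trace hN y x (H.hc.trans_le (hy x hx))
  · intro i _
    exact Integrable.of_bound (k2_meas H _ i i x).aestronglyMeasurable (kB c R (mm N))
      ((H.bounds (by linarith)).mono fun y hy => (hy x hx).2.2 i i)

end quad

/-! ### Part 5c: Newton potentials -/

section newton
variable {N : ℕ}

lemma riesz (hN : 4 ≤ N) {s : ℝ} (hs : s < N) : ∃ I : ℝ, 0 ≤ I ∧ ∀ x : E N, ‖x‖ ≤ 1 →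
    Integrable (fun y => ‖x - y‖ ^ (-s)) (μB N) ∧ ∫ y, ‖x - y‖ ^ (-s) ∂(μB N) ≤ I := by
  have : Nonempty (Fin N) := ⟨⟨0, by omega⟩⟩
  have h1 : IntegrableOn (fun z : E N => ‖z‖ ^ (-s)) (ball (0 : E N) 2) volume := by
    rw [integrableOn_fun_norm_addHaar (μ := volume) (f := fun t : ℝ => t ^ (-s))]
    have h2 : IntegrableOn (fun t : ℝ => t ^ ((N : ℝ) - 1 - s)) (Ioo 0 2) volume := by
      have := intervalIntegral.intervalIntegrable_rpow' (a := 0) (b := 2)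
        (r := (N : ℝ) - 1 - s) (by linarith)
      rw [intervalIntegrable_iff_integrableOn_Ioo_of_le (by norm_num)] at this
      exact this
    refine h2.congr_fun (fun t ht => ?_) measurableSet_Ioo
    have ht0 : 0 < t := ht.1
    simp only [finrank_euclideanSpace, Fintype.card_fin, smul_eq_mul]
    rw [← Real.rpow_natCast, ← Real.rpow_add ht0]
    congr 1
    push_cast [Nat.cast_sub (by omega : 1 ≤ N)]
    ring
  set φ : E N → ℝ := (ball (0 : E N) 2).indicator fun z => ‖z‖ ^ (-s) with hφ
  have h3 : Integrable φ volume := (integrable_indicator_iff measurableSet_ball).2 h1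
  have hφ0 : ∀ z, 0 ≤ φ z := fun z => indicator_nonneg (fun z _ => by positivity) z
  refine ⟨∫ z, φ z, integral_nonneg hφ0, fun x hx => ?_⟩
  have h4 : Integrable (fun y => φ (x - y)) volume := h3.comp_sub_left x
  have h5 : (fun y => ‖x - y‖ ^ (-s)) =ᵐ[μB N] fun y => φ (x - y) := by
    filter_upwards [ae_ball] with y hy
    have : x - y ∈ ball (0 : E N) 2 := by
      rw [mem_ball_zero_iff]
      have := norm_sub_le x y
      linarith
    simp [hφ, indicator_of_mem this]
  have h6 : Integrable (fun y => φ (x - y)) (μB N) := h4.integrableOn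
  refine ⟨h6.congr h5.symm, ?_⟩
  rw [integral_congr_ae h5]
  calc ∫ y, φ (x - y) ∂(μB N) ≤ ∫ y, φ (x - y) :=
        setIntegral_le_integral h4 (Eventually.of_forall fun y => hφ0 _)
    _ = ∫ z, φ z := integral_sub_left_eq_self φ volume x

lemma ae_ne (hN : 4 ≤ N) (x : E N) : ∀ᵐ y ∂(μB N), x ≠ y := by
  have : Nonempty (Fin N) := ⟨⟨0, by omega⟩⟩
  have h : ∀ᵐ y ∂(volume : Measure (E N)), x ≠ y := by
    rw [ae_iff]; simp
  exact ae_restrict_of_ae h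

lemma epsj_rpow_tendsto {θ : ℝ} (hθ : 0 < θ) : Tendsto (fun n => epsj n ^ θ) atTop (𝓝 0) := by
  have h := epsj_tendsto
  have := h.rpow_const (p := θ) (Or.inr hθ.le)
  rwa [Real.zero_rpow hθ.ne'] at this

lemma unif_of_bound (hN : 4 ≤ N) {U : Set (E N)} (hU : ∀ x ∈ U, ‖x‖ ≤ 1)
    {Kn : ℕ → E N → E N → ℝ} {K : E N → E N → ℝ} {s θ D : ℝ} (hs : s < N) (hθ : 0 < θ)
    (hD : 0 ≤ D) (hKn : ∀ n, ∀ x ∈ U, Integrable (fun y => Kn n y x) (μB N))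
    (hK : ∀ x ∈ U, Integrable (fun y => K y x) (μB N))
    (hb : ∀ n, ∀ x ∈ U, ∀ᵐ y ∂(μB N),
      |K y x - Kn n y x| ≤ D * epsj n ^ θ * ‖x - y‖ ^ (-s)) :
    TendstoUniformlyOn (fun n x => ∫ y, Kn n y x ∂(μB N)) (fun x => ∫ y, K y x ∂(μB N)) atTop U := by
  obtain ⟨I, hI, h⟩ := riesz hN hs
  rw [Metric.tendstoUniformlyOn_iff]
  intro δ hδ
  have ht : Tendsto (fun n => D * epsj n ^ θ * I) atTop (𝓝 0) := by
    have := ((epsj_rpow_tendsto hθ).const_mul D).mul_const I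
    simpa using this
  filter_upwards [ht.eventually_lt_const hδ] with n hn x hx
  rw [Real.dist_eq, ← integral_sub (hK x hx) (hKn n x hx)]
  refine lt_of_le_of_lt ?_ hn
  calc |∫ y, (K y x - Kn n y x) ∂(μB N)| ≤ ∫ y, |K y x - Kn n y x| ∂(μB N) :=
        abs_integral_le_integral_abs
    _ ≤ ∫ y, D * epsj n ^ θ * ‖x - y‖ ^ (-s) ∂(μB N) :=
        integral_mono_ae ((hK x hx).sub (hKn n x hx)).abs ((h x (hU x hx)).1.const_mul _)
          (hb n x hx)
    _ = D * epsj n ^ θ * ∫ y, ‖x - y‖ ^ (-s) ∂(μB N) := integral_const_mul _ _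
    _ ≤ D * epsj n ^ θ * I := by
        have := (h x (hU x hx)).2
        have h0 : 0 ≤ epsj n ^ θ := Real.rpow_nonneg (epsj_pos n).le _
        gcongr

/-- data of the regularized Newton kernel -/
def a1 : E N → ℝ := fun _ => 1
def c1 (ε : ℝ) : E N → ℝ := fun y => ‖y‖ ^ 2 + ε

lemma qd_newton (ε : ℝ) (y x : E N) : qd a1 (c1 ε) y x = ‖x - y‖ ^ 2 + ε := by
  rw [@norm_sub_sq ℝ]; simp [qd, a1, c1]; ring

lemma qe_newton (y x : E N) (i : Fin N) : qe a1 y i x = 2 * (x - y) i := by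
  simp [qe, a1]

lemma qhyp_newton {ε R : ℝ} (hε : 0 < ε) {f : E N → ℝ} (hf : Measurable f)
    (hR : ∀ y, |f y| ≤ R) : QHyp a1 (c1 ε) f (μB N) (ball 0 1) ε R where
  mA := measurable_const
  mC := by unfold c1; fun_prop
  mh := hf
  hU := isOpen_ball
  hUb x hx := (mem_ball_zero_iff.1 hx).le
  hc := hε
  bA := Eventually.of_forall fun y => by simp [a1]
  by1 := ae_ball.mono fun y hy => hy.le
  bh := hR
  hq := Eventually.of_forall fun y x _ => by rw [qd_newton]; nlinarith [sq_nonneg ‖x - y‖]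

def JJ (ε : ℝ) (f : E N → ℝ) (x : E N) : ℝ := ∫ y, k0 a1 (c1 ε) f (mm N) y x ∂(μB N)
def JG (ε : ℝ) (f : E N → ℝ) (i : Fin N) (x : E N) : ℝ :=
  ∫ y, k1 a1 (c1 ε) f (mm N) y i x ∂(μB N)

lemma JJ_d1 (hN : 4 ≤ N) {ε R : ℝ} (hε : 0 < ε) {f : E N → ℝ} (hf : Measurable f)
    (hR : ∀ y, |f y| ≤ R) : D1 (ball 0 1) (JJ ε f) (JG ε f) :=
  (qhyp_newton hε hf hR).d1 (by have := mm_pos hN; linarith)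

lemma norm_rpow_sq {x y : E N} (s : ℝ) : (‖x - y‖ ^ 2) ^ s = ‖x - y‖ ^ (2 * s) := by
  rw [← Real.rpow_natCast, ← Real.rpow_mul (norm_nonneg _)]; norm_num

lemma k0_int (hN : 4 ≤ N) {R : ℝ} {f : E N → ℝ} (hf : Measurable f)
    (hR : ∀ y, |f y| ≤ R) {x : E N} (hx : ‖x‖ ≤ 1) :
    Integrable (fun y => k0 a1 (c1 0) f (mm N) y x) (μB N) := by
  obtain ⟨I, hI, h⟩ := riesz hN (s := (N : ℝ) - 2) (by linarith)
  refine ((h x hx).1.mul_const R).mono'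
    (k0_meas (qhyp_newton one_pos hf hR |> fun H =>
      { H with mC := by unfold c1; fun_prop, hc := one_pos, hU := isOpen_empty, hUb := by simp,
               hq := by simp } : QHyp a1 (c1 0) f (μB N) ∅ 1 R) _ x).aestronglyMeasurable ?_
  refine Eventually.of_forall fun y => ?_
  rw [Real.norm_eq_abs, k0, qd_newton, add_zero, norm_rpow_sq, abs_mul,
    abs_of_nonneg (by positivity)]
  rw [show 2 * -mm N = -((N : ℝ) - 2) by unfold mm; ring]
  gcongr
  exact hR y

lemma k1_int (hN : 4 ≤ N) {R : ℝ} {f : E N → ℝ} (hf : Measurable f)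
    (hR : ∀ y, |f y| ≤ R) {x : E N} (hx : ‖x‖ ≤ 1) (i : Fin N) :
    Integrable (fun y => k1 a1 (c1 0) f (mm N) y i x) (μB N) := by
  obtain ⟨I, hI, h⟩ := riesz hN (s := (N : ℝ) - 1) (by linarith)
  have hm := mm_pos hN
  refine (((h x hx).1.const_mul (mm N * 2)).mul_const R).mono'
    (k1_meas (qhyp_newton one_pos hf hR |> fun H =>
      { H with mC := by unfold c1; fun_prop, hc := one_pos, hU := isOpen_empty, hUb := by simp,
               hq := by simp } : QHyp a1 (c1 0) f (μB N) ∅ 1 R) _ i x).aestronglyMeasurable ?_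
  filter_upwards [ae_ne hN x] with y hy
  have hd : 0 < ‖x - y‖ := norm_pos_iff.2 (sub_ne_zero.2 hy)
  have hc := coord_le_norm (x - y) i
  rw [Real.norm_eq_abs, k1, qd_newton, qe_newton, add_zero, norm_rpow_sq, abs_mul, abs_mul, abs_mul,
    abs_neg, abs_of_nonneg (by linarith : 0 ≤ mm N), abs_mul, abs_two,
    abs_of_nonneg (by positivity : 0 ≤ ‖x - y‖ ^ (2 * (-mm N - 1)))]
  have e : ‖x - y‖ ^ (-((N : ℝ) - 1)) = ‖x - y‖ ^ (2 * (-mm N - 1)) * ‖x - y‖ := by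
    rw [← Real.rpow_add_one hd.ne']
    congr 1; unfold mm; ring
  rw [e]
  calc mm N * ‖x - y‖ ^ (2 * (-mm N - 1)) * (2 * |(x - y) i|) * |f y|
      ≤ mm N * ‖x - y‖ ^ (2 * (-mm N - 1)) * (2 * ‖x - y‖) * R := by
        gcongr
        exact hR y
    _ = _ := by ring

lemma JJ_unif (hN : 4 ≤ N) {R : ℝ} {f : E N → ℝ} (hf : Measurable f)
    (hR : ∀ y, |f y| ≤ R) :
    TendstoUniformlyOn (fun n => JJ (epsj n) f) (JJ 0 f) atTop (ball 0 1) := by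
  have hm := mm_pos hN
  have hR0 : 0 ≤ R := (abs_nonneg _).trans (hR 0)
  refine unif_of_bound hN (s := (N : ℝ) - 2 + 2 * (1 / 4)) (θ := 1 / 4) (D := mm N * R)
    (fun x hx => (mem_ball_zero_iff.1 hx).le) (by linarith) (by norm_num) (by positivity)
    (fun n x hx => ?_) (fun x hx => k0_int hN hf hR (mem_ball_zero_iff.1 hx).le) ?_
  · have H := qhyp_newton (N := N) (epsj_pos n) hf hR
    exact Integrable.of_bound (k0_meas H _ x).aestronglyMeasurable (kB (epsj n) R (mm N))
      ((H.bounds (by linarith)).mono fun y hy => (hy x hx).1)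
  · intro n x hx
    filter_upwards [ae_ne hN x] with y hy
    have hd : 0 < ‖x - y‖ := norm_pos_iff.2 (sub_ne_zero.2 hy)
    have h1 := rpow_diff_le (m := mm N) (s := ‖x - y‖ ^ 2) (h := epsj n) (θ := 1 / 4) hm
      (by positivity) (epsj_pos n) (by norm_num) (by norm_num)
    have h2 : (‖x - y‖ ^ 2 + epsj n) ^ (-mm N) ≤ (‖x - y‖ ^ 2) ^ (-mm N) :=
      Real.rpow_le_rpow_of_nonpos (by positivity) (by linarith [epsj_pos n]) (by linarith)
    rw [k0, k0, qd_newton, qd_newton, add_zero, ← sub_mul, abs_mul, abs_of_nonneg (by linarith)]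
    rw [norm_rpow_sq (-mm N - 1 / 4),
      show 2 * (-mm N - 1 / 4) = -((N : ℝ) - 2 + 2 * (1 / 4)) by unfold mm; ring] at h1
    calc _ ≤ (mm N * epsj n ^ (1 / 4 : ℝ) * ‖x - y‖ ^ (-((N : ℝ) - 2 + 2 * (1 / 4)))) * R :=
          mul_le_mul h1 (hR y) (abs_nonneg _) ((sub_nonneg.2 h2).trans h1)
      _ = _ := by ring

lemma JG_unif (hN : 4 ≤ N) {R : ℝ} {f : E N → ℝ} (hf : Measurable f)
    (hR : ∀ y, |f y| ≤ R) (i : Fin N) :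
    TendstoUniformlyOn (fun n => JG (epsj n) f i) (JG 0 f i) atTop (ball 0 1) := by
  have hm := mm_pos hN
  have hR0 : 0 ≤ R := (abs_nonneg _).trans (hR 0)
  refine unif_of_bound hN (s := (N : ℝ) - 1 + 2 * (1 / 4)) (θ := 1 / 4)
    (D := mm N * (mm N + 1) * 2 * R)
    (fun x hx => (mem_ball_zero_iff.1 hx).le) (by linarith) (by norm_num) (by positivity)
    (fun n x hx => ?_) (fun x hx => k1_int hN hf hR (mem_ball_zero_iff.1 hx).le i) ?_
  · have H := qhyp_newton (N := N) (epsj_pos n) hf hR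
    exact Integrable.of_bound (k1_meas H _ i x).aestronglyMeasurable (kB (epsj n) R (mm N))
      ((H.bounds (by linarith)).mono fun y hy => (hy x hx).2.1 i)
  · intro n x hx
    filter_upwards [ae_ne hN x] with y hy
    have hd : 0 < ‖x - y‖ := norm_pos_iff.2 (sub_ne_zero.2 hy)
    have h1 := rpow_diff_le (m := mm N + 1) (s := ‖x - y‖ ^ 2) (h := epsj n) (θ := 1 / 4)
      (by linarith) (by positivity) (epsj_pos n) (by norm_num) (by norm_num)
    have h2 : (‖x - y‖ ^ 2 + epsj n) ^ (-(mm N + 1)) ≤ (‖x - y‖ ^ 2) ^ (-(mm N + 1)) :=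
      Real.rpow_le_rpow_of_nonpos (by positivity) (by linarith [epsj_pos n]) (by linarith)
    rw [k1, k1, qd_newton, qd_newton, add_zero, qe_newton, show -mm N - 1 = -(mm N + 1) by ring]
    have e0 : -mm N * (‖x - y‖ ^ 2) ^ (-(mm N + 1)) * (2 * (x - y) i) * f y -
        -mm N * (‖x - y‖ ^ 2 + epsj n) ^ (-(mm N + 1)) * (2 * (x - y) i) * f y =
        -(mm N) * ((‖x - y‖ ^ 2) ^ (-(mm N + 1)) - (‖x - y‖ ^ 2 + epsj n) ^ (-(mm N + 1))) *
          (2 * (x - y) i) * f y := by ring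
    rw [e0, abs_mul, abs_mul, abs_mul, abs_neg, abs_of_nonneg (by linarith : 0 ≤ mm N),
      abs_of_nonneg (sub_nonneg.2 h2), abs_mul, abs_two]
    rw [norm_rpow_sq (-(mm N + 1) - 1 / 4)] at h1
    have e : ‖x - y‖ ^ (-((N : ℝ) - 1 + 2 * (1 / 4))) =
        ‖x - y‖ ^ (2 * (-(mm N + 1) - 1 / 4)) * ‖x - y‖ := by
      rw [← Real.rpow_add_one hd.ne']
      congr 1; unfold mm; ring
    rw [e]
    have hc := coord_le_norm (x - y) i
    have h3 := sub_nonneg.2 h2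
    have h4 : 0 ≤ epsj n ^ (1 / 4 : ℝ) := Real.rpow_nonneg (epsj_pos n).le _
    calc _ ≤ mm N * ((mm N + 1) * epsj n ^ (1 / 4 : ℝ) * ‖x - y‖ ^ (2 * (-(mm N + 1) - 1 / 4))) *
          (2 * ‖x - y‖) * R := by
          gcongr
          exact hR y
      _ = _ := by ring

/-- the Newton potential of a bounded function is continuously differentiable -/
lemma JJ0_d1 (hN : 4 ≤ N) {R : ℝ} {f : E N → ℝ} (hf : Measurable f)
    (hR : ∀ y, |f y| ≤ R) : D1 (ball 0 1) (JJ 0 f) (JG 0 f) :=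
  D1.of_limit isOpen_ball (fun n => JJ_d1 hN (epsj_pos n) hf hR)
    (fun x hx => (JJ_unif hN hf hR).tendsto_at hx) (fun i => JG_unif hN hf hR i)

lemma JG0_cont (hN : 4 ≤ N) {R : ℝ} {f : E N → ℝ} (hf : Measurable f)
    (hR : ∀ y, |f y| ≤ R) (i : Fin N) : ContinuousOn (JG 0 f i) (ball 0 1) := by
  have hm := mm_pos hN
  refine (JG_unif hN hf hR i).continuousOn (Frequently.of_forall fun n => ?_)
  exact ((qhyp_newton (epsj_pos n) hf hR).d2 (by linarith) i).continuousOn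

end newton

/-! ### Part 5d: second derivatives of Newton potentials -/

section newton2
variable {N : ℕ}

/-- partial derivative -/
def dg (g : E N → ℝ) (i : Fin N) (y : E N) : ℝ := fderiv ℝ g y (EuclideanSpace.single i 1)

lemma JJ_eq_conv {ε : ℝ} {g : E N → ℝ} (h0 : ∀ y, y ∉ ball (0 : E N) 1 → g y = 0) (x : E N) :
    JJ ε g x = convolution (fun z : E N => (‖z‖ ^ 2 + ε) ^ (-mm N)) g
      (ContinuousLinearMap.lsmul ℝ ℝ) volume x := by
  rw [convolution_lsmul_swap]
  unfold JJ μB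
  rw [setIntegral_eq_integral_of_forall_compl_eq_zero]
  · simp only [k0, qd_newton, smul_eq_mul]
  · intro y hy
    simp [k0, h0 y hy]

structure GHyp (g : E N → ℝ) : Prop where
  c1 : ContDiff ℝ 1 g
  cs : HasCompactSupport g
  ts : tsupport g ⊆ ball 0 1

lemma GHyp.zero {g : E N → ℝ} (H : GHyp g) (y : E N) (hy : y ∉ ball (0 : E N) 1) : g y = 0 :=
  image_eq_zero_of_notMem_tsupport fun h => hy (H.ts h)

lemma GHyp.dzero {g : E N → ℝ} (H : GHyp g) (i : Fin N) (y : E N) (hy : y ∉ ball (0 : E N) 1) :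
    dg g i y = 0 := by
  have : fderiv ℝ g y = 0 := by
    have h : y ∉ tsupport (fderiv ℝ g) := fun h => hy (H.ts (tsupport_fderiv_subset ℝ h))
    exact image_eq_zero_of_notMem_tsupport h
  simp [dg, this]

lemma GHyp.dcont {g : E N → ℝ} (H : GHyp g) (i : Fin N) : Continuous (dg g i) :=
  (H.c1.continuous_fderiv one_ne_zero).clm_apply continuous_const

lemma GHyp.bound {g : E N → ℝ} (H : GHyp g) :
    ∃ R, (∀ y, |g y| ≤ R) ∧ ∀ i y, |dg g i y| ≤ R := by
  obtain ⟨R1, h1⟩ := H.cs.exists_bound_of_continuous H.c1.continuous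
  have h2 : ∀ i : Fin N, ∃ R, ∀ y, |dg g i y| ≤ R := by
    intro i
    have hc : HasCompactSupport (dg g i) := by
      have := H.cs.fderiv (𝕜 := ℝ)
      exact this.comp_left (g := fun L : E N →L[ℝ] ℝ => L (EuclideanSpace.single i 1)) (by simp)
    exact hc.exists_bound_of_continuous (H.dcont i)
  choose R2 h2 using h2
  refine ⟨|R1| + ∑ i, |R2 i|, fun y => ?_, fun i y => ?_⟩
  · have : 0 ≤ ∑ i, |R2 i| := Finset.sum_nonneg fun i _ => abs_nonneg _
    have := (h1 y).trans (le_abs_self R1)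
    rw [Real.norm_eq_abs] at this
    linarith
  · have h3 : |R2 i| ≤ ∑ i, |R2 i| :=
      Finset.single_le_sum (f := fun i => |R2 i|) (fun i _ => abs_nonneg _) (Finset.mem_univ i)
    have := (h2 i y).trans (le_abs_self _)
    have := abs_nonneg R1
    linarith

/-- derivative falling on the density -/
lemma GHyp.conv_d1 {g : E N → ℝ} (H : GHyp g) {ε : ℝ} (hε : 0 < ε) (U : Set (E N)) :
    D1 U (JJ ε g) (fun i => JJ ε (dg g i)) := by
  intro x _
  have hc : Continuous fun z : E N => (‖z‖ ^ 2 + ε) ^ (-mm N) :=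
    Continuous.rpow_const (by fun_prop) fun z => Or.inl (by positivity)
  have h := H.cs.hasFDerivAt_convolution_right (ContinuousLinearMap.lsmul ℝ ℝ)
    (μ := volume) hc.locallyIntegrable H.c1 x
  have e1 : JJ ε g = convolution (fun z : E N => (‖z‖ ^ 2 + ε) ^ (-mm N)) g
      (ContinuousLinearMap.lsmul ℝ ℝ) volume := funext fun x => JJ_eq_conv H.zero x
  rw [e1]
  refine h.congr_fderiv ?_
  rw [clm_eq_sum (convolution _ _ _ _ x)]
  refine Finset.sum_congr rfl fun i _ => ?_
  congr 1
  rw [convolution_precompR_apply _ hc.locallyIntegrable (H.cs.fderiv ℝ)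
    (H.c1.continuous_fderiv one_ne_zero)]
  exact (JJ_eq_conv (H.dzero i) x).symm

lemma GHyp.JG_eq (hN : 4 ≤ N) {g : E N → ℝ} (H : GHyp g) {ε : ℝ} (hε : 0 < ε) (i : Fin N)
    {x : E N} (hx : x ∈ ball (0 : E N) 1) : JG ε g i x = JJ ε (dg g i) x := by
  obtain ⟨R, hR, hR'⟩ := H.bound
  rw [← (JJ_d1 hN hε H.c1.continuous.measurable hR).fderiv_single hx i,
    (H.conv_d1 hε (ball 0 1)).fderiv_single hx i]

lemma GHyp.JG0_eq (hN : 4 ≤ N) {g : E N → ℝ} (H : GHyp g) (i : Fin N)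
    {x : E N} (hx : x ∈ ball (0 : E N) 1) : JG 0 g i x = JJ 0 (dg g i) x := by
  obtain ⟨R, hR, hR'⟩ := H.bound
  have h1 := (JG_unif hN H.c1.continuous.measurable hR i).tendsto_at hx
  have h2 := (JJ_unif hN (H.dcont i).measurable (hR' i)).tendsto_at hx
  refine tendsto_nhds_unique h1 (h2.congr fun n => ?_)
  rw [H.JG_eq hN (epsj_pos n) i hx]

lemma GHyp.d2 (hN : 4 ≤ N) {g : E N → ℝ} (H : GHyp g) (i : Fin N) :
    D1 (ball 0 1) (JG 0 g i) (fun j => JG 0 (dg g i) j) := by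
  obtain ⟨R, hR, hR'⟩ := H.bound
  exact (JJ0_d1 hN (H.dcont i).measurable (hR' i)).congr isOpen_ball
    (fun x hx => H.JG0_eq hN i hx) fun _ _ _ => rfl

/-- the profile of the approximate identity -/
def pk (z : E N) : ℝ := (N : ℝ) * (N - 2) * (1 + ‖z‖ ^ 2) ^ (-mm N - 2)

lemma pk_int (hN : 4 ≤ N) : Integrable (pk (N := N)) volume := by
  have := integrable_rpow_neg_one_add_norm_sq (E := E N) (μ := volume) (r := N + 2)
    (by simp)
  have h2 := this.const_mul ((N : ℝ) * (N - 2))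
  refine h2.congr (Eventually.of_forall fun z => ?_)
  simp only [pk]
  congr 2
  unfold mm; ring

/-- the constant of the Newton kernel -/
def kap (N : ℕ) : ℝ := ∫ z : E N, pk z

lemma N_cast (hN : 4 ≤ N) : (4 : ℝ) ≤ N := by exact_mod_cast hN

lemma pk_pos (hN : 4 ≤ N) (z : E N) : 0 < pk z := by
  have := N_cast hN
  unfold pk
  have : 0 < (N : ℝ) - 2 := by linarith
  positivity

lemma kap_pos (hN : 4 ≤ N) : 0 < kap N := by
  unfold kap
  rw [integral_pos_iff_support_of_nonneg (fun z => (pk_pos hN z).le) (pk_int hN)]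
  have : Function.support (pk (N := N)) = univ := by
    ext z; simp [(pk_pos hN z).ne']
  rw [this]
  exact Measure.measure_univ_pos.2 (NeZero.ne _)

lemma pk_decay (hN : 4 ≤ N) :
    Tendsto (fun z : E N => ‖z‖ ^ N * (pk z / kap N)) (Bornology.cobounded (E N)) (𝓝 0) := by
  have hk := kap_pos hN
  have hc : Tendsto (fun z : E N => ((N : ℝ) * (N - 2) / kap N) * ‖z‖ ^ (-2 : ℝ))
      (Bornology.cobounded (E N)) (𝓝 0) := by
    have h1 := (tendsto_rpow_neg_atTop (y := 2) two_pos).comp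
      (tendsto_norm_cobounded_atTop (E := E N))
    have := h1.const_mul ((N : ℝ) * (N - 2) / kap N)
    simpa using this
  refine squeeze_zero' (Eventually.of_forall fun z => ?_) ?_ hc
  · have := pk_pos hN z; positivity
  · have hev : ∀ᶠ z : E N in Bornology.cobounded (E N), 0 < ‖z‖ :=
      (tendsto_norm_cobounded_atTop (E := E N)).eventually_gt_atTop 0
    filter_upwards [hev] with z hz
    have hN' := N_cast hN
    have hm := mm_pos hN
    have h1 : (1 + ‖z‖ ^ 2) ^ (-mm N - 2) ≤ (‖z‖ ^ 2) ^ (-mm N - 2) :=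
      Real.rpow_le_rpow_of_nonpos (by positivity) (by linarith) (by linarith)
    have h2 : ‖z‖ ^ N * (‖z‖ ^ 2) ^ (-mm N - 2) = ‖z‖ ^ (-2 : ℝ) := by
      rw [← Real.rpow_natCast, ← Real.rpow_natCast, ← Real.rpow_mul hz.le, ← Real.rpow_add hz]
      congr 1; unfold mm; push_cast; ring
    have h3 : 0 ≤ (N : ℝ) * (N - 2) / kap N := by
      have : 0 ≤ (N : ℝ) - 2 := by linarith
      positivity
    calc ‖z‖ ^ N * (pk z / kap N)
        = ((N : ℝ) * (N - 2) / kap N) * (‖z‖ ^ N * (1 + ‖z‖ ^ 2) ^ (-mm N - 2)) := by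
          unfold pk; ring
      _ ≤ ((N : ℝ) * (N - 2) / kap N) * (‖z‖ ^ N * (‖z‖ ^ 2) ^ (-mm N - 2)) := by gcongr
      _ = _ := by rw [h2]

lemma GHyp.trace_eps (hN : 4 ≤ N) {g : E N → ℝ} (H : GHyp g) {ε : ℝ} (hε : 0 < ε)
    {x : E N} (hx : x ∈ ball (0 : E N) 1) :
    ∑ i, JG ε (dg g i) i x = - kap N *
      ∫ y, ((ε ^ (-1 / 2 : ℝ)) ^ N * (pk (ε ^ (-1 / 2 : ℝ) • (x - y)) / kap N)) • g y := by
  obtain ⟨R, hR, hR'⟩ := H.bound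
  have hk := kap_pos hN
  have hm := mm_pos hN
  have Q := qhyp_newton (N := N) hε H.c1.continuous.measurable hR
  have h1 : ∀ i, JG ε (dg g i) i x = ∫ y, k2 a1 (_root_.c1 ε) g (mm N) y i i x ∂(μB N) := by
    intro i
    rw [← (JJ_d1 hN hε (H.dcont i).measurable (hR' i)).fderiv_single hx i]
    have h2 : D1 (ball 0 1) (JJ ε (dg g i)) (fun j x => ∫ y, k2 a1 (_root_.c1 ε) g (mm N) y i j x ∂(μB N)) :=
      (Q.d2 (by linarith) i).congr isOpen_ball
        (fun x hx => (H.JG_eq hN hε i hx).symm) fun _ _ _ => rfl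
    exact h2.fderiv_single hx i
  simp only [h1]
  rw [Q.trace hN hx]
  unfold μB
  rw [setIntegral_eq_integral_of_forall_compl_eq_zero (fun y hy => by simp [H.zero y hy]),
    ← integral_const_mul]
  refine integral_congr_ae (Eventually.of_forall fun y => ?_)
  simp only [qd_newton, smul_eq_mul]
  have e1 : ‖ε ^ (-1 / 2 : ℝ) • (x - y)‖ ^ 2 = ε⁻¹ * ‖x - y‖ ^ 2 := by
    rw [norm_smul, mul_pow, Real.norm_eq_abs, sq_abs, ← Real.rpow_natCast, ← Real.rpow_mul hε.le]
    rw [show (-1 / 2 : ℝ) * ((2 : ℕ) : ℝ) = -1 by norm_num, Real.rpow_neg_one]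
  have e2 : 1 + ε⁻¹ * ‖x - y‖ ^ 2 = ε⁻¹ * (‖x - y‖ ^ 2 + ε) := by field_simp; ring
  unfold pk
  rw [e1, e2, Real.mul_rpow (by positivity) (by positivity), Real.inv_rpow hε.le,
    ← Real.rpow_neg hε.le]
  have e3 : (ε ^ (-1 / 2 : ℝ)) ^ N * ε ^ (-(-mm N - 2)) = ε := by
    rw [← Real.rpow_natCast, ← Real.rpow_mul hε.le, ← Real.rpow_add hε]
    conv_rhs => rw [← Real.rpow_one ε]
    congr 1; unfold mm; ring
  have e4 : a1 y * _root_.c1 ε y - ‖y‖ ^ 2 = ε := by simp [a1, _root_.c1]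
  rw [e4]
  have e5 : -kap N * ((ε ^ (-1 / 2 : ℝ)) ^ N * ((N : ℝ) * (N - 2) * (ε ^ (-(-mm N - 2)) *
      (‖x - y‖ ^ 2 + ε) ^ (-mm N - 2)) / kap N) * g y) =
      -((N : ℝ) * (N - 2)) * ((ε ^ (-1 / 2 : ℝ)) ^ N * ε ^ (-(-mm N - 2))) *
       (‖x - y‖ ^ 2 + ε) ^ (-mm N - 2) * g y := by
    field_simp
  rw [e5, e3]

/-- the Laplacian of the Newton potential -/
lemma GHyp.trace (hN : 4 ≤ N) {g : E N → ℝ} (H : GHyp g)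
    {x : E N} (hx : x ∈ ball (0 : E N) 1) :
    ∑ i, JG 0 (dg g i) i x = - kap N * g x := by
  obtain ⟨R, hR, hR'⟩ := H.bound
  have hk := kap_pos hN
  have h1 : Tendsto (fun n => ∑ i, JG (epsj n) (dg g i) i x) atTop
      (𝓝 (∑ i, JG 0 (dg g i) i x)) :=
    tendsto_finsetSum _ fun i _ => (JG_unif hN (H.dcont i).measurable (hR' i) i).tendsto_at hx
  have h2 := tendsto_integral_comp_smul_smul_of_integrable' (μ := (volume : Measure (E N)))
    (φ := fun z => pk z / kap N) (fun z => div_nonneg (pk_pos hN z).le hk.le)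
    (by rw [integral_div]; exact div_self hk.ne')
    (by simpa using pk_decay hN) (g := g) (x₀ := x)
    (H.c1.continuous.integrable_of_hasCompactSupport H.cs) H.c1.continuous.continuousAt
  have h3 : Tendsto (fun n => epsj n ^ (-1 / 2 : ℝ)) atTop atTop := by
    have ha := (tendsto_rpow_neg_nhdsGT_zero (y := -1 / 2) (by norm_num)).comp
      (tendsto_nhdsWithin_iff.2 ⟨epsj_tendsto, Eventually.of_forall epsj_pos⟩)
    exact ha
  have h4 := (h2.comp h3).const_mul (-kap N)
  refine tendsto_nhds_unique h1 (h4.congr fun n => ?_)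
  rw [H.trace_eps hN (epsj_pos n) hx]
  simp

end newton2

/-! ### Part 5e: regularity of Green potentials -/

section green
variable {N : ℕ}

/-- Green potential (up to a constant) -/
def gu (f : E N → ℝ) (x : E N) : ℝ := ∫ y, Ge 0 x y * f y ∂(μB N)

lemma Ge_meas (ε : ℝ) (x : E N) : Measurable fun y => Ge ε x y := by
  unfold Ge QH; fun_prop

lemma Ge_cont_left {ε : ℝ} (hε : 0 < ε) (y : E N) : Continuous fun x : E N => Ge ε x y := by
  unfold Ge
  refine Continuous.sub ?_ ?_
  · exact Continuous.rpow_const (by fun_prop) (fun z => Or.inl (by positivity))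
  · refine Continuous.rpow_const (by unfold QH; fun_prop) (fun z => Or.inl ?_)
    have := QH_nonneg z y
    positivity

lemma Ge_abs_le (hN : 4 ≤ N) {ε : ℝ} {x y : E N} (hx : ‖x‖ ≤ 1) (hy : ‖y‖ ≤ 1)
    (h : 0 < ‖x - y‖ ^ 2 + ε) (hε : 0 ≤ ε) : |Ge ε x y| ≤ (‖x - y‖ ^ 2 + ε) ^ (-mm N) := by
  rw [abs_of_nonneg (Ge_nonneg hN hx hy h)]
  have : 0 ≤ (QH x y + ε) ^ (-mm N) := by
    have := QH_nonneg x y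
    positivity
  unfold Ge; linarith

lemma gu_int (hN : 4 ≤ N) {R : ℝ} {f : E N → ℝ} (hf : Measurable f)
    (hR : ∀ y, |f y| ≤ R) {x : E N} (hx : ‖x‖ ≤ 1) :
    Integrable (fun y => Ge 0 x y * f y) (μB N) := by
  obtain ⟨I, hI, h⟩ := riesz hN (s := (N : ℝ) - 2) (by linarith)
  refine ((h x hx).1.mul_const R).mono' ((Ge_meas 0 x).mul hf).aestronglyMeasurable ?_
  filter_upwards [ae_ne hN x, ae_ball] with y hxy hy
  have hd : 0 < ‖x - y‖ := norm_pos_iff.2 (sub_ne_zero.2 hxy)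
  have h1 := Ge_abs_le hN hx hy.le (ε := 0) (by positivity) le_rfl
  rw [add_zero, norm_rpow_sq, show 2 * -mm N = -((N : ℝ) - 2) by unfold mm; ring] at h1
  rw [Real.norm_eq_abs, abs_mul]
  gcongr
  exact hR y

lemma gue_bound (hN : 4 ≤ N) {ε : ℝ} (hε : 0 < ε) {x y : E N} (hx : ‖x‖ ≤ 1) (hy : ‖y‖ ≤ 1) :
    |Ge ε x y| ≤ ε ^ (-mm N) := by
  refine (Ge_abs_le hN hx hy (by positivity) hε.le).trans ?_
  exact Real.rpow_le_rpow_of_nonpos hε (by nlinarith [sq_nonneg ‖x - y‖])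
    (by have := mm_pos hN; linarith)

lemma gue_int (hN : 4 ≤ N) {ε : ℝ} (hε : 0 < ε) {R : ℝ} {f : E N → ℝ} (hf : Measurable f)
    (hR : ∀ y, |f y| ≤ R) {x : E N} (hx : ‖x‖ ≤ 1) :
    Integrable (fun y => Ge ε x y * f y) (μB N) := by
  refine Integrable.of_bound ((Ge_meas ε x).mul hf).aestronglyMeasurable (ε ^ (-mm N) * R) ?_
  filter_upwards [ae_ball] with y hy
  rw [Real.norm_eq_abs, abs_mul]
  have := gue_bound hN hε hx hy.le
  gcongr
  exact hR y

lemma gu_cont (hN : 4 ≤ N) {R : ℝ} {f : E N → ℝ} (hf : Measurable f)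
    (hR : ∀ y, |f y| ≤ R) : ContinuousOn (gu f) (closedBall 0 1) := by
  have hm := mm_pos hN
  have hR0 : 0 ≤ R := (abs_nonneg _).trans (hR 0)
  have hU : ∀ x ∈ closedBall (0 : E N) 1, ‖x‖ ≤ 1 := fun x hx => mem_closedBall_zero_iff.1 hx
  have h := unif_of_bound hN hU (s := (N : ℝ) - 2 + 2 * (1 / 4)) (θ := 1 / 4) (D := mm N * R)
    (Kn := fun n y x => Ge (epsj n) x y * f y) (K := fun y x => Ge 0 x y * f y)
    (by linarith) (by norm_num) (by positivity)
    (fun n x hx => gue_int hN (epsj_pos n) hf hR (hU x hx)) (fun x hx => gu_int hN hf hR (hU x hx))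
    (fun n x hx => by
      filter_upwards [ae_ne hN x, ae_ball] with y hxy hy
      have hd : 0 < ‖x - y‖ := norm_pos_iff.2 (sub_ne_zero.2 hxy)
      have h1 := Ge_sub_le hN (hU x hx) hy.le hxy le_rfl (epsj_pos n) (epsj_pos n).le
        (θ := 1 / 4) (by norm_num) (by norm_num)
      have h2 := Ge_mono hN (hU x hx) hy.le (ε := 0) (by positivity) (epsj_pos n).le
      rw [← sub_mul, abs_mul, abs_of_nonneg (sub_nonneg.2 h2)]
      calc _ ≤ (mm N * epsj n ^ (1 / 4 : ℝ) * ‖x - y‖ ^ (-((N : ℝ) - 2 + 2 * (1 / 4)))) * R :=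
            mul_le_mul h1 (hR y) (abs_nonneg _) ((sub_nonneg.2 h2).trans h1)
        _ = _ := by ring)
  refine h.continuousOn (Frequently.of_forall fun n => ?_)
  refine continuousOn_of_dominated (bound := fun _ => epsj n ^ (-mm N) * R)
    (fun x _ => ((Ge_meas _ x).mul hf).aestronglyMeasurable) ?_ (integrable_const _) ?_
  · intro x hx
    filter_upwards [ae_ball] with y hy
    rw [Real.norm_eq_abs, abs_mul]
    have := gue_bound hN (epsj_pos n) (hU x hx) hy.le
    exact mul_le_mul this (hR y) (abs_nonneg _) ((abs_nonneg _).trans this)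
  · refine Eventually.of_forall fun y => ?_
    exact ((Ge_cont_left (epsj_pos n) y).mul continuous_const).continuousOn

lemma gu_boundary (f : E N → ℝ) {x : E N} (hx : ‖x‖ = 1) : gu f x = 0 := by
  unfold gu
  simp [Ge_boundary, hx]

/-- the regular part -/
def a2 : E N → ℝ := fun y => ‖y‖ ^ 2
def c2 : E N → ℝ := fun _ => 1

lemma qd_reg (y x : E N) : qd a2 c2 y x = QH x y := by
  simp [qd, a2, c2, QH]; ring

lemma qhyp_reg {R r : ℝ} (hr : r < 1) {U : Set (E N)} (hU : IsOpen U) (hUr : ∀ x ∈ U, ‖x‖ ≤ r)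
    {f : E N → ℝ} (hf : Measurable f) (hR : ∀ y, |f y| ≤ R) :
    QHyp a2 c2 f (μB N) U ((1 - r) ^ 2) R where
  mA := by unfold a2; fun_prop
  mC := measurable_const
  mh := hf
  hU := hU
  hUb x hx := (hUr x hx).trans hr.le
  hc := by have : 0 < 1 - r := by linarith
           positivity
  bA := ae_ball.mono fun y hy => by
    rw [a2, abs_of_nonneg (by positivity)]
    exact pow_le_one₀ (norm_nonneg _) hy.le
  by1 := ae_ball.mono fun y hy => hy.le
  bh := hR
  hq := ae_ball.mono fun y hy x hx => by
    rw [qd_reg]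
    refine le_trans ?_ (QH_ge x y)
    have h1 : ‖x‖ * ‖y‖ ≤ r := by
      have := hUr x hx
      nlinarith [norm_nonneg x, norm_nonneg y]
    have : 0 ≤ 1 - r := by linarith
    gcongr

def LL (f : E N → ℝ) (x : E N) : ℝ := ∫ y, k0 a2 c2 f (mm N) y x ∂(μB N)
def LG (f : E N → ℝ) (i : Fin N) (x : E N) : ℝ := ∫ y, k1 a2 c2 f (mm N) y i x ∂(μB N)
def LH (f : E N → ℝ) (i j : Fin N) (x : E N) : ℝ := ∫ y, k2 a2 c2 f (mm N) y i j x ∂(μB N)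

lemma gu_eq (hN : 4 ≤ N) {R : ℝ} {f : E N → ℝ} (hf : Measurable f)
    (hR : ∀ y, |f y| ≤ R) {x : E N} (hx : x ∈ ball (0 : E N) 1) : gu f x = JJ 0 f x - LL f x := by
  have hm := mm_pos hN
  have hx1 := mem_ball_zero_iff.1 hx
  obtain ⟨r, hr1, hr2⟩ := exists_between hx1
  have Q := qhyp_reg (N := N) hr2 (isOpen_ball (x := 0) (ε := r))
    (fun x hx => (mem_ball_zero_iff.1 hx).le) hf hR
  unfold JJ LL gu
  rw [← integral_sub (k0_int hN hf hR hx1.le)]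
  · refine integral_congr_ae (Eventually.of_forall fun y => ?_)
    simp only [k0, qd_newton, qd_reg, Ge, add_zero]
    ring
  · refine Integrable.of_bound (k0_meas Q _ x).aestronglyMeasurable (kB ((1 - r) ^ 2) R (mm N))
      ((Q.bounds (s := mm N) (by linarith)).mono fun y hy => ?_)
    exact (hy x (mem_ball_zero_iff.2 hr1)).1

lemma gu_D1 (hN : 4 ≤ N) {R : ℝ} {f : E N → ℝ} (hf : Measurable f)
    (hR : ∀ y, |f y| ≤ R) :
    D1 (ball 0 1) (gu f) (fun i x => JG 0 f i x - LG f i x) := by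
  have hm := mm_pos hN
  intro x hx
  have hx1 := mem_ball_zero_iff.1 hx
  obtain ⟨r, hr1, hr2⟩ := exists_between hx1
  have Q := qhyp_reg (N := N) hr2 (isOpen_ball (x := 0) (ε := r))
    (fun x hx => (mem_ball_zero_iff.1 hx).le) hf hR
  have hsub : ball (0 : E N) r ⊆ ball 0 1 := ball_subset_ball hr2.le
  have h1 := ((JJ0_d1 hN hf hR).mono hsub).sub (Q.d1 (s := mm N) (by linarith))
  have h2 := h1.congr isOpen_ball (F' := gu f) (G' := fun i x => JG 0 f i x - LG f i x)
    (fun x hx => gu_eq hN hf hR (hsub hx)) fun _ _ _ => rfl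
  exact h2 x (mem_ball_zero_iff.2 hr1)

lemma gu_grad_cont (hN : 4 ≤ N) {R : ℝ} {f : E N → ℝ} (hf : Measurable f)
    (hR : ∀ y, |f y| ≤ R) (i : Fin N) :
    ContinuousOn (fun x => JG 0 f i x - LG f i x) (ball 0 1) := by
  have hm := mm_pos hN
  refine (JG0_cont hN hf hR i).sub ?_
  intro x hx
  have hx1 := mem_ball_zero_iff.1 hx
  obtain ⟨r, hr1, hr2⟩ := exists_between hx1
  have Q := qhyp_reg (N := N) hr2 (isOpen_ball (x := 0) (ε := r))
    (fun x hx => (mem_ball_zero_iff.1 hx).le) hf hR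
  have := (Q.d2 (s := mm N) (by linarith) i) x (mem_ball_zero_iff.2 hr1)
  exact this.continuousAt.continuousWithinAt

lemma gu_C1 (hN : 4 ≤ N) {R : ℝ} {f : E N → ℝ} (hf : Measurable f)
    (hR : ∀ y, |f y| ≤ R) : ContDiffOn ℝ 1 (gu f) (ball 0 1) :=
  (gu_D1 hN hf hR).contDiffOn_one isOpen_ball (gu_grad_cont hN hf hR)

lemma qhyp_far {R δ : ℝ} (hδ : 0 < δ) {x0 : E N} (hx0 : ball x0 δ ⊆ ball 0 1)
    {f : E N → ℝ} (hf : Measurable f) (hR : ∀ y, |f y| ≤ R) :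
    QHyp a1 (c1 0) f ((μB N).restrict (ball x0 (2 * δ))ᶜ) (ball x0 δ) (δ ^ 2) R where
  mA := measurable_const
  mC := by unfold c1; fun_prop
  mh := hf
  hU := isOpen_ball
  hUb x hx := (mem_ball_zero_iff.1 (hx0 hx)).le
  hc := by positivity
  bA := Eventually.of_forall fun y => by simp [a1]
  by1 := ae_restrict_of_ae (ae_ball.mono fun y hy => hy.le)
  bh := hR
  hq := by
    filter_upwards [ae_restrict_mem measurableSet_ball.compl] with y hy x hx
    rw [qd_newton, add_zero]
    have h1 : 2 * δ ≤ dist y x0 := by simpa using hy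
    have h2 : dist x x0 < δ := hx
    have h3 := dist_triangle y x x0
    rw [dist_comm y x, dist_eq_norm x y] at h3
    have : δ ≤ ‖x - y‖ := by linarith
    gcongr

lemma bump_mul_GHyp {f : E N → ℝ} (hf1 : ContDiffOn ℝ 1 f (ball 0 1)) {x0 : E N}
    (χ : ContDiffBump x0) (hχ : closedBall x0 χ.rOut ⊆ ball 0 1) :
    GHyp (fun y => χ y * f y) := by
  have hts : tsupport (fun y => χ y * f y) ⊆ closedBall x0 χ.rOut := by
    rw [← χ.tsupport_eq]
    exact tsupport_mul_subset_left
  refine ⟨?_, ?_, hts.trans hχ⟩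
  · rw [contDiff_iff_contDiffAt]
    intro x
    by_cases hx : x ∈ ball (0 : E N) 1
    · exact χ.contDiff.contDiffAt.mul (hf1.contDiffAt (isOpen_ball.mem_nhds hx))
    · have : x ∉ tsupport (fun y => χ y * f y) := fun h => hx (hχ (hts h))
      exact contDiffAt_const.congr_of_eventuallyEq (notMem_tsupport_iff_eventuallyEq.1 this)
  · exact HasCompactSupport.of_support_subset_isCompact (isCompact_closedBall x0 χ.rOut)
      ((subset_tsupport _).trans hts)

lemma gu_local (hN : 4 ≤ N) {R : ℝ} {f : E N → ℝ} (hf : Measurable f)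
    (hR : ∀ y, |f y| ≤ R) (hf1 : ContDiffOn ℝ 1 f (ball 0 1)) {x0 : E N}
    (hx0 : x0 ∈ ball (0 : E N) 1) :
    ∃ (V : Set (E N)) (H : Fin N → Fin N → E N → ℝ), IsOpen V ∧ x0 ∈ V ∧ V ⊆ ball 0 1 ∧
      (∀ i, D1 V (fun x => JG 0 f i x - LG f i x) (H i)) ∧ (∀ i j, ContinuousOn (H i j) V) ∧
      ∀ x ∈ V, ∑ i, H i i x = - kap N * f x := by
  have hm := mm_pos hN
  have hx1 := mem_ball_zero_iff.1 hx0
  set δ := (1 - ‖x0‖) / 8 with hδ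
  have hδ0 : 0 < δ := by rw [hδ]; linarith
  let χ : ContDiffBump x0 := ⟨2 * δ, 4 * δ, by linarith, by linarith⟩
  have hχ : closedBall x0 χ.rOut ⊆ ball 0 1 := by
    intro y hy
    have h1 : dist y x0 ≤ 4 * δ := hy
    rw [dist_eq_norm] at h1
    have h2 := norm_le_insert' y x0
    rw [mem_ball_zero_iff]
    linarith
  have hV : ball x0 δ ⊆ ball 0 1 := fun y hy => hχ <| by
    have h1 : dist y x0 < δ := hy
    show dist y x0 ≤ 4 * δ
    linarith
  set g : E N → ℝ := fun y => χ y * f y with hg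
  set h : E N → ℝ := fun y => (1 - χ y) * f y with hh
  have Hg : GHyp g := bump_mul_GHyp hf1 χ hχ
  have mχ : Measurable χ := χ.continuous.measurable
  have mg : Measurable g := mχ.mul hf
  have mh : Measurable h := (measurable_const.sub mχ).mul hf
  have bg : ∀ y, |g y| ≤ R := fun y => by
    rw [hg]; simp only [abs_mul]
    rw [abs_of_nonneg χ.nonneg]
    exact (mul_le_of_le_one_left (abs_nonneg _) χ.le_one).trans (hR y)
  have bh : ∀ y, |h y| ≤ R := fun y => by
    rw [hh]; simp only [abs_mul]
    have := χ.le_one (x := y)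
    have := χ.nonneg (x := y)
    rw [abs_of_nonneg (by linarith)]
    exact (mul_le_of_le_one_left (abs_nonneg _) (by linarith)).trans (hR y)
  have Q1 := qhyp_far hδ0 hV mh bh
  have hVr : ∀ x ∈ ball x0 δ, ‖x‖ ≤ 1 - 7 * δ := by
    intro x hx
    have h1 : dist x x0 < δ := hx
    rw [dist_eq_norm] at h1
    have h2 := norm_le_insert' x x0
    linarith
  have Q2 := qhyp_reg (N := N) (r := 1 - 7 * δ) (by linarith) (isOpen_ball (x := x0) (ε := δ)) hVr hf hR
  have hm0 : 0 ≤ mm N := by linarith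
  refine ⟨ball x0 δ, fun i j x => JG 0 (dg g i) j x +
    ∫ y, k2 a1 (c1 0) h (mm N) y i j x ∂((μB N).restrict (ball x0 (2 * δ))ᶜ) - LH f i j x,
    isOpen_ball, mem_ball_self hδ0, hV, fun i => ?_, fun i j => ?_, fun x hx => ?_⟩
  · have h1 := (((Hg.d2 hN i).mono hV).add (Q1.d2 hm0 i)).sub (Q2.d2 hm0 i)
    refine h1.congr isOpen_ball (fun x hx => ?_) fun _ _ _ => rfl
    have hxb := (mem_ball_zero_iff.1 (hV hx)).le
    have e1 : JG 0 f i x = JG 0 g i x + JG 0 h i x := by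
      unfold JG
      rw [← integral_add (k1_int hN mg bg hxb i) (k1_int hN mh bh hxb i)]
      refine integral_congr_ae (Eventually.of_forall fun y => ?_)
      simp only [k1, hg, hh]; ring
    have e2 : JG 0 h i x =
        ∫ y, k1 a1 (c1 0) h (mm N) y i x ∂((μB N).restrict (ball x0 (2 * δ))ᶜ) := by
      unfold JG
      rw [setIntegral_eq_integral_of_forall_compl_eq_zero]
      intro y hy
      have hy' : y ∈ closedBall x0 χ.rIn := by
        rw [notMem_compl_iff] at hy
        exact ball_subset_closedBall hy
      simp [k1, hh, χ.one_of_mem_closedBall hy']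
    rw [e1, e2]
    rfl
  · obtain ⟨R', hR1, hR2⟩ := Hg.bound
    exact (((JG0_cont hN (Hg.dcont i).measurable (hR2 i) j).mono hV).add (Q1.cont hm0 i j)).sub
      (Q2.cont hm0 i j)
  · rw [Finset.sum_sub_distrib, Finset.sum_add_distrib, Hg.trace hN (hV hx), Q1.trace hN hx]
    have e3 := Q2.trace hN hx
    unfold LH
    rw [e3]
    have hxx : χ x = 1 := χ.one_of_mem_closedBall (by
      have h1 : dist x x0 < δ := hx
      show dist x x0 ≤ 2 * δ
      linarith)
    simp [a1, c1, a2, c2, hg, hxx]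

/-- Regularity theorem. -/
theorem gu_C2 (hN : 4 ≤ N) {R : ℝ} {f : E N → ℝ} (hf : Measurable f)
    (hR : ∀ y, |f y| ≤ R) (hf1 : ContDiffOn ℝ 1 f (ball 0 1)) :
    ContDiffOn ℝ 2 (gu f) (ball 0 1) ∧
      ∀ x ∈ ball (0 : E N) 1, lap (gu f) x = - kap N * f x := by
  constructor
  · intro x hx
    obtain ⟨V, H, hV, hxV, hVb, h1, h2, h3⟩ := gu_local hN hf hR hf1 hx
    have := ((gu_D1 hN hf hR).mono hVb).contDiffOn_two hV h1 h2
    exact (this.contDiffAt (hV.mem_nhds hxV)).contDiffWithinAt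
  · intro x hx
    obtain ⟨V, H, hV, hxV, hVb, h1, h2, h3⟩ := gu_local hN hf hR hf1 hx
    rw [((gu_D1 hN hf hR).mono hVb).lap_eq hV h1 hxV, h3 x hxV]

end green

section RealEL
variable {N : ℕ} {p α : ℝ}

def fw (p α : ℝ) (w : E N → ℝ≥0∞) (y : E N) : ℝ :=
  (ball (0 : E N) 1).indicator (fun y => (aw α p y * w y).toReal) y

lemma fw_meas {w : E N → ℝ≥0∞} (hw : Measurable w) : Measurable (fw p α w) := by
  unfold fw
  exact (((aw_measurable α p).mul hw).ennreal_toReal).indicator measurableSet_ball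

lemma fw_nonneg (w : E N → ℝ≥0∞) (y : E N) : 0 ≤ fw p α w y := by
  unfold fw
  exact indicator_nonneg (fun _ _ => ENNReal.toReal_nonneg) y

lemma fw_le (hp : 1 < p) (hα : p + 1 ≤ α) {w : E N → ℝ≥0∞} {b : ℝ≥0∞} (hb : b ≠ ⊤)
    (h : ∀ x, ‖x‖ ≤ 1 → w x ≤ b) (y : E N) : |fw p α w y| ≤ b.toReal := by
  rw [abs_of_nonneg (fw_nonneg w y)]
  unfold fw
  by_cases hy : y ∈ ball (0 : E N) 1
  · rw [indicator_of_mem hy]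
    have hy' : ‖y‖ ≤ 1 := (mem_ball_zero_iff.1 hy).le
    refine ENNReal.toReal_mono hb ?_
    calc aw α p y * w y ≤ 1 * b := by gcongr; exacts [aw_le_one hp hα hy', h y hy']
      _ = b := one_mul _
  · rw [indicator_of_notMem hy]; exact ENNReal.toReal_nonneg

lemma gu_nonneg (hN : 4 ≤ N) {f : E N → ℝ} (hf : ∀ y, 0 ≤ f y) {x : E N} (hx : ‖x‖ ≤ 1) :
    0 ≤ gu f x := by
  unfold gu
  refine integral_nonneg_of_ae ?_
  filter_upwards [ae_ball, ae_ne hN x] with y hy hxy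
  have : 0 < ‖x - y‖ ^ 2 + 0 := by
    have := norm_pos_iff.2 (sub_ne_zero.2 hxy); positivity
  exact mul_nonneg (Ge_nonneg hN hx hy.le this) (hf y)

lemma TE_eq (hN : 4 ≤ N) (hp : 1 < p) (hα : p + 1 ≤ α) {w : E N → ℝ≥0∞} (hw : Measurable w)
    {b : ℝ≥0∞} (hb : b ≠ ⊤) (h : ∀ x, ‖x‖ ≤ 1 → w x ≤ b) {x : E N} (hx : ‖x‖ ≤ 1) :
    TE p α w x = aw α p x * ENNReal.ofReal (gu (fw p α w) x) := by
  have hpos : ∀ᵐ y ∂(μB N), 0 ≤ Ge 0 x y * fw p α w y := by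
    filter_upwards [ae_ball, ae_ne hN x] with y hy hxy
    have : 0 < ‖x - y‖ ^ 2 + 0 := by
      have := norm_pos_iff.2 (sub_ne_zero.2 hxy); positivity
    exact mul_nonneg (Ge_nonneg hN hx hy.le this) (fw_nonneg w y)
  unfold gu
  rw [ofReal_integral_eq_lintegral_ofReal (gu_int hN (fw_meas hw) (fw_le hp hα hb h) hx) hpos,
    ← lintegral_const_mul' _ _ (by unfold aw; simp)]
  unfold TE KE
  refine lintegral_congr_ae ?_
  filter_upwards [ae_ball, ae_ne hN x] with y hy hxy
  have h0 : 0 < ‖x - y‖ ^ 2 + 0 := by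
    have := norm_pos_iff.2 (sub_ne_zero.2 hxy); positivity
  rw [GE_eq hN hx hy.le hxy, ENNReal.ofReal_mul (Ge_nonneg hN hx hy.le h0)]
  have : ENNReal.ofReal (fw p α w y) = aw α p y * w y := by
    unfold fw
    rw [indicator_of_mem (by simpa using hy), ENNReal.ofReal_toReal]
    refine ENNReal.mul_ne_top (by unfold aw; simp) ?_
    exact ne_top_of_le_ne_top hb (h y hy.le)
  rw [this]; ring

structure HalfSol (p α M : ℝ) (f g : E N → ℝ) : Prop where
  meas : Measurable f
  nonneg : ∀ x, 0 ≤ f x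
  bdd : ∃ R, ∀ x, |f x| ≤ R
  eq : ∀ x ∈ ball (0 : E N) 1, f x = ‖x‖ ^ α * (gu g x / M) ^ p
  norm : ∫⁻ x, ENNReal.ofReal (‖x‖ ^ α * (gu g x / M) ^ (p + 1)) ∂(μB N) = 1

lemma half_of (P : Pkg N p α) (hM : MM N p α ≠ 0) {w w' : E N → ℝ≥0∞} (hw : Measurable w)
    (hw' : Measurable w') {b : ℝ≥0∞} (hb : b ≠ ⊤) (hwb : ∀ x, ‖x‖ ≤ 1 → w x ≤ b)
    (hwb' : ∀ x, ‖x‖ ≤ 1 → w' x ≤ b)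
    (h1 : ∀ x, w x = ((MM N p α)⁻¹ * TE p α w' x) ^ p)
    (hn : ∫⁻ x, w x ^ ((p + 1) / p) ∂(μB N) = 1) :
    HalfSol p α (MM N p α).toReal (fw p α w) (fw p α w') := by
  have hp := P.hp
  have hα := P.hα
  have hN := P.hN
  have hMt := P.MM_lt_top
  have hp1 : 0 < p + 1 := by linarith
  have hp0 : 0 < p := by linarith
  have hα0 : 0 < α := by linarith
  set M := (MM N p α).toReal with hMdef
  have hMp : 0 < M := ENNReal.toReal_pos hM hMt.ne
  have hMM : MM N p α = ENNReal.ofReal M := (ENNReal.ofReal_toReal hMt.ne).symm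
  have key : ∀ x : E N, ‖x‖ ≤ 1 →
      w x = ENNReal.ofReal ((‖x‖ ^ (α / (p + 1)) * (gu (fw p α w') x / M)) ^ p) ∧
      0 ≤ gu (fw p α w') x := by
    intro x hx
    have hg := gu_nonneg hN (fw_nonneg (p := p) (α := α) w') hx
    refine ⟨?_, hg⟩
    rw [h1, TE_eq hN hp hα hw' hb hwb' hx, hMM, ← ENNReal.ofReal_inv_of_pos hMp, aw,
      ← ENNReal.ofReal_mul (by positivity), ← ENNReal.ofReal_mul (by positivity),
      ENNReal.ofReal_rpow_of_nonneg (by positivity) hp0.le]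
    congr 2; field_simp
  refine ⟨fw_meas hw, fw_nonneg w, ⟨_, fw_le hp hα hb hwb⟩, ?_, ?_⟩
  · intro x hx
    have hx' : ‖x‖ ≤ 1 := (mem_ball_zero_iff.1 hx).le
    obtain ⟨k1, k2⟩ := key x hx'
    unfold fw
    rw [indicator_of_mem hx, k1, aw, ← ENNReal.ofReal_mul (by positivity),
      ENNReal.toReal_ofReal (by positivity)]
    rw [Real.mul_rpow (by positivity) (by positivity), ← mul_assoc, ← Real.rpow_mul (norm_nonneg _),
      ← Real.rpow_add_of_nonneg (norm_nonneg _) (by positivity) (by positivity)]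
    congr 2; field_simp; ring
  · rw [← hn]
    refine lintegral_congr_ae ?_
    filter_upwards [ae_ball] with x hx
    obtain ⟨k1, k2⟩ := key x hx.le
    rw [k1, ENNReal.ofReal_rpow_of_nonneg (by positivity) (by positivity),
      ← Real.rpow_mul (by positivity), Real.mul_rpow (by positivity) (by positivity),
      ← Real.rpow_mul (norm_nonneg _)]
    congr 3
    · field_simp
    · field_simp

theorem EL_real (P : Pkg N p α) (hM : MM N p α ≠ 0) :
    ∃ f g : E N → ℝ, HalfSol p α (MM N p α).toReal f g ∧ HalfSol p α (MM N p α).toReal g f := by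
  obtain ⟨w, w', hw, hw', n1, n2, e1, e2⟩ := exists_EL P hM
  obtain ⟨b, hb, hbb⟩ := EL_bdd P hM hw hw' e1 e2
  exact ⟨fw p α w, fw p α w',
    half_of P hM hw.meas hw'.meas hb (fun x hx => (hbb x hx).1) (fun x hx => (hbb x hx).2) e1 n1,
    half_of P hM hw'.meas hw.meas hb (fun x hx => (hbb x hx).2) (fun x hx => (hbb x hx).1) e2 n2⟩
end RealEL

section MaxP
variable {N : ℕ} {p α : ℝ}

lemma line_D1 {U : Set (E N)} {F : E N → ℝ} {G : Fin N → E N → ℝ} (h : D1 U F G) (z : E N)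
    (i : Fin N) (t : ℝ) (ht : z + t • (EuclideanSpace.single i 1 : E N) ∈ U) :
    HasDerivAt (fun t : ℝ => F (z + t • (EuclideanSpace.single i 1 : E N)))
      (G i (z + t • (EuclideanSpace.single i 1 : E N))) t := by
  have h1 : HasDerivAt (fun t : ℝ => z + t • (EuclideanSpace.single i 1 : E N))
      (EuclideanSpace.single i 1 : E N) t := by
    have := ((hasDerivAt_id t).smul_const (EuclideanSpace.single i 1 : E N)).const_add z
    simpa using this
  have := (h _ ht).comp_hasDerivAt t h1
  rw [sum_pj_single] at this
  exact this

lemma hess_nonpos {U : Set (E N)} (hU : IsOpen U) {F : E N → ℝ} {G : Fin N → E N → ℝ}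
    {H : Fin N → Fin N → E N → ℝ} (h : D1 U F G) (hG : ∀ i, D1 U (G i) (H i)) {z : E N}
    (hz : z ∈ U) (hm : IsLocalMax F z) (i : Fin N) : H i i z ≤ 0 := by
  by_contra! hc
  set e : E N := EuclideanSpace.single i 1 with he
  have hcont : Continuous fun t : ℝ => z + t • e := by fun_prop
  have hev : ∀ᶠ t : ℝ in 𝓝 0, z + t • e ∈ U :=
    hcont.continuousAt.eventually (by simpa using hU.mem_nhds hz)
  set φ : ℝ → ℝ := fun t => F (z + t • e) with hφ
  have hd : deriv φ =ᶠ[𝓝 0] fun t => G i (z + t • e) := by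
    filter_upwards [hev] with t ht
    exact (line_D1 h z i t ht).deriv
  have hdd : deriv (deriv φ) 0 = H i i z := by
    rw [hd.deriv_eq]
    have := (line_D1 (hG i) z i 0 (by simpa using hz)).deriv
    simpa using this
  have hmax : IsLocalMax φ 0 := by
    have : IsLocalMax F (z + (0:ℝ) • e) := by simpa using hm
    exact this.comp_continuous (g := fun t : ℝ => z + t • e) hcont.continuousAt
  have hd0 : deriv φ 0 = 0 := hmax.deriv_eq_zero
  have hmin : IsLocalMin φ 0 := by
    refine isLocalMin_of_deriv_deriv_pos (by rw [hdd]; exact hc) hd0 ?_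
    exact (line_D1 h z i 0 (by simpa using hz)).continuousAt
  have hconst : φ =ᶠ[𝓝 0] fun _ => φ 0 := by
    filter_upwards [hmax, hmin] with t h1 h2
    exact le_antisymm h1 h2
  have h3 : deriv φ =ᶠ[𝓝 0] fun _ => (0:ℝ) := by
    have := hconst.deriv
    simpa using this
  have h4 := h3.deriv_eq
  rw [hdd] at h4
  simp at h4
  linarith

lemma C2_D1 {U : Set (E N)} (hU : IsOpen U) {F : E N → ℝ} (hF : ContDiffOn ℝ 2 F U) :
    ∃ (G : Fin N → E N → ℝ) (H : Fin N → Fin N → E N → ℝ), D1 U F G ∧ (∀ i, D1 U (G i) (H i)) := by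
  refine ⟨_, _, D1_of_differentiable fun x hx =>
    (hF.contDiffAt (hU.mem_nhds hx)).differentiableAt (by norm_num), fun i =>
    D1_of_differentiable fun x hx => ?_⟩
  have h1 := (hF.contDiffAt (hU.mem_nhds hx)).fderiv_right (m := 1) (by norm_num)
  exact (h1.differentiableAt (by norm_num)).clm_apply (differentiableAt_const _)

lemma lap_sub_C2 {U : Set (E N)} (hU : IsOpen U) {F F' : E N → ℝ} (hF : ContDiffOn ℝ 2 F U)
    (hF' : ContDiffOn ℝ 2 F' U) {x : E N} (hx : x ∈ U) :
    lap (fun x => F x - F' x) x = lap F x - lap F' x := by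
  obtain ⟨G, H, h1, h2⟩ := C2_D1 hU hF
  obtain ⟨G', H', h1', h2'⟩ := C2_D1 hU hF'
  rw [(h1.sub h1').lap_eq hU (fun i => (h2 i).sub (h2' i)) hx, h1.lap_eq hU h2 hx,
    h1'.lap_eq hU h2' hx, Finset.sum_sub_distrib]

lemma max_prin (hN : 4 ≤ N) {F : E N → ℝ} (hc : ContinuousOn F (closedBall 0 1))
    (hF : ContDiffOn ℝ 2 F (ball 0 1)) (hb : ∀ x, ‖x‖ = 1 → F x = 0)
    (hl : ∀ x ∈ ball (0 : E N) 1, 0 < F x → 0 ≤ lap F x) :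
    ∀ x ∈ closedBall (0 : E N) 1, F x ≤ 0 := by
  intro x0 hx0
  by_contra! hpos
  set η := F x0 / 2 with hη
  have hη0 : 0 < η := by positivity
  obtain ⟨z, hz, hzm⟩ := (isCompact_closedBall (0 : E N) 1).exists_isMaxOn ⟨x0, hx0⟩
    (f := fun x => F x + η * ‖x‖ ^ 2) (hc.add (by fun_prop))
  have hz0 : F x0 ≤ F z + η * ‖z‖ ^ 2 := by
    have := hzm hx0
    simp only [mem_ofPred_eq] at this
    nlinarith [sq_nonneg ‖x0‖]
  have hzn : ‖z‖ ≤ 1 := mem_closedBall_zero_iff.1 hz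
  have hz1 : ‖z‖ < 1 := by
    refine lt_of_le_of_ne hzn fun h => ?_
    rw [hb z h, h] at hz0
    linarith
  have hzb : z ∈ ball (0 : E N) 1 := by simpa using hz1
  have hFz : 0 < F z := by
    have : ‖z‖ ^ 2 ≤ 1 := by nlinarith [norm_nonneg z]
    nlinarith
  obtain ⟨G, H, h1, h2⟩ := C2_D1 isOpen_ball hF
  have h3 : D1 (ball (0 : E N) 1) (fun x => F x + η * ‖x‖ ^ 2)
      (fun i x => G i x + η * qe (fun _ => 1) 0 i x) :=
    (h1.add ((D1_qd (fun _ => 1) (fun _ => 0) 0).const_mul η)).congr isOpen_ball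
      (fun x _ => by simp [qd]) (fun _ _ _ => rfl)
  have h4 : ∀ i, D1 (ball (0 : E N) 1) (fun x => G i x + η * qe (fun _ => 1) 0 i x)
      (fun j x => H i j x + η * (2 * 1 * (if i = j then 1 else 0))) := fun i =>
    (h2 i).add ((D1_qe (fun _ => 1) 0 i).const_mul η)
  have hloc : IsLocalMax (fun x => F x + η * ‖x‖ ^ 2) z := by
    refine hzm.isLocalMax (Filter.mem_of_superset (isOpen_ball.mem_nhds hzb) ball_subset_closedBall)
  have h5 := fun i => hess_nonpos isOpen_ball h3 h4 hzb hloc i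
  have h6 := hl z hzb hFz
  rw [h1.lap_eq isOpen_ball h2 hzb] at h6
  have h7 : ∑ i, H i i z ≤ ∑ i : Fin N, (- (2 * η)) := Finset.sum_le_sum fun i _ => by
    have := h5 i
    simp at this
    linarith
  simp at h7
  have : (4:ℝ) ≤ N := N_cast hN
  nlinarith

lemma hsol_pos (hN : 4 ≤ N) (hp : 1 < p) {M : ℝ} {f g : E N → ℝ} (hM : 0 < M) (h : HalfSol p α M f g)
    (hg : HalfSol p α M g f) : ∀ x ∈ ball (0 : E N) 1, 0 < gu g x := by
  intro x hx
  have hx1 : ‖x‖ < 1 := mem_ball_zero_iff.1 hx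
  refine lt_of_le_of_ne (gu_nonneg hN hg.nonneg hx1.le) fun h0 => ?_
  obtain ⟨R, hR⟩ := hg.bdd
  have hpos : ∀ᵐ y ∂(μB N), 0 < Ge 0 x y := by
    filter_upwards [ae_ball, ae_ne hN x] with y hy hxy
    have : 0 < ‖x - y‖ ^ 2 + 0 := by
      have := norm_pos_iff.2 (sub_ne_zero.2 hxy); positivity
    exact Ge_pos hN hx1 hy this
  have h1 : (fun y => Ge 0 x y * g y) =ᵐ[μB N] 0 := by
    rw [← integral_eq_zero_iff_of_nonneg_ae _ (gu_int hN hg.meas hR hx1.le)]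
    · exact h0.symm
    · filter_upwards [hpos] with y hy
      exact mul_nonneg hy.le (hg.nonneg y)
  have h2 : g =ᵐ[μB N] 0 := by
    filter_upwards [hpos, h1] with y hy hy1
    simp only [Pi.zero_apply, mul_eq_zero] at hy1 ⊢
    rcases hy1 with h | h
    · exact absurd h hy.ne'
    · exact h
  have h3 : ∀ z, gu g z = 0 := by
    intro z
    unfold gu
    rw [integral_eq_zero_of_ae]
    filter_upwards [h2] with y hy
    rw [hy]; simp
  have h4 := h.norm
  simp only [h3] at h4

  simp [Real.zero_rpow (show p + 1 ≠ 0 by linarith)] at h4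

lemma half_C1 (hN : 4 ≤ N) (hp : 1 < p) (hα : p + 1 ≤ α) {M : ℝ} {f g : E N → ℝ} (hM : 0 < M)
    (h : HalfSol p α M f g) (hg : HalfSol p α M g f) : ContDiffOn ℝ 1 f (ball 0 1) := by
  obtain ⟨R, hR⟩ := hg.bdd
  have h1 : ContDiffOn ℝ 1 (fun x : E N => ‖x‖ ^ α * (gu g x / M) ^ p) (ball 0 1) := by
    refine ContDiffOn.mul (contDiff_norm_rpow (by linarith)).contDiffOn ?_
    refine ContDiffOn.rpow_const_of_ne ((gu_C1 hN hg.meas hR).div_const M) ?_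
    intro x hx
    have := hsol_pos hN hp hM h hg x hx
    positivity
  exact h1.congr h.eq

lemma half_le (hN : 4 ≤ N) (hp : 1 < p) (hα : p + 1 ≤ α) {M : ℝ} {f g : E N → ℝ} (hM : 0 < M)
    (h : HalfSol p α M f g) (hg : HalfSol p α M g f) :
    ∀ x ∈ closedBall (0 : E N) 1, gu g x - gu f x ≤ 0 := by
  obtain ⟨R, hR⟩ := h.bdd
  obtain ⟨R', hR'⟩ := hg.bdd
  obtain ⟨c1, l1⟩ := gu_C2 hN h.meas hR (half_C1 hN hp hα hM h hg)
  obtain ⟨c2, l2⟩ := gu_C2 hN hg.meas hR' (half_C1 hN hp hα hM hg h)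
  refine max_prin hN (F := fun x => gu g x - gu f x)
    ((gu_cont hN hg.meas hR').sub (gu_cont hN h.meas hR)) (c2.sub c1) ?_ ?_
  · intro x hx
    rw [gu_boundary _ hx, gu_boundary _ hx, sub_zero]
  · intro x hx hlt
    rw [lap_sub_C2 isOpen_ball c2 c1 hx, l1 x hx, l2 x hx, h.eq x hx, hg.eq x hx]
    have hκ := kap_pos hN
    have hle : (gu f x / M) ^ p ≤ (gu g x / M) ^ p := by
      have := hsol_pos hN hp hM hg h x hx
      refine Real.rpow_le_rpow (by positivity) ?_ (by linarith)
      gcongr; linarith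
    have : ‖x‖ ^ α * (gu f x / M) ^ p ≤ ‖x‖ ^ α * (gu g x / M) ^ p := by gcongr
    nlinarith

theorem EL_sol (P : Pkg N p α) (hM : MM N p α ≠ 0) :
    ∃ f : E N → ℝ, HalfSol p α (MM N p α).toReal f f ∧ (∀ x ∈ ball (0 : E N) 1, 0 < gu f x) ∧
      ContDiffOn ℝ 1 f (ball 0 1) := by
  obtain ⟨f, g, h, hg⟩ := EL_real P hM
  have hN := P.hN
  have hp := P.hp
  have hα := P.hα
  have hMp : 0 < (MM N p α).toReal := ENNReal.toReal_pos hM P.MM_lt_top.ne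
  have heq : ∀ x ∈ ball (0 : E N) 1, gu g x = gu f x := fun x hx => by
    have h1 := half_le hN hp hα hMp h hg x (ball_subset_closedBall hx)
    have h2 := half_le hN hp hα hMp hg h x (ball_subset_closedBall hx)
    linarith
  refine ⟨f, ⟨h.meas, h.nonneg, h.bdd, fun x hx => by rw [h.eq x hx, heq x hx], hg.norm⟩,
    hsol_pos hN hp hMp hg h, half_C1 hN hp hα hMp h hg⟩
end MaxP

section Radial
variable {N : ℕ} {p α : ℝ}

def RadialOn (u : E N → ℝ) : Prop :=
  ∀ x ∈ ball (0 : E N) 1, ∀ y ∈ ball (0 : E N) 1, ‖x‖ = ‖y‖ → u x = u y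

lemma norm_line (i0 i : Fin N) (hi : i ≠ i0) (t s : ℝ) :
    ‖t • (EuclideanSpace.single i0 1 : E N) + s • (EuclideanSpace.single i 1 : E N)‖
      = Real.sqrt (t ^ 2 + s ^ 2) := by
  have h : inner ℝ (t • (EuclideanSpace.single i0 1 : E N)) (s • (EuclideanSpace.single i 1 : E N)) = 0 := by
    rw [inner_smul_left, inner_smul_right]
    rw [EuclideanSpace.inner_single_left]
    simp [hi, Ne.symm hi]
  have h2 := norm_add_sq_eq_norm_sq_add_norm_sq_of_inner_eq_zero _ _ h
  rw [← Real.sqrt_mul_self (norm_nonneg _), h2]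
  congr 1
  simp [norm_smul]
  ring

lemma norm_te (i0 : Fin N) (t : ℝ) : ‖t • (EuclideanSpace.single i0 1 : E N)‖ = |t| := by
  simp [norm_smul]

lemma radial_hess {u : E N → ℝ} {G : Fin N → E N → ℝ} {H : Fin N → Fin N → E N → ℝ}
    (hr : RadialOn u) (h : D1 (ball 0 1) u G) (hG : ∀ i, D1 (ball 0 1) (G i) (H i))
    (i0 i : Fin N) (hi : i ≠ i0) {t : ℝ} (ht : 0 < t) (ht1 : t < 1) :
    H i i (t • (EuclideanSpace.single i0 1 : E N)) =
      G i0 (t • (EuclideanSpace.single i0 1 : E N)) / t := by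
  set e0 : E N := EuclideanSpace.single i0 1 with he0
  set e : E N := EuclideanSpace.single i 1 with he
  set r : ℝ → ℝ := fun s => Real.sqrt (t ^ 2 + s ^ 2) with hrdef
  have hrc : Continuous r := by fun_prop
  have hr0 : r 0 = t := by simp [hrdef, Real.sqrt_sq ht.le]
  have hev : ∀ᶠ s in 𝓝 (0:ℝ), r s < 1 :=
    hrc.continuousAt.eventually_lt continuousAt_const (by rw [hr0]; exact ht1)
  have hrpos : ∀ s, 0 < r s := fun s => Real.sqrt_pos.2 (by positivity)
  have hrd : ∀ s, HasDerivAt r (s / r s) s := by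
    intro s
    have h1 : HasDerivAt (fun s : ℝ => t ^ 2 + s ^ 2) (2 * s) s := by
      simpa using (hasDerivAt_pow 2 s).const_add (t ^ 2)
    have h2 := h1.sqrt (by positivity)
    convert h2 using 1
    simp only [hrdef]
    ring
  have hmem : ∀ s, r s < 1 → t • e0 + s • e ∈ ball (0 : E N) 1 := fun s hs => by
    rw [mem_ball_zero_iff, norm_line i0 i hi]; exact hs
  have hmem' : ∀ s, r s < 1 → (0 : E N) + r s • e0 ∈ ball (0 : E N) 1 := fun s hs => by
    rw [mem_ball_zero_iff, zero_add, norm_te, abs_of_pos (hrpos s)]; exact hs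
  have hcomp : ∀ {K : E N → ℝ} {L : Fin N → E N → ℝ}, D1 (ball 0 1) K L → ∀ s, r s < 1 →
      HasDerivAt (fun s => K (0 + r s • e0)) (L i0 (0 + r s • e0) * (s / r s)) s := by
    intro K L hKL s hs
    exact (line_D1 hKL 0 i0 (r s) (hmem' s hs)).comp s (hrd s)
  have hev2 : ∀ᶠ s in 𝓝 (0:ℝ), ∀ᶠ s' in 𝓝 s, r s' < 1 := hev.eventually_nhds
  have hψ : (fun s => G i (t • e0 + s • e)) =ᶠ[𝓝 0] fun s => G i0 (0 + r s • e0) * (s / r s) := by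
    filter_upwards [hev, hev2] with s hs hs2
    have h1 := line_D1 h (t • e0) i s (hmem s hs)
    refine h1.unique ((hcomp h s hs).congr_of_eventuallyEq ?_)
    filter_upwards [hs2] with s' hs'
    refine hr _ (hmem s' hs') _ (hmem' s' hs') ?_
    rw [norm_line i0 i hi, zero_add, norm_te, abs_of_pos (hrpos s')]
  have h1 := line_D1 (hG i) (t • e0) i 0 (hmem 0 (by rw [hr0]; exact ht1))
  have h2 : HasDerivAt (fun s => G i0 (0 + r s • e0) * (s / r s)) _ 0 :=
    (hcomp (hG i0) 0 (by rw [hr0]; exact ht1)).mul ((hasDerivAt_id (0:ℝ)).div (hrd 0) (hrpos 0).ne')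
  have h3 := h1.unique (h2.congr_of_eventuallyEq hψ)
  simp only [hr0, zero_smul, add_zero, zero_add, id] at h3
  rw [h3]
  have := ht.ne'
  field_simp
  ring

lemma radial_flux (hN : 4 ≤ N) {u f : E N → ℝ} (hr : RadialOn u) (hu : ContDiffOn ℝ 2 u (ball 0 1))
    (hf : ContinuousOn f (ball 0 1)) (i0 : Fin N)
    (hl : ∀ x ∈ ball (0 : E N) 1, lap u x = - kap N * f x) :
    ∃ φ' : ℝ → ℝ, ∀ t, 0 < t → t < 1 →
      HasDerivAt (fun t => u (t • (EuclideanSpace.single i0 1 : E N))) (φ' t) t ∧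
      t ^ (N - 1) * φ' t = - kap N * ∫ s in (0:ℝ)..t, s ^ (N - 1) * f (s • (EuclideanSpace.single i0 1 : E N)) := by
  obtain ⟨G, H, h1, h2⟩ := C2_D1 isOpen_ball hu
  set e0 : E N := EuclideanSpace.single i0 1 with he0
  have hmem : ∀ t : ℝ, |t| < 1 → t • e0 ∈ ball (0 : E N) 1 := fun t ht => by
    rw [mem_ball_zero_iff, norm_te]; exact ht
  have hd : ∀ {K : E N → ℝ} {L : Fin N → E N → ℝ}, D1 (ball 0 1) K L → ∀ t : ℝ, |t| < 1 →
      HasDerivAt (fun t : ℝ => K (t • e0)) (L i0 (t • e0)) t := by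
    intro K L hKL t ht
    simpa using line_D1 hKL 0 i0 t (by simpa using hmem t ht)
  refine ⟨fun t => G i0 (t • e0), fun t ht ht1 => ⟨hd h1 t (by rwa [abs_of_pos ht]), ?_⟩⟩
  have hN1 : N - 1 ≠ 0 := by omega
  have hder : ∀ s ∈ Ioo 0 t, HasDerivAt (fun s => s ^ (N - 1) * G i0 (s • e0))
      (- kap N * (s ^ (N - 1) * f (s • e0))) s := by
    intro s hs
    have hs1 : |s| < 1 := by rw [abs_of_pos hs.1]; linarith [hs.2]
    have h3 := (hasDerivAt_pow (N - 1) s).mul (hd (h2 i0) s hs1)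
    refine h3.congr_deriv ?_
    have h4 := hl _ (hmem s hs1)
    rw [h1.lap_eq isOpen_ball h2 (hmem s hs1), ← Finset.add_sum_erase _ _ (Finset.mem_univ i0),
      Finset.sum_congr rfl (g := fun _ => G i0 (s • e0) / s) (fun i hi => radial_hess hr h1 h2 i0 i
        (Finset.ne_of_mem_erase hi) hs.1 (by linarith [hs.2]))] at h4
    simp only [Finset.sum_const, Finset.card_erase_of_mem (Finset.mem_univ i0), Finset.card_univ,
      Fintype.card_fin, nsmul_eq_mul] at h4
    have h5 : s ^ (N - 1) = s * s ^ (N - 1 - 1) := by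
      rw [← pow_succ', Nat.sub_add_cancel (by omega)]
    have hs0 := hs.1.ne'
    have h6 : - kap N * (s ^ (N - 1) * f (s • e0)) = s ^ (N - 1) * (- kap N * f (s • e0)) := by ring
    rw [h6, ← h4, h5]
    field_simp
    ring
  have hcf : ContinuousOn (fun s : ℝ => f (s • e0)) (Icc 0 t) := by
    refine hf.comp (by fun_prop) fun s hs => hmem s ?_
    rw [abs_of_nonneg hs.1]; linarith [hs.2]
  have hcG : ContinuousOn (fun s : ℝ => G i0 (s • e0)) (Icc 0 t) := by
    refine (h2 i0).continuousOn.comp (by fun_prop) fun s hs => hmem s ?_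
    rw [abs_of_nonneg hs.1]; linarith [hs.2]
  have key := intervalIntegral.integral_eq_sub_of_hasDerivAt_of_le ht.le
    (((continuous_pow (N - 1)).continuousOn).mul hcG) hder
    (ContinuousOn.intervalIntegrable_of_Icc ht.le
      (continuousOn_const.mul (((continuous_pow (N - 1)).continuousOn).mul hcf)))
  rw [intervalIntegral.integral_const_mul] at key
  rw [key]
  simp [zero_pow hN1]

lemma radial_le (hN : 4 ≤ N) {u f : E N → ℝ} (hr : RadialOn u) (hu : ContDiffOn ℝ 2 u (ball 0 1))
    (huc : ContinuousOn u (closedBall 0 1)) (hub : ∀ x, ‖x‖ = 1 → u x = 0)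
    (hf : ContinuousOn f (ball 0 1)) (i0 : Fin N)
    (hl : ∀ x ∈ ball (0 : E N) 1, lap u x = - kap N * f x) {I : ℝ} (hI0 : 0 ≤ I)
    (hI : ∀ t, 0 < t → t < 1 →
      ∫ s in (0:ℝ)..t, s ^ (N - 1) * f (s • (EuclideanSpace.single i0 1 : E N)) ≤ I)
    {t : ℝ} (ht : 0 < t) (ht1 : t < 1) :
    u (t • (EuclideanSpace.single i0 1 : E N)) ≤ kap N * I * (1 - t) * (t ^ (N - 1))⁻¹ := by
  obtain ⟨φ', hφ⟩ := radial_flux hN hr hu hf i0 hl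
  have hκ := kap_pos hN
  set e0 : E N := EuclideanSpace.single i0 1 with he0
  have hc : ContinuousOn (fun s : ℝ => u (s • e0)) (Icc t 1) := by
    refine huc.comp (by fun_prop) fun s hs => ?_
    rw [mem_closedBall_zero_iff, norm_te, abs_of_pos (by linarith [hs.1])]; exact hs.2
  obtain ⟨ξ, hξ, hs⟩ := exists_hasDerivAt_eq_slope (fun s : ℝ => u (s • e0)) φ' ht1 hc
    (fun s hs => (hφ s (by linarith [hs.1]) hs.2).1)
  have hξ0 : 0 < ξ := by linarith [hξ.1]
  rw [hub ((1:ℝ) • e0) (by rw [norm_te]; simp), eq_div_iff (by linarith)] at hs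
  have h1 := (hφ ξ hξ0 hξ.2).2
  have h2 := hI ξ hξ0 hξ.2
  have h3 : - φ' ξ ≤ kap N * I * (ξ ^ (N - 1))⁻¹ := by
    rw [← div_eq_mul_inv, le_div_iff₀ (by positivity)]
    nlinarith
  have h4 : (ξ ^ (N - 1))⁻¹ ≤ (t ^ (N - 1))⁻¹ := by
    gcongr; exact hξ.1.le
  have h5 : - φ' ξ ≤ kap N * I * (t ^ (N - 1))⁻¹ :=
    h3.trans (mul_le_mul_of_nonneg_left h4 (by positivity))
  nlinarith
end Radial

section RadialB
variable {N : ℕ} {p α : ℝ}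

def sg (N : ℕ) : ℝ := N * (volume : Measure (E N)).real (ball 0 1)

lemma sg_pos (hN : 4 ≤ N) : 0 < sg N := by
  have := N_cast hN
  unfold sg
  refine mul_pos (by linarith) ?_
  exact ENNReal.toReal_pos (measure_ball_pos _ _ one_pos).ne' measure_ball_lt_top.ne

lemma polar (hN : 4 ≤ N) (h : ℝ → ℝ) :
    ∫ x, h ‖x‖ ∂(μB N) = sg N * ∫ y in Ioo (0:ℝ) 1, y ^ (N - 1) * h y := by
  haveI : Nontrivial (E N) := by
    haveI : Nonempty (Fin N) := ⟨⟨0, by omega⟩⟩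
    infer_instance
  have h1 : ∫ x, h ‖x‖ ∂(μB N) = ∫ x : E N, (Iio (1:ℝ)).indicator h ‖x‖ := by
    unfold μB
    rw [← integral_indicator measurableSet_ball]
    refine integral_congr_ae (Eventually.of_forall fun x => ?_)
    simp only [indicator, mem_ball_zero_iff, mem_Iio]
  rw [h1, integral_fun_norm_addHaar]
  simp only [finrank_euclideanSpace, Fintype.card_fin, nsmul_eq_mul, smul_eq_mul]
  unfold sg
  rw [mul_assoc]
  congr 2
  have h2 : ∀ y : ℝ, y ^ (N - 1) * (Iio (1:ℝ)).indicator h y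
      = (Iio (1:ℝ)).indicator (fun y => y ^ (N - 1) * h y) y := by
    intro y; by_cases hy : y < 1 <;> simp [indicator, hy]
  simp only [h2]
  rw [setIntegral_indicator measurableSet_Iio]
  rfl

lemma int_norm_rpow (hN : 4 ≤ N) (hα : 0 < α) :
    ∫ x : E N, ‖x‖ ^ α ∂(μB N) ≤ sg N / α := by
  have hN' := N_cast hN
  rw [polar hN (fun y => y ^ α), div_eq_mul_inv]
  refine mul_le_mul_of_nonneg_left ?_ (sg_pos hN).le
  have h1 : ∫ y in Ioo (0:ℝ) 1, y ^ (N - 1) * y ^ α ≤ ∫ y in Ioo (0:ℝ) 1, y ^ α := by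
    refine integral_mono_of_nonneg ?_ ?_ ?_
    · filter_upwards [ae_restrict_mem measurableSet_Ioo] with y hy
      have := hy.1
      simp only [Pi.zero_apply]; positivity
    · exact (Continuous.integrableOn_Icc (by fun_prop (disch := exact hα.le)) : IntegrableOn _ (Icc (0:ℝ) 1) volume).mono_set
        Ioo_subset_Icc_self
    · filter_upwards [ae_restrict_mem measurableSet_Ioo] with y hy
      have h0 := hy.1
      have : y ^ (N - 1) ≤ 1 := pow_le_one₀ hy.1.le hy.2.le
      exact mul_le_of_le_one_left (by positivity) this
  refine h1.trans ?_
  rw [← integral_Ioc_eq_integral_Ioo, ← intervalIntegral.integral_of_le zero_le_one,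
    integral_rpow (Or.inl (by linarith))]
  rw [Real.one_rpow, Real.zero_rpow (by linarith), sub_zero, one_div]
  gcongr
  linarith

lemma young_p (hp : 1 < p) {v τ : ℝ} (hv : 0 ≤ v) (hτ : 0 < τ) :
    v ^ p ≤ τ ^ p + τ⁻¹ * v ^ (p + 1) := by
  rcases le_total v τ with h | h
  · have : v ^ p ≤ τ ^ p := Real.rpow_le_rpow hv h (by linarith)
    have : 0 ≤ τ⁻¹ * v ^ (p + 1) := by positivity
    linarith
  · have hv0 : 0 < v := by linarith
    have : v ^ p ≤ τ⁻¹ * v ^ (p + 1) := by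
      rw [Real.rpow_add_one hv0.ne', ← div_eq_inv_mul, le_div_iff₀ hτ]
      gcongr
    have : 0 ≤ τ ^ p := by positivity
    linarith

lemma beta_bound (hp : 1 < p) (hα : 0 < α) :
    ∫ t in Ioo (0:ℝ) 1, (1 - t) ^ (p + 1) * Real.exp (-(α / 2 * (1 - t))) ≤
      (2 / α) ^ (p + 2) * Real.Gamma (p + 2) := by
  have hG := Real.integral_rpow_mul_exp_neg_mul_Ioi (a := p + 2) (r := α / 2) (by linarith) (by positivity)
  have e1 : 1 / (α / 2) = 2 / α := by field_simp
  have e2 : p + 2 - 1 = p + 1 := by ring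
  rw [e1, e2] at hG
  rw [← hG, ← integral_Ioc_eq_integral_Ioo, ← intervalIntegral.integral_of_le zero_le_one,
    intervalIntegral.integral_comp_sub_left (fun s => s ^ (p + 1) * Real.exp (-(α / 2 * s))) 1]
  simp only [sub_self, sub_zero]
  rw [intervalIntegral.integral_of_le zero_le_one]
  refine setIntegral_mono_set ?_ ?_ ?_
  · refine Integrable.of_integral_ne_zero ?_
    rw [hG]
    have := Real.Gamma_pos_of_pos (s := p + 2) (by linarith)
    positivity
  · filter_upwards [ae_restrict_mem measurableSet_Ioi] with y hy
    have : 0 < y := hy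
    simp only [Pi.zero_apply]; positivity
  · exact (Ioc_subset_Ioi_self).eventuallyLE

theorem radial_upper (hN : 4 ≤ N) (hp : 1 < p) :
    ∃ C : ℝ, 0 < C ∧ ∀ (α M : ℝ) (f : E N → ℝ), p + 1 ≤ α → 2 * ((N:ℝ) - 1) * (p + 1) ≤ α → 0 < M →
      HalfSol p α M f f → ContDiffOn ℝ 1 f (ball 0 1) →
      RadialOn (gu f) → M ^ (p + 1) ≤ C * α ^ (-(p + 3)) := by
  have hσ := sg_pos hN
  have hκ := kap_pos hN
  have hN' := N_cast hN
  have hΓ := Real.Gamma_pos_of_pos (s := p + 2) (by linarith)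
  set c1 := kap N * ((sg N + 1) / sg N) with hc1
  have hc1p : 0 < c1 := by positivity
  refine ⟨sg N * c1 ^ (p + 1) * (2 ^ (p + 2) * Real.Gamma (p + 2)), by positivity, ?_⟩
  intro α M f hα hα2 hM h hf1 hr
  have hα0 : 0 < α := by linarith
  have hp1 : 0 < p + 1 := by linarith
  obtain ⟨R, hR⟩ := h.bdd
  obtain ⟨hu2, hl⟩ := gu_C2 hN h.meas hR hf1
  set u := gu f with hu
  have hunn : ∀ x ∈ ball (0 : E N) 1, 0 ≤ u x := fun x hx =>
    gu_nonneg hN h.nonneg (mem_ball_zero_iff.1 hx).le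
  set i0 : Fin N := ⟨0, by omega⟩
  set e0 : E N := EuclideanSpace.single i0 1 with he0
  have hue : ∀ x ∈ ball (0 : E N) 1, u x = u (‖x‖ • e0) := fun x hx =>
    hr x hx _ (by rw [mem_ball_zero_iff, norm_te]; simpa using hx) (by rw [norm_te]; simp)
  have humeas : AEStronglyMeasurable u (μB N) := by
    unfold μB
    exact ((gu_cont hN h.meas hR).mono ball_subset_closedBall).aestronglyMeasurable measurableSet_ball
  -- normalization
  have hnn : ∀ᵐ x ∂(μB N), 0 ≤ ‖x‖ ^ α * (u x / M) ^ (p + 1) := by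
    filter_upwards [ae_ball] with x hx
    have := hunn x (by simpa using hx)
    positivity
  have hmeas2 : AEStronglyMeasurable (fun x : E N => ‖x‖ ^ α * (u x / M) ^ (p + 1)) (μB N) := by
    have := humeas.aemeasurable
    exact AEMeasurable.aestronglyMeasurable (by fun_prop)
  have hint2 : Integrable (fun x : E N => ‖x‖ ^ α * (u x / M) ^ (p + 1)) (μB N) := by
    refine ⟨hmeas2, ?_⟩
    rw [hasFiniteIntegral_iff_ofReal hnn, h.norm]; simp
  have hn1 : ∫ x, ‖x‖ ^ α * (u x / M) ^ (p + 1) ∂(μB N) = 1 := by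
    rw [integral_eq_lintegral_of_nonneg_ae hnn hmeas2, h.norm]; simp
  -- mass bound
  set τ := α ^ (1 / (p + 1)) with hτ
  have hτ0 : 0 < τ := by positivity
  have hfint : Integrable f (μB N) :=
    Integrable.of_bound h.meas.aestronglyMeasurable R (Eventually.of_forall hR)
  have hnint : Integrable (fun x : E N => ‖x‖ ^ α) (μB N) := by
    refine Integrable.of_bound (Measurable.aestronglyMeasurable (by fun_prop)) 1 ?_
    filter_upwards [ae_ball] with x hx
    rw [Real.norm_eq_abs, abs_of_nonneg (by positivity)]
    exact Real.rpow_le_one (norm_nonneg _) hx.le hα0.le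
  have hmass : ∫ x, f x ∂(μB N) ≤ (sg N + 1) * τ⁻¹ := by
    calc ∫ x, f x ∂(μB N) ≤ ∫ x, (τ ^ p * ‖x‖ ^ α + τ⁻¹ * (‖x‖ ^ α * (u x / M) ^ (p + 1))) ∂(μB N) := by
          refine integral_mono_ae hfint ((hnint.const_mul _).add (hint2.const_mul _)) ?_
          filter_upwards [ae_ball] with x hx
          have hxb : x ∈ ball (0 : E N) 1 := by simpa using hx
          have h0 := hunn x hxb
          rw [h.eq x hxb]
          have h1 := young_p hp (v := u x / M) (τ := τ) (by positivity) hτ0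
          have h2 : 0 ≤ ‖x‖ ^ α := by positivity
          nlinarith
      _ = τ ^ p * ∫ x : E N, ‖x‖ ^ α ∂(μB N) + τ⁻¹ := by
          rw [integral_add (hnint.const_mul _) (hint2.const_mul _), integral_const_mul,
            integral_const_mul, hn1, mul_one]
      _ ≤ τ ^ p * (sg N / α) + τ⁻¹ := by
          gcongr; exact int_norm_rpow hN hα0
      _ = (sg N + 1) * τ⁻¹ := by
          have : τ ^ p / α = τ⁻¹ := by
            have h1 : α = τ ^ (p + 1) := by
              rw [hτ, ← Real.rpow_mul hα0.le, one_div, inv_mul_cancel₀ hp1.ne', Real.rpow_one]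
            rw [h1, Real.rpow_add_one hτ0.ne']
            field_simp
          rw [add_mul, one_mul, ← this]; ring
  set I := ∫ s in Ioo (0:ℝ) 1, s ^ (N - 1) * f (s • e0) with hI
  have hIeq : ∫ x, f x ∂(μB N) = sg N * I := by
    rw [hI, ← polar hN (fun s => f (s • e0))]
    refine integral_congr_ae ?_
    filter_upwards [ae_ball] with x hx
    have hxb : x ∈ ball (0 : E N) 1 := by simpa using hx
    have hxb' : ‖x‖ • e0 ∈ ball (0 : E N) 1 := by rw [mem_ball_zero_iff, norm_te]; simpa using hx
    rw [h.eq x hxb, h.eq _ hxb', ← hu, hue x hxb, norm_te, abs_norm]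
  have hI1 : I ≤ (sg N + 1) / sg N * τ⁻¹ := by
    rw [div_mul_eq_mul_div, le_div_iff₀ hσ]
    linarith
  have hgint : IntegrableOn (fun s : ℝ => s ^ (N - 1) * f (s • e0)) (Ioo 0 1) := by
    refine Integrable.of_bound (Measurable.aestronglyMeasurable ?_) R ?_
    · exact (measurable_id.pow_const _).mul (h.meas.comp (by fun_prop))
    · filter_upwards [ae_restrict_mem measurableSet_Ioo] with s hs
      rw [Real.norm_eq_abs, abs_mul, abs_of_nonneg (pow_nonneg hs.1.le _)]
      calc s ^ (N - 1) * |f (s • e0)| ≤ 1 * R :=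
            mul_le_mul (pow_le_one₀ hs.1.le hs.2.le) (hR _) (abs_nonneg _) zero_le_one
        _ = R := one_mul R
  have hgnn : ∀ᵐ s ∂(volume.restrict (Ioo (0:ℝ) 1)), 0 ≤ s ^ (N - 1) * f (s • e0) := by
    filter_upwards [ae_restrict_mem measurableSet_Ioo] with s hs
    exact mul_nonneg (pow_nonneg hs.1.le _) (h.nonneg _)
  have hI0 : 0 ≤ I := integral_nonneg_of_ae hgnn
  have hIt : ∀ t, 0 < t → t < 1 → ∫ s in (0:ℝ)..t, s ^ (N - 1) * f (s • e0) ≤ I := by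
    intro t ht ht1
    rw [intervalIntegral.integral_of_le ht.le]
    refine setIntegral_mono_set hgint hgnn (LE.le.eventuallyLE ?_)
    intro s hs
    exact ⟨hs.1, by linarith [hs.2]⟩
  have hφ : ∀ t, 0 < t → t < 1 → u (t • e0) ≤ c1 * τ⁻¹ * (1 - t) * (t ^ (N - 1))⁻¹ := by
    intro t ht ht1
    refine (radial_le hN hr hu2 (gu_cont hN h.meas hR) (fun x hx => gu_boundary f hx)
      hf1.continuousOn i0 hl hI0 hIt ht ht1).trans ?_
    have h1 : kap N * I ≤ c1 * τ⁻¹ := by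
      rw [hc1, mul_assoc]; gcongr
    have : 0 ≤ 1 - t := by linarith
    gcongr
  -- final
  have hMp : M ^ (p + 1) = ∫ x, ‖x‖ ^ α * (u x) ^ (p + 1) ∂(μB N) := by
    have h1 : ∀ᵐ x ∂(μB N), ‖x‖ ^ α * (u x) ^ (p + 1) = M ^ (p + 1) * (‖x‖ ^ α * (u x / M) ^ (p + 1)) := by
      filter_upwards [ae_ball] with x hx
      have := hunn x (by simpa using hx)
      rw [Real.div_rpow this hM.le]
      field_simp
    rw [integral_congr_ae h1, integral_const_mul, hn1, mul_one]
  have hpol : M ^ (p + 1) = sg N * ∫ t in Ioo (0:ℝ) 1, t ^ (N - 1) * (t ^ α * u (t • e0) ^ (p + 1)) := by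
    rw [hMp, ← polar hN (fun t => t ^ α * u (t • e0) ^ (p + 1))]
    refine integral_congr_ae ?_
    filter_upwards [ae_ball] with x hx
    rw [hue x (by simpa using hx)]
  have hτp : (τ⁻¹) ^ (p + 1) = α⁻¹ := by
    rw [Real.inv_rpow hτ0.le, hτ, ← Real.rpow_mul hα0.le, one_div, inv_mul_cancel₀ hp1.ne', Real.rpow_one]
  have hfin : ∫ t in Ioo (0:ℝ) 1, t ^ (N - 1) * (t ^ α * u (t • e0) ^ (p + 1)) ≤
      c1 ^ (p + 1) * α⁻¹ * ∫ t in Ioo (0:ℝ) 1, (1 - t) ^ (p + 1) * Real.exp (-(α / 2 * (1 - t))) := by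
    rw [← integral_const_mul]
    refine integral_mono_of_nonneg ?_ ?_ ?_
    · filter_upwards [ae_restrict_mem measurableSet_Ioo] with t ht
      have h0 := ht.1
      have : 0 ≤ u (t • e0) := hunn _ (by rw [mem_ball_zero_iff, norm_te, abs_of_pos h0]; exact ht.2)
      simp only [Pi.zero_apply]; positivity
    · refine Integrable.const_mul ?_ _
      refine (Continuous.integrableOn_Icc ?_ : IntegrableOn _ (Icc (0:ℝ) 1) volume).mono_set
        Ioo_subset_Icc_self
      refine Continuous.mul ?_ (by fun_prop)
      exact Continuous.rpow_const (by fun_prop) fun _ => Or.inr hp1.le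
    · filter_upwards [ae_restrict_mem measurableSet_Ioo] with t ht
      have h0 := ht.1
      have h1t : 0 < 1 - t := by linarith [ht.2]
      have hu0 : 0 ≤ u (t • e0) := hunn _ (by rw [mem_ball_zero_iff, norm_te, abs_of_pos h0]; exact ht.2)
      have h2 : u (t • e0) ^ (p + 1) ≤
          c1 ^ (p + 1) * α⁻¹ * (1 - t) ^ (p + 1) * t ^ (-(((N:ℝ) - 1) * (p + 1))) := by
        calc u (t • e0) ^ (p + 1) ≤ (c1 * τ⁻¹ * (1 - t) * (t ^ (N - 1))⁻¹) ^ (p + 1) :=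
              Real.rpow_le_rpow hu0 (hφ t h0 ht.2) hp1.le
          _ = _ := by
              rw [Real.mul_rpow (by positivity) (by positivity), Real.mul_rpow (by positivity) h1t.le,
                Real.mul_rpow hc1p.le (by positivity), hτp]
              congr 1
              rw [← Real.rpow_natCast, ← Real.rpow_neg h0.le, ← Real.rpow_mul h0.le]
              congr 1
              rw [Nat.cast_sub (by omega)]; push_cast; ring
      have h3 : t ^ α * t ^ (-(((N:ℝ) - 1) * (p + 1))) ≤ Real.exp (-(α / 2 * (1 - t))) := by
        rw [← Real.rpow_add h0]
        calc t ^ (α + -(((N:ℝ) - 1) * (p + 1))) ≤ t ^ (α / 2) :=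
              Real.rpow_le_rpow_of_exponent_ge h0 ht.2.le (by nlinarith)
          _ ≤ (Real.exp (-(1 - t))) ^ (α / 2) := by
              refine Real.rpow_le_rpow h0.le ?_ (by positivity)
              have := Real.add_one_le_exp (-(1 - t)); linarith
          _ = _ := by rw [← Real.exp_mul]; congr 1; ring
      have h4 : t ^ (N - 1) ≤ 1 := pow_le_one₀ h0.le ht.2.le
      calc t ^ (N - 1) * (t ^ α * u (t • e0) ^ (p + 1)) ≤ t ^ α * u (t • e0) ^ (p + 1) :=
            mul_le_of_le_one_left (by positivity) h4
        _ ≤ t ^ α * (c1 ^ (p + 1) * α⁻¹ * (1 - t) ^ (p + 1) * t ^ (-(((N:ℝ) - 1) * (p + 1)))) := by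
            gcongr
        _ = (c1 ^ (p + 1) * α⁻¹ * (1 - t) ^ (p + 1)) * (t ^ α * t ^ (-(((N:ℝ) - 1) * (p + 1)))) := by ring
        _ ≤ (c1 ^ (p + 1) * α⁻¹ * (1 - t) ^ (p + 1)) * Real.exp (-(α / 2 * (1 - t))) := by gcongr
        _ = _ := by ring
  rw [hpol]
  calc _ ≤ sg N * (c1 ^ (p + 1) * α⁻¹ * ((2 / α) ^ (p + 2) * Real.Gamma (p + 2))) := by
        refine mul_le_mul_of_nonneg_left (hfin.trans ?_) hσ.le
        exact mul_le_mul_of_nonneg_left (beta_bound hp hα0) (by positivity)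
    _ = _ := by
        rw [Real.div_rpow (by norm_num) hα0.le, show -(p + 3) = -1 + -(p + 2) by ring,
          Real.rpow_add hα0 (-1) (-(p + 2)), Real.rpow_neg_one, Real.rpow_neg hα0.le]
        ring
end RadialB

section Lower
variable {N : ℕ} {p α : ℝ}

def SO (N : ℕ) (h : ℝ) : Set (E N) := {c | blk c = 0 ∧ ‖c‖ = 1 - 2 * h}
def SS (N : ℕ) (h : ℝ) : Set (E N) := ⋃ c ∈ SO N h, ball c h

lemma SS_open (h : ℝ) : IsOpen (SS N h) := isOpen_biUnion fun _ _ => isOpen_ball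

lemma mem_SS {h : ℝ} {x : E N} : x ∈ SS N h ↔ ∃ c ∈ SO N h, ‖x - c‖ < h := by
  simp [SS, dist_eq_norm]

lemma SS_inv (h : ℝ) (g : E N ≃ₗᵢ[ℝ] E N) (hg : IsSym g) (x : E N) (hx : x ∈ SS N h) :
    g x ∈ SS N h := by
  rw [mem_SS] at hx ⊢
  obtain ⟨c, ⟨h1, h2⟩, h3⟩ := hx
  refine ⟨g c, ⟨by rw [hg, h1], by rw [LinearIsometryEquiv.norm_map, h2]⟩, ?_⟩
  rw [← map_sub, LinearIsometryEquiv.norm_map]; exact h3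

lemma SS_iff (h : ℝ) (g : E N ≃ₗᵢ[ℝ] E N) (hg : IsSym g) (x : E N) :
    g x ∈ SS N h ↔ x ∈ SS N h := by
  refine ⟨fun hx => ?_, SS_inv h g hg x⟩
  simpa using SS_inv h g.symm hg.symm (g x) hx

lemma SS_norm {h : ℝ} {x : E N} (hx : x ∈ SS N h) : 1 - 3 * h ≤ ‖x‖ ∧ ‖x‖ ≤ 1 - h := by
  obtain ⟨c, ⟨_, h2⟩, h3⟩ := mem_SS.1 hx
  have h4 := abs_norm_sub_norm_le x c
  rw [abs_le] at h4
  constructor <;> linarith [h4.1, h4.2]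

lemma blk_zero {c : E N} (hc : blk c = 0) (i : Fin N) (hi : i.val < 2) : c i = 0 := by
  unfold blk at hc
  rw [Finset.sum_eq_zero_iff_of_nonneg (fun j _ => by split_ifs <;> positivity)] at hc
  have := hc i (Finset.mem_univ i)
  rw [if_pos hi] at this
  simpa using this

lemma SS_vol (hN : 4 ≤ N) {h : ℝ} (hh : 0 < h) :
    volume (SS N h) ≤ ENNReal.ofReal (2 ^ N * h ^ 2) := by
  set b : Fin N → ℝ := fun i => if i.val < 2 then h else 1 with hb
  have hb0 : ∀ i, 0 ≤ b i := fun i => by simp only [hb]; split_ifs <;> linarith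
  have hsub : SS N h ⊆ (@WithLp.ofLp 2 (Fin N → ℝ)) ⁻¹' (Icc (-b) b) := by
    intro x hx
    have hx1 := (SS_norm hx).2
    obtain ⟨c, ⟨h1, h2⟩, h3⟩ := mem_SS.1 hx
    have hk : ∀ i, |x i| ≤ b i := by
      intro i
      simp only [hb]
      split_ifs with hi
      · have h4 := coord_le_norm (x - c) i
        rw [PiLp.sub_apply, blk_zero h1 i hi, sub_zero] at h4
        linarith
      · exact (coord_le_norm x i).trans (by linarith)
    exact ⟨fun i => (abs_le.1 (hk i)).1, fun i => (abs_le.1 (hk i)).2⟩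
  refine (measure_mono hsub).trans ?_
  rw [(PiLp.volume_preserving_ofLp (Fin N)).measure_preimage measurableSet_Icc.nullMeasurableSet,
    Real.volume_Icc_pi, ← ENNReal.ofReal_prod_of_nonneg (fun i _ => by
      have := hb0 i; simp only [Pi.neg_apply]; linarith)]
  refine ENNReal.ofReal_le_ofReal (le_of_eq ?_)
  have : ∀ i, b i - (-b) i = 2 * b i := fun i => by simp only [Pi.neg_apply]; ring
  simp only [this]
  rw [Finset.prod_mul_distrib, Finset.prod_const, Finset.card_univ, Fintype.card_fin]
  congr 1
  obtain ⟨n, rfl⟩ : ∃ n, N = n + 2 := ⟨N - 2, by omega⟩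
  rw [Fin.prod_univ_succ, Fin.prod_univ_succ]
  simp [hb, sq]

lemma SO_nonempty (hN : 4 ≤ N) {h : ℝ} (hh : 2 * h ≤ 1) : ∃ c, c ∈ SO N h := by
  refine ⟨(1 - 2 * h) • (EuclideanSpace.single (⟨2, by omega⟩ : Fin N) 1 : E N), ?_, ?_⟩
  · unfold blk
    refine Finset.sum_eq_zero fun i _ => ?_
    split_ifs with hi
    · have : i ≠ ⟨2, by omega⟩ := fun hc => by rw [hc] at hi; simp at hi
      simp [this]
    · rfl
  · rw [norm_te, abs_of_nonneg (by linarith)]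

lemma aw_lower (hp : 1 < p) (hα : 6 ≤ α) {x : E N} (hx : x ∈ SS N (1 / α)) :
    ENNReal.ofReal (Real.exp (-(6 / (p + 1)))) ≤ aw α p x := by
  unfold aw
  refine ENNReal.ofReal_le_ofReal ?_
  have hα0 : 0 < α := by linarith
  have h1 := (SS_norm hx).1
  set s := 3 * (1 / α) with hs
  have hs0 : 0 ≤ s := by positivity
  have hs1 : s ≤ 1 / 2 := by
    rw [hs, mul_one_div, div_le_div_iff₀ hα0 (by norm_num)]; linarith
  have h2 : Real.exp (-(2 * s)) ≤ 1 - s := by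
    rw [Real.exp_neg, inv_le_comm₀ (Real.exp_pos _) (by linarith)]
    have h3 := Real.add_one_le_exp (2 * s)
    refine le_trans ?_ h3
    rw [inv_le_iff_one_le_mul₀ (by linarith)]
    nlinarith
  calc Real.exp (-(6 / (p + 1))) = Real.exp (-(2 * s)) ^ (α / (p + 1)) := by
        rw [← Real.exp_mul, hs]; congr 1; field_simp; norm_num
    _ ≤ ‖x‖ ^ (α / (p + 1)) := by
        refine Real.rpow_le_rpow (Real.exp_pos _).le (h2.trans h1) (by positivity)

lemma GE_lower (hN : 4 ≤ N) {h : ℝ} {x y : E N} (hh : 0 < h) (hx : ‖x‖ ≤ 1 - h)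
    (hy : ‖y‖ ≤ 1 - h) (hxy : ‖x - y‖ ≤ 2 * h) :
    ENNReal.ofReal (((5 : ℝ) ^ (-mm N) - 6 ^ (-mm N)) * h ^ (-((N : ℝ) - 2))) ≤ GE x y := by
  have hev : ∀ᶠ j in atTop, epsj j < h ^ 2 := epsj_tendsto.eventually_lt_const (by positivity)
  obtain ⟨j, hj⟩ := hev.exists
  refine le_trans (ENNReal.ofReal_le_ofReal (Ge_lower hN hh hx hy hxy (epsj_pos j) hj.le)) ?_
  exact le_iSup (fun j => ENNReal.ofReal (Ge (epsj j) x y)) j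

theorem MM_lower (hN : 4 ≤ N) (hp : 1 < p) :
    ∃ c : ℝ, 0 < c ∧ ∀ α : ℝ, p + 1 ≤ α → 6 ≤ α → MM N p α < ⊤ →
      MM N p α ≠ 0 ∧ c * α ^ (-4 : ℝ) ≤ (MM N p α).toReal ^ (p + 1) := by
  haveI : Nontrivial (E N) := by
    haveI : Nonempty (Fin N) := ⟨⟨0, by omega⟩⟩
    infer_instance
  have h56 := const56_pos hN
  have hp1 : 0 < p + 1 := by linarith
  have hp0 : 0 < p := by linarith
  set ω : ℝ := (volume (ball (0 : E N) 1)).toReal with hω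
  have hωp : 0 < ω := ENNReal.toReal_pos (measure_ball_pos _ _ one_pos).ne' measure_ball_lt_top.ne
  have hωe : volume (ball (0 : E N) 1) = ENNReal.ofReal ω := (ENNReal.ofReal_toReal measure_ball_lt_top.ne).symm
  set ca := Real.exp (-(6 / (p + 1))) with hca
  have hcap : 0 < ca := Real.exp_pos _
  set c56 := (5 : ℝ) ^ (-mm N) - 6 ^ (-mm N) with hc56
  set d := ca * ca * c56 * ω with hd
  have hdp : 0 < d := by positivity
  refine ⟨d ^ (p + 1) * (2 ^ N) ^ (-(p - 1)), by positivity, fun α hα hα6 hMt => ?_⟩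
  have hα0 : 0 < α := by linarith
  set h := 1 / α with hh
  have hh0 : 0 < h := by positivity
  have hh6 : h ≤ 1 / 6 := one_div_le_one_div_of_le (by norm_num) hα6
  set S := SS N h with hS
  set V := volume S with hV
  have hSm : MeasurableSet S := (SS_open h).measurableSet
  have hSb : S ⊆ ball 0 1 := fun x hx => by
    rw [mem_ball_zero_iff]; linarith [(SS_norm hx).2]
  obtain ⟨c0, hc0⟩ := SO_nonempty hN (h := h) (by linarith)
  have hbs : ∀ c ∈ SO N h, ball c h ⊆ S := fun c hc x hx => by
    rw [hS, mem_SS]; exact ⟨c, hc, mem_ball_iff_norm.1 hx⟩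
  have hV0 : V ≠ 0 := ((measure_ball_pos volume c0 hh0).trans_le (measure_mono (hbs c0 hc0))).ne'
  have hVle : V ≤ ENNReal.ofReal (2 ^ N * h ^ 2) := SS_vol hN hh0
  have hVt : V ≠ ⊤ := ne_top_of_le_ne_top ENNReal.ofReal_ne_top hVle
  set l := V ^ (-(p / (p + 1))) with hl
  set w : E N → ℝ≥0∞ := S.indicator (fun _ => l) with hw
  have hμS : μB N S = V := by
    unfold μB; rw [Measure.restrict_apply hSm, inter_eq_left.2 hSb]
  have hwW : InW p w := by
    refine ⟨measurable_const.indicator hSm, ?_, ?_⟩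
    · intro g hg x
      simp only [hw, indicator]
      by_cases hx : x ∈ S
      · rw [if_pos hx, if_pos ((SS_iff h g hg x).2 hx)]
      · rw [if_neg hx, if_neg (fun hc => hx ((SS_iff h g hg x).1 hc))]
    · have e : ∀ x, w x ^ ((p + 1) / p) = S.indicator (fun _ => V⁻¹) x := by
        intro x
        simp only [hw, indicator]
        split_ifs
        · rw [hl, ← ENNReal.rpow_mul, ← ENNReal.rpow_neg_one]
          congr 1; field_simp
        · exact ENNReal.zero_rpow_of_pos (by positivity)
      simp only [e]
      rw [lintegral_indicator hSm, lintegral_const, Measure.restrict_apply_univ, hμS,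
        ENNReal.inv_mul_cancel hV0 hVt]
  have hTE : ∀ x ∈ S, ENNReal.ofReal (d * h ^ 2) * l ≤ TE p α w x := by
    intro x hx
    obtain ⟨c, hc, hxc⟩ := mem_SS.1 hx
    have hbm : volume (ball c h) = ENNReal.ofReal (h ^ N * ω) := by
      rw [Measure.addHaar_ball _ _ hh0.le, hωe, ← ENNReal.ofReal_mul (by positivity)]
      simp
    unfold TE μB
    calc ENNReal.ofReal (d * h ^ 2) * l
        = (ENNReal.ofReal ca * ENNReal.ofReal ca * ENNReal.ofReal (c56 * h ^ (-((N:ℝ) - 2))) * l) *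
            volume (ball c h) := by
          rw [hbm, mul_right_comm _ l, ← ENNReal.ofReal_mul hcap.le, ← ENNReal.ofReal_mul (by positivity),
            ← ENNReal.ofReal_mul (by positivity)]
          congr 2
          have : h ^ (-((N:ℝ) - 2)) * h ^ N = h ^ 2 := by
            rw [← Real.rpow_natCast h N, ← Real.rpow_natCast h 2, ← Real.rpow_add hh0]
            congr 1; push_cast; ring
          rw [hd, ← this]; ring
      _ = ∫⁻ y in ball c h, (ENNReal.ofReal ca * ENNReal.ofReal ca * ENNReal.ofReal (c56 * h ^ (-((N:ℝ) - 2))) * l) := by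
          rw [setLIntegral_const]
      _ ≤ ∫⁻ y in ball c h, KE p α x y * w y := by
          refine setLIntegral_mono' measurableSet_ball fun y hy => ?_
          have hyS := hbs c hc hy
          have hyc : ‖y - c‖ < h := mem_ball_iff_norm.1 hy
          have e1 : w y = l := by simp only [hw]; rw [indicator_of_mem hyS]
          rw [e1]
          unfold KE
          refine mul_le_mul' (mul_le_mul' (mul_le_mul' (aw_lower hp hα6 hx) (aw_lower hp hα6 hyS)) ?_) le_rfl
          refine GE_lower hN hh0 (SS_norm hx).2 (SS_norm hyS).2 ?_
          calc ‖x - y‖ = ‖(x - c) - (y - c)‖ := by congr 1; abel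
            _ ≤ ‖x - c‖ + ‖y - c‖ := norm_sub_le _ _
            _ ≤ 2 * h := by linarith
      _ ≤ ∫⁻ y in ball 0 1, KE p α x y * w y :=
          lintegral_mono_set ((hbs c hc).trans hSb)
  have hlow : ENNReal.ofReal (d * h ^ 2) * l * (l * V) ≤ MM N p α := by
    refine le_trans ?_ (le_MM hwW hwW)
    calc ENNReal.ofReal (d * h ^ 2) * l * (l * V)
        = ∫⁻ x in S, l * (ENNReal.ofReal (d * h ^ 2) * l) ∂(μB N) := by
          rw [lintegral_const, Measure.restrict_apply_univ, hμS]; ring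
      _ ≤ ∫⁻ x in S, w x * TE p α w x ∂(μB N) := by
          refine setLIntegral_mono' hSm fun x hx => ?_
          have e1 : w x = l := by simp only [hw]; rw [indicator_of_mem hx]
          rw [e1]
          exact mul_le_mul' le_rfl (hTE x hx)
      _ ≤ _ := setLIntegral_le_lintegral _ _
  have hp1' : 0 ≤ (p - 1) / (p + 1) := div_nonneg (by linarith) hp1.le
  have hlV : l * (l * V) = V ^ (-((p - 1) / (p + 1))) := by
    have : V = V ^ (1:ℝ) := (ENNReal.rpow_one V).symm
    rw [hl]
    nth_rw 3 [this]
    rw [← ENNReal.rpow_add _ _ hV0 hVt, ← ENNReal.rpow_add _ _ hV0 hVt]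
    congr 1; field_simp; ring
  have hfin : ENNReal.ofReal (d * h ^ 2 * (2 ^ N * h ^ 2) ^ (-((p - 1) / (p + 1)))) ≤ MM N p α := by
    refine le_trans ?_ hlow
    rw [mul_assoc (ENNReal.ofReal (d * h ^ 2)), hlV, ENNReal.ofReal_mul (by positivity), ← ENNReal.ofReal_rpow_of_pos (by positivity)]
    refine mul_le_mul' le_rfl ?_
    rw [ENNReal.rpow_neg, ENNReal.rpow_neg]
    exact ENNReal.inv_le_inv.2 (ENNReal.rpow_le_rpow hVle hp1')
  set m := d * h ^ 2 * (2 ^ N * h ^ 2) ^ (-((p - 1) / (p + 1))) with hm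
  have hmp : 0 < m := by positivity
  refine ⟨((ENNReal.ofReal_pos.2 hmp).trans_le hfin).ne', ?_⟩
  have hmM : m ≤ (MM N p α).toReal := (ENNReal.ofReal_le_iff_le_toReal hMt.ne).1 hfin
  refine le_trans (le_of_eq ?_) (Real.rpow_le_rpow hmp.le hmM hp1.le)
  have e1 : m ^ (p + 1) = (d * h ^ 2) ^ (p + 1) *
      ((2 ^ N * h ^ 2) ^ (-((p - 1) / (p + 1)))) ^ (p + 1) :=
    Real.mul_rpow (by positivity) (by positivity)
  have e2 : (d * h ^ 2) ^ (p + 1) = d ^ (p + 1) * (h ^ 2) ^ (p + 1) :=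
    Real.mul_rpow (by positivity) (by positivity)
  have e3 : (((2:ℝ) ^ N * h ^ 2) ^ (-((p - 1) / (p + 1)))) ^ (p + 1) =
      (2 ^ N) ^ (-(p - 1)) * (h ^ 2) ^ (-(p - 1)) := by
    rw [← Real.rpow_mul (by positivity), show -((p - 1) / (p + 1)) * (p + 1) = -(p - 1) by field_simp]
    exact Real.mul_rpow (by positivity) (by positivity)
  rw [e1, e2, e3, ← Real.rpow_natCast h 2, ← Real.rpow_mul hh0.le, ← Real.rpow_mul hh0.le]
  have e : α ^ (-4:ℝ) = h ^ (((2:ℕ):ℝ) * (p + 1)) * h ^ (((2:ℕ):ℝ) * -(p - 1)) := by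
    rw [← Real.rpow_add hh0, show ((2:ℕ):ℝ) * (p + 1) + ((2:ℕ):ℝ) * -(p - 1) = 4 by push_cast; ring, hh,
      one_div, Real.inv_rpow hα0.le, Real.rpow_neg hα0.le]
  rw [e]; ring
end Lower

section Final
variable {N : ℕ} {p α : ℝ}

lemma gu_isom (g : E N ≃ₗᵢ[ℝ] E N) (f : E N → ℝ) (x : E N) :
    gu f (g x) = gu (fun y => f (g y)) x := by
  unfold gu μB
  have hpre : g ⁻¹' (ball (0 : E N) 1) = ball 0 1 := by
    ext y; simp
  have h := g.measurePreserving.setIntegral_preimage_emb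
    g.toHomeomorph.measurableEmbedding (fun y => Ge 0 (g x) y * f y) (ball (0 : E N) 1)
  rw [hpre] at h
  rw [← h]
  simp only [Ge_isom]

lemma lap_const_mul {U : Set (E N)} (hU : IsOpen U) {F : E N → ℝ} (hF : ContDiffOn ℝ 2 F U)
    (c : ℝ) {x : E N} (hx : x ∈ U) : lap (fun x => c * F x) x = c * lap F x := by
  obtain ⟨G, H, h1, h2⟩ := C2_D1 hU hF
  rw [(h1.const_mul c).lap_eq hU (fun i => (h2 i).const_mul c) hx, h1.lap_eq hU h2 hx,
    Finset.mul_sum]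

lemma exists_isom {x z : E N} (h : ‖x‖ = ‖z‖) : ∃ g : E N ≃ₗᵢ[ℝ] E N, g x = z :=
  ⟨(ℝ ∙ (x - z))ᗮ.reflection, Submodule.reflection_sub h⟩

lemma infinite_values (hN : 4 ≤ N) {u : E N → ℝ} (hc : ContinuousOn u (closedBall 0 1)) {x y : E N}
    (hx : ‖x‖ < 1) (hxy : ‖x‖ = ‖y‖) (hne : u x ≠ u y) : (u '' sphere 0 ‖x‖).Infinite := by
  have hrank : 1 < Module.rank ℝ (E N) := by
    rw [rank_eq_card_basis (EuclideanSpace.basisFun (Fin N) ℝ).toBasis, Fintype.card_fin]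
    exact_mod_cast (by omega : 1 < N)
  have h1 : IsPreconnected (u '' sphere 0 ‖x‖) :=
    (isPreconnected_sphere hrank 0 ‖x‖).image u (hc.mono fun z hz => by
      rw [mem_sphere_zero_iff_norm] at hz
      rw [mem_closedBall_zero_iff, hz]; exact hx.le)
  have h2 : uIcc (u x) (u y) ⊆ u '' sphere 0 ‖x‖ :=
    h1.ordConnected.uIcc_subset ⟨x, by simp, rfl⟩ ⟨y, by simp [hxy], rfl⟩
  refine Set.Infinite.mono h2 ?_
  exact Set.Icc_infinite (inf_lt_sup.2 hne)

lemma assemble (hN : 4 ≤ N) (hp : 1 < p) {M : ℝ} (hM : 0 < M) {f : E N → ℝ}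
    (h : HalfSol p α M f f) (hpos : ∀ x ∈ ball (0 : E N) 1, 0 < gu f x)
    (hf1 : ContDiffOn ℝ 1 f (ball 0 1)) (hr : ¬ RadialOn (gu f)) (k : ℕ) :
    ∃ U : Fin k → (E N → ℝ),
        Function.Injective U ∧
        ∀ i, ContinuousOn (U i) (closedBall 0 1) ∧
          ContDiffOn ℝ 2 (U i) (ball 0 1) ∧
          (∀ x ∈ ball (0 : E N) 1, 0 < U i x) ∧
          (∀ x : E N, ‖x‖ = 1 → U i x = 0) ∧
          (∀ x ∈ ball (0 : E N) 1, -lap (U i) x = ‖x‖ ^ α * U i x ^ p) ∧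
          ∃ x y : E N, x ∈ ball (0 : E N) 1 ∧ y ∈ ball (0 : E N) 1 ∧
            ‖x‖ = ‖y‖ ∧ U i x ≠ U i y := by
  have hκ := kap_pos hN
  obtain ⟨R, hR⟩ := h.bdd
  have hp1 : 0 < p - 1 := by linarith
  unfold RadialOn at hr
  push Not at hr
  obtain ⟨x0, hx0, y0, hy0, hxy, hne⟩ := hr
  have hx0' : ‖x0‖ < 1 := mem_ball_zero_iff.1 hx0
  have hy0' : ‖y0‖ < 1 := mem_ball_zero_iff.1 hy0
  have hinf := infinite_values hN (gu_cont hN h.meas hR) hx0' hxy hne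
  have emb := hinf.natEmbedding
  have hz : ∀ n : ℕ, ∃ g : E N ≃ₗᵢ[ℝ] E N, gu f (g x0) = (emb n : ℝ) := by
    intro n
    obtain ⟨z, hz, hz2⟩ := (emb n).2
    obtain ⟨g, hg⟩ := exists_isom (x := x0) (z := z) (mem_sphere_zero_iff_norm.1 hz).symm
    exact ⟨g, by rw [hg, hz2]⟩
  choose g hg using hz
  set C : ℝ := (kap N * M ^ (-p)) ^ (1 / (p - 1)) with hC
  have hC0 : 0 < C := by positivity
  have hCp : C ^ p = C * (kap N * M ^ (-p)) := by
    have h1 : C ^ (p - 1) = kap N * M ^ (-p) := by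
      rw [hC, ← Real.rpow_mul (by positivity), one_div, inv_mul_cancel₀ hp1.ne', Real.rpow_one]
    rw [← h1, ← Real.rpow_one_add' hC0.le (by linarith)]
    congr 1; ring
  have hball : ∀ (g : E N ≃ₗᵢ[ℝ] E N), ∀ x ∈ ball (0 : E N) 1, g x ∈ ball (0 : E N) 1 := by
    intro g x hx
    rw [mem_ball_zero_iff] at hx ⊢
    rwa [LinearIsometryEquiv.norm_map]
  refine ⟨fun i x => C * gu f (g i.val x), ?_, ?_⟩
  · intro i j hij
    have h1 := congrFun hij x0
    simp only [hg] at h1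
    have h2 := mul_left_cancel₀ hC0.ne' h1
    exact Fin.ext (emb.injective (Subtype.ext h2))
  · intro i
    set G := g i.val with hG
    set f' : E N → ℝ := fun y => f (G y) with hf'
    have hfm : Measurable f' := h.meas.comp G.continuous.measurable
    have hR' : ∀ y, |f' y| ≤ R := fun y => hR _
    have hf1' : ContDiffOn ℝ 1 f' (ball 0 1) :=
      hf1.comp G.contDiff.contDiffOn (hball G)
    obtain ⟨c2, l2⟩ := gu_C2 hN hfm hR' hf1'
    have hfun : (fun x => C * gu f (G x)) = fun x => C * gu f' x := by
      funext x; rw [gu_isom]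
    beta_reduce
    rw [← hG, hfun]
    refine ⟨continuousOn_const.mul (gu_cont hN hfm hR'), contDiffOn_const.mul c2, ?_, ?_, ?_, ?_⟩
    · intro x hx
      exact mul_pos hC0 (hpos _ (hball G x hx))
    · intro x hx
      rw [gu_boundary _ (by rwa [LinearIsometryEquiv.norm_map]), mul_zero]
    · intro x hx
      have hu := hpos _ (hball G x hx)
      rw [lap_const_mul isOpen_ball c2 C hx, l2 x hx]
      simp only [hf']
      rw [h.eq _ (hball G x hx), LinearIsometryEquiv.norm_map]
      rw [Real.mul_rpow hC0.le hu.le, hCp, Real.div_rpow hu.le hM.le, Real.rpow_neg hM.le]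
      ring
    · refine ⟨G.symm x0, G.symm y0, hball _ _ hx0, hball _ _ hy0, ?_, ?_⟩
      · simp [hxy]
      · simpa [hC0.ne'] using hne

end Final

/-- Badiale–Serra multiplicity: for N ≥ 4, 1 < p < (N+1)/(N-3) and α large, the Hénon
problem has at least ⌊N/2⌋ - 1 pairwise distinct non-radial positive classical solutions. -/
theorem stmt8 {N : ℕ} (hN : 4 ≤ N) (p : ℝ) (hp : 1 < p)
    (hsup : p < ((N : ℝ) + 1) / ((N : ℝ) - 3)) :
    ∃ α₀ : ℝ, 0 < α₀ ∧ ∀ α : ℝ, α₀ < α →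
      ∃ U : Fin (N / 2 - 1) → (E N → ℝ),
        Function.Injective U ∧
        ∀ i, ContinuousOn (U i) (closedBall 0 1) ∧
          ContDiffOn ℝ 2 (U i) (ball 0 1) ∧
          (∀ x ∈ ball (0 : E N) 1, 0 < U i x) ∧
          (∀ x : E N, ‖x‖ = 1 → U i x = 0) ∧
          (∀ x ∈ ball (0 : E N) 1, -lap (U i) x = ‖x‖ ^ α * U i x ^ p) ∧
          ∃ x y : E N, x ∈ ball (0 : E N) 1 ∧ y ∈ ball (0 : E N) 1 ∧
            ‖x‖ = ‖y‖ ∧ U i x ≠ U i y := by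
  obtain ⟨θ, k, A, hθ, hθ1, hk, hks, hA, hkA, hkw⟩ := kernel_package hN hp hsup
  obtain ⟨C, hC, hup⟩ := radial_upper hN hp
  obtain ⟨c, hc, hlow⟩ := MM_lower (N := N) hN hp
  have hp1 : 0 < p - 1 := by linarith
  refine ⟨max (max (p + 1) 6) (max (2 * ((N:ℝ) - 1) * (p + 1)) ((C / c) ^ (1 / (p - 1)))), ?_, ?_⟩
  · exact lt_of_lt_of_le (by norm_num : (0:ℝ) < 6) ((le_max_right _ _).trans (le_max_left _ _))
  intro α hα
  simp only [max_lt_iff] at hα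
  obtain ⟨⟨ha1, ha2⟩, ha3, ha4⟩ := hα
  have hα0 : 0 < α := by linarith
  let P : Pkg N p α := ⟨hN, hp, ha1.le, θ, k, A, hθ, hθ1, hk, hks, hA, hkA, hkw α ha1.le⟩
  have hMt := P.MM_lt_top
  obtain ⟨hM0, hMl⟩ := hlow α ha1.le ha2.le hMt
  have hMp : 0 < (MM N p α).toReal := ENNReal.toReal_pos hM0 hMt.ne
  obtain ⟨f, hf, hpos, hf1⟩ := EL_sol P hM0
  refine assemble hN hp hMp hf hpos hf1 (fun hr => ?_) _
  have h1 := hMl.trans (hup α _ f ha1.le ha3.le hMp hf hf1 hr)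
  have h2 : C / c < α ^ (p - 1) := by
    have := Real.rpow_lt_rpow (by positivity) ha4 hp1
    rwa [← Real.rpow_mul (by positivity), one_div, inv_mul_cancel₀ hp1.ne', Real.rpow_one] at this
  have h3 : α ^ (-4:ℝ) = α ^ (p - 1) * α ^ (-(p + 3)) := by
    rw [← Real.rpow_add hα0]; congr 1; ring
  rw [h3, ← mul_assoc] at h1
  have h4 := le_of_mul_le_mul_right h1 (by positivity)
  rw [div_lt_iff₀ hc] at h2
  linarith
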